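/- Let δ = δ_P be the conformal dimension of the prime Cantor set Λ_P. For any doubling dimension function ψ such that Ψ(r) = r^{-δ}ψ(r) is monotonic, the ψ-dimensional Hausdorff measure of Λ_P is either 0 or ∞: H^ψ(Λ_P) ∈ {0, ∞}. -/

import Mathlib

open MeasureTheory Metric Filter Set
open scoped ENNReal Topology NNReal

noncomputable section

/-- The Gauss map `φ_a(x) = 1/(a+x)`. -/
def gaussMap (a : ℕ) (x : ℝ) : ℝ := 1 / (a + x)

/-- `φ_ω = φ_{ω₁} ∘ ⋯ ∘ φ_{ω_n}` for a finite word `ω`. -/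
def wordMap : List ℕ → ℝ → ℝ
  | [] => fun x => x
  | a :: ω => fun x => gaussMap a (wordMap ω x)

/-- `‖φ_ω'‖ = sup_{x ∈ [0,1]} |φ_ω'(x)|`. -/
def derivNorm (ω : List ℕ) : ℝ := ⨆ x : Icc (0 : ℝ) 1, |deriv (wordMap ω) (x : ℝ)|

/-- The cylinder `[ω] = φ_ω([0,1])`. -/
def cyl (ω : List ℕ) : Set ℝ := wordMap ω '' Icc 0 1

/-- The set of finite words over the alphabet `E`. -/
def words (E : Set ℕ) : Set (List ℕ) := {ω | ∀ a ∈ ω, a ∈ E}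

/-- The coding map `π(ω) = [0; ω₀, ω₁, …]`. -/
def codingMap (ω : ℕ → ℕ) : ℝ :=
  limUnder atTop fun n => wordMap (List.ofFn fun i : Fin n => ω i) 0

/-- The limit set `Λ_E`. -/
def limitSet (E : Set ℕ) : Set ℝ := codingMap '' {ω | ∀ n, ω n ∈ E}

/-- The pressure function of the Gauss IFS on the alphabet `E`. -/
def pressure (E : Set ℕ) (s : ℝ) : ℝ :=
  limUnder atTop fun n : ℕ =>
    (n : ℝ)⁻¹ * Real.log (∑' ω : Fin n → E, derivNorm (List.ofFn fun i => (ω i : ℕ)) ^ s)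

/-- `μ` is the `δ`-conformal measure of the Gauss IFS on the alphabet `E`. -/
def IsConformal (E : Set ℕ) (δ : ℝ) (μ : Measure ℝ) : Prop :=
  IsProbabilityMeasure μ ∧ μ (limitSet E)ᶜ = 0 ∧
    ∀ A : Set ℝ, A ⊆ Icc 0 1 → MeasurableSet A →
      μ A = ∑' a : E, ENNReal.ofReal (∫ x in gaussMap (a : ℕ) ⁻¹' A, |deriv (gaussMap (a : ℕ)) x| ^ δ ∂μ)

/-- The set of prime numbers. -/
def primes : Set ℕ := {p | p.Prime}

/-- `μ(J) = ∑_{a ∈ J} μ([a])` for a set of letters `J`. -/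
def cylMass (μ : Measure ℝ) (J : Set ℕ) : ℝ≥0∞ := ∑' a : J, μ (cyl [(a : ℕ)])

/-- A dimension function: continuous, increasing, positive, with `ψ(0⁺) = 0`. -/
def IsDimFun (ψ : ℝ → ℝ) : Prop :=
  ContinuousOn ψ (Ioi 0) ∧ MonotoneOn ψ (Ioi 0) ∧ (∀ r : ℝ, 0 < r → 0 < ψ r) ∧
    Tendsto ψ (𝓝[>] (0 : ℝ)) (𝓝 0)

/-- A doubling function. -/
def IsDoubling (ψ : ℝ → ℝ) : Prop :=
  ∀ C₁ : ℝ, 1 ≤ C₁ → ∃ C₂ : ℝ, 1 ≤ C₂ ∧ ∀ x y : ℝ, 0 < x → 0 < y →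
    C₁⁻¹ ≤ x / y → x / y ≤ C₁ → C₂⁻¹ ≤ ψ x / ψ y ∧ ψ x / ψ y ≤ C₂

open Classical in
/-- The `ψ`-dimensional Hausdorff measure `H^ψ`. -/
def hausdorffPsi (ψ : ℝ → ℝ) : Measure ℝ :=
  Measure.mkMetric fun d => if d = 0 then 0 else ENNReal.ofReal (ψ d.toReal)

/-- `H^ψ(μ) = inf {H^ψ(A) : A Borel, μ(ℝ∖A) = 0}`. -/
def hausdorffPsiOf (ψ : ℝ → ℝ) (μ : Measure ℝ) : ℝ≥0∞ :=
  ⨅ (A : Set ℝ) (_ : MeasurableSet A) (_ : μ Aᶜ = 0), hausdorffPsi ψ A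

/-- The `ψ`-dimensional packing pre-measure `P̃^ψ`. -/
def packingPre (ψ : ℝ → ℝ) (A : Set ℝ) : ℝ≥0∞ :=
  ⨅ (ε : ℝ) (_ : 0 < ε),
    ⨆ (D : Set (ℝ × ℝ)) (_ : D.Countable)
      (_ : ∀ p ∈ D, p.1 ∈ A ∧ 0 < p.2 ∧ 2 * p.2 ≤ ε)
      (_ : D.PairwiseDisjoint fun p => closedBall p.1 p.2),
      ∑' p : D, ENNReal.ofReal (ψ (2 * (p : ℝ × ℝ).2))

/-- The `ψ`-dimensional packing measure `P^ψ`. -/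
def packingPsi (ψ : ℝ → ℝ) (A : Set ℝ) : ℝ≥0∞ :=
  ⨅ (S : ℕ → Set ℝ) (_ : A ⊆ ⋃ i, S i), ∑' i, packingPre ψ (S i)

/-- `P^ψ(μ) = inf {P^ψ(A) : A Borel, μ(ℝ∖A) = 0}`. -/
def packingPsiOf (ψ : ℝ → ℝ) (μ : Measure ℝ) : ℝ≥0∞ :=
  ⨅ (A : Set ℝ) (_ : MeasurableSet A) (_ : μ Aᶜ = 0), packingPsi ψ A

/-- Assumption C with constant `λ`: `μ({a : λ⁻¹r < ‖φ_a'‖ ≤ r}) ≍ μ({a : ‖φ_a'‖ ≤ r})`. -/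
def AssumptionC (E : Set ℕ) (μ : Measure ℝ) (lam : ℝ) : Prop :=
  ∃ c C : ℝ≥0∞, 0 < c ∧ C ≠ ⊤ ∧ ∀ r : ℝ, 0 < r → r ≤ 1 →
    c * cylMass μ {a ∈ E | derivNorm [a] ≤ r} ≤
        cylMass μ {a ∈ E | lam⁻¹ * r < derivNorm [a] ∧ derivNorm [a] ≤ r} ∧
      cylMass μ {a ∈ E | lam⁻¹ * r < derivNorm [a] ∧ derivNorm [a] ≤ r} ≤
        C * cylMass μ {a ∈ E | derivNorm [a] ≤ r}

/-- `f` is regularly varying with exponent `s`. -/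
def RegVarying (f : ℝ → ℝ) (s : ℝ) : Prop :=
  ∀ a : ℝ, 1 < a → Tendsto (fun x => f (a * x) / f x) atTop (𝓝 (a ^ s))

/-- Assumption 1: `#(E ∩ [N,2N]) ≍ f(N)`. -/
def Assumption1 (E : Set ℕ) (f : ℝ → ℝ) : Prop :=
  ∃ c C : ℝ, 0 < c ∧ 0 < C ∧ ∀ N : ℕ, 1 ≤ N →
    c * f N ≤ ((E ∩ Icc N (2 * N)).ncard : ℝ) ∧ ((E ∩ Icc N (2 * N)).ncard : ℝ) ≤ C * f N

/-- Assumption 3: the Lyapunov exponent `-∑_{a∈E} μ(a) log ‖φ_a'‖` is finite. -/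
def Assumption3 (E : Set ℕ) (μ : Measure ℝ) : Prop :=
  Summable fun a : E => (μ (cyl [(a : ℕ)])).toReal * Real.log (derivNorm [(a : ℕ)])

/-- `W_k = {ω : λ^{-(k+1)} < ‖φ_ω'‖ ≤ λ^{-k}}`. -/
def W (lam : ℝ) (k : ℕ) : Set (List ℕ) :=
  {ω | lam ^ (-(k : ℝ) - 1) < derivNorm ω ∧ derivNorm ω ≤ lam ^ (-(k : ℝ))}

/-- `A_k = ⋃ {[ωa] : ω ∈ W_k ∩ E^*, a ∈ J}`. -/
def cylUnion (E : Set ℕ) (lam : ℝ) (k : ℕ) (J : Set ℕ) : Set ℝ :=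
  ⋃ ω ∈ W lam k ∩ words E, ⋃ a ∈ J, cyl (ω ++ [a])

/-- `S_J`: sequences in `E^ℕ` with infinitely many `(n,k)` such that `ω|n ∈ W_k`, `ω_{n+1} ∈ J_k`. -/
def Sset (E : Set ℕ) (lam : ℝ) (J : ℕ → Set ℕ) : Set (ℕ → ℕ) :=
  {ω | (∀ n, ω n ∈ E) ∧
    {p : ℕ × ℕ | (List.ofFn fun i : Fin p.1 => ω i) ∈ W lam p.2 ∧ ω p.1 ∈ J p.2}.Infinite}

/-- The upper density `D̄^ψ_μ(x)`. -/
def upperDensity (ψ : ℝ → ℝ) (μ : Measure ℝ) (x : ℝ) : ℝ≥0∞ :=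
  limsup (fun r => μ (closedBall x r) / ENNReal.ofReal (ψ r)) (𝓝[>] (0 : ℝ))

/-- The lower density `D̲^ψ_μ(x)`. -/
def lowerDensity (ψ : ℝ → ℝ) (μ : Measure ℝ) (x : ℝ) : ℝ≥0∞ :=
  liminf (fun r => μ (closedBall x r) / ENNReal.ofReal (ψ r)) (𝓝[>] (0 : ℝ))

/-- `J_{k,α,1} = {a ∈ E : ∃ r ∈ [‖φ_a'‖,1], r^{-δ} μ(B([a],r)) ≥ α Ψ(λ^{-k} r)}`. -/
def JsetH (E : Set ℕ) (δ : ℝ) (μ : Measure ℝ) (Ψ : ℝ → ℝ) (lam : ℝ) (k : ℕ) (α : ℝ) : Set ℕ :=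
  {a ∈ E | ∃ r : ℝ, derivNorm [a] ≤ r ∧ r ≤ 1 ∧
    ENNReal.ofReal (α * r ^ δ * Ψ (lam ^ (-(k : ℝ)) * r)) ≤ μ (cthickening r (cyl [a]))}

/-- `J_{k,α,-1} = {a ∈ E : ∃ r ∈ [‖φ_a'‖,1], r^{-δ} μ(B([a],r)) ≤ α Ψ(λ^{-k} r)}`. -/
def JsetP (E : Set ℕ) (δ : ℝ) (μ : Measure ℝ) (Ψ : ℝ → ℝ) (lam : ℝ) (k : ℕ) (α : ℝ) : Set ℕ :=
  {a ∈ E | ∃ r : ℝ, derivNorm [a] ≤ r ∧ r ≤ 1 ∧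
    μ (cthickening r (cyl [a])) ≤ ENNReal.ofReal (α * r ^ δ * Ψ (lam ^ (-(k : ℝ)) * r))}

/-- `S_{α,1}`. -/
def SsetH (E : Set ℕ) (δ : ℝ) (μ : Measure ℝ) (Ψ : ℝ → ℝ) (lam : ℝ) (α : ℝ) : Set (ℕ → ℕ) :=
  {ω | {p : ℕ × ℕ | (List.ofFn fun i : Fin p.1 => ω i) ∈ W lam p.2 ∧
    ω p.1 ∈ JsetH E δ μ Ψ lam p.2 α}.Infinite}

/-- `S_{α,-1}`. -/
def SsetP (E : Set ℕ) (δ : ℝ) (μ : Measure ℝ) (Ψ : ℝ → ℝ) (lam : ℝ) (α : ℝ) : Set (ℕ → ℕ) :=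
  {ω | {p : ℕ × ℕ | (List.ofFn fun i : Fin p.1 => ω i) ∈ W lam p.2 ∧
    ω p.1 ∈ JsetP E δ μ Ψ lam p.2 α}.Infinite}

/-- `M(x,pre,r) = ∑_{a ∈ E, [pre·a] ⊆ B(x,r)} μ([pre·a])`. -/
def Mform (E : Set ℕ) (μ : Measure ℝ) (x : ℝ) (pre : List ℕ) (r : ℝ) : ℝ≥0∞ :=
  ∑' a : {a : ℕ // a ∈ E ∧ cyl (pre ++ [a]) ⊆ closedBall x r}, μ (cyl (pre ++ [(a : ℕ)]))

/-- The absolute value of the derivative of `wordMap ω`, given by the chain rule. -/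
def derivAbs : List ℕ → ℝ → ℝ
  | [] => fun _ => 1
  | a :: ω => fun x => (1 / (a + wordMap ω x)) ^ 2 * derivAbs ω x

/-- Words all of whose letters are positive. -/
def PosWord (ω : List ℕ) : Prop := ∀ a ∈ ω, 1 ≤ a

lemma PosWord.append {ω τ : List ℕ} (hω : PosWord ω) (hτ : PosWord τ) : PosWord (ω ++ τ) := by
  intro a ha
  rcases List.mem_append.1 ha with h | h
  exacts [hω a h, hτ a h]

lemma posWord_singleton {a : ℕ} (ha : 1 ≤ a) : PosWord [a] := by
  intro b hb
  rw [List.mem_singleton.1 hb]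
  exact ha

lemma wordMap_append (ω τ : List ℕ) (x : ℝ) :
    wordMap (ω ++ τ) x = wordMap ω (wordMap τ x) := by
  induction ω with
  | nil => rfl
  | cons a ω ih => simp only [List.cons_append, wordMap, ih]

lemma derivAbs_append (ω τ : List ℕ) (x : ℝ) :
    derivAbs (ω ++ τ) x = derivAbs ω (wordMap τ x) * derivAbs τ x := by
  induction ω with
  | nil => simp [derivAbs]
  | cons a ω ih => simp only [List.cons_append, derivAbs, ih, wordMap_append, mul_assoc]

lemma wordMap_moebius (ω : List ℕ) (h : PosWord ω) :
    ∃ A B C D : ℝ, 0 ≤ A ∧ 0 ≤ B ∧ 1 ≤ C ∧ 0 ≤ D ∧ D ≤ C ∧ B + D ≤ A + C ∧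
      |A * D - B * C| = 1 ∧
      ∀ x, 0 ≤ x → wordMap ω x = (A + B * x) / (C + D * x) ∧
        derivAbs ω x = 1 / (C + D * x) ^ 2 := by
  induction ω with
  | nil => exact ⟨0, 1, 1, 0, by simp [wordMap, derivAbs]⟩
  | cons a ω ih =>
    obtain ⟨A, B, C, D, hA, hB, hC, hD, hDC, hs, hdet, hx⟩ :=
      ih fun b hb => h b (List.mem_cons_of_mem _ hb)
    have ha : (1 : ℝ) ≤ a := by exact_mod_cast h a List.mem_cons_self
    refine ⟨C, D, a * C + A, a * D + B, by linarith, hD, by nlinarith, by positivity,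
      by nlinarith, by nlinarith, ?_, fun x hx0 => ?_⟩
    · rw [← hdet, ← abs_neg]
      congr 1
      ring
    · obtain ⟨h1, h2⟩ := hx x hx0
      have hp : 0 < C + D * x := by positivity
      have hq : 0 < a * C + A + (a * D + B) * x := by positivity
      have hne : (a : ℝ) * (C + D * x) + (A + B * x) ≠ 0 := by
        have : (a : ℝ) * (C + D * x) + (A + B * x) = a * C + A + (a * D + B) * x := by ring
        rw [this]
        exact hq.ne'
      have key : 1 / ((a : ℝ) + (A + B * x) / (C + D * x)) =
          (C + D * x) / (a * C + A + (a * D + B) * x) := by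
        rw [div_eq_div_iff (by rw [← mul_div_cancel_right₀ (a : ℝ) hp.ne', ← add_div]
                               exact div_ne_zero hne hp.ne') hq.ne']
        field_simp
        ring
      simp only [wordMap, gaussMap, derivAbs, h1, h2, key]
      refine ⟨trivial, ?_⟩
      field_simp

lemma wordMap_geometry (ω : List ℕ) (h : PosWord ω) :
    ∃ C D : ℝ, 1 ≤ C ∧ 0 ≤ D ∧ D ≤ C ∧
      (∀ x, 0 ≤ x → derivAbs ω x = 1 / (C + D * x) ^ 2) ∧
      ∀ x y, 0 ≤ x → 0 ≤ y →
        |wordMap ω x - wordMap ω y| = |x - y| / ((C + D * x) * (C + D * y)) := by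
  obtain ⟨A, B, C, D, hA, hB, hC, hD, hDC, hs, hdet, hx⟩ := wordMap_moebius ω h
  refine ⟨C, D, hC, hD, hDC, fun x hx0 => (hx x hx0).2, fun x y hx0 hy0 => ?_⟩
  have hp : 0 < C + D * x := by positivity
  have hq : 0 < C + D * y := by positivity
  rw [(hx x hx0).1, (hx y hy0).1, div_sub_div _ _ hp.ne' hq.ne', abs_div,
    abs_of_pos (mul_pos hp hq)]
  congr 1
  have : (A + B * x) * (C + D * y) - (C + D * x) * (A + B * y) = -((A * D - B * C) * (x - y)) := by
    ring
  rw [this, abs_neg, abs_mul, hdet, one_mul]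

/-- The contraction ratio `‖φ_ω'‖` of `wordMap ω`. -/
def rho (ω : List ℕ) : ℝ := derivAbs ω 0

section geometry

variable {ω : List ℕ} (h : PosWord ω) {x y : ℝ}

include h

lemma rho_pos : 0 < rho ω := by
  obtain ⟨C, D, hC, hD, hDC, hd, -⟩ := wordMap_geometry ω h
  rw [rho, hd 0 le_rfl]
  have : 0 < C + D * 0 := by linarith
  positivity

lemma rho_le_one : rho ω ≤ 1 := by
  obtain ⟨C, D, hC, hD, hDC, hd, -⟩ := wordMap_geometry ω h
  rw [rho, hd 0 le_rfl, div_le_one (by nlinarith)]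
  nlinarith

lemma derivAbs_le (hx : 0 ≤ x) : derivAbs ω x ≤ rho ω := by
  obtain ⟨C, D, hC, hD, hDC, hd, -⟩ := wordMap_geometry ω h
  rw [rho, hd 0 le_rfl, hd x hx]
  have : 0 < C + D * 0 := by linarith
  have : 0 ≤ D * x := by positivity
  gcongr

lemma le_derivAbs (hx : 0 ≤ x) (hx1 : x ≤ 1) : rho ω / 4 ≤ derivAbs ω x := by
  obtain ⟨C, D, hC, hD, hDC, hd, -⟩ := wordMap_geometry ω h
  rw [rho, hd 0 le_rfl, hd x hx, div_div]
  have h0 : 0 < C + D * x := by positivity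
  have h1 : D * x ≤ C := by nlinarith
  exact one_div_le_one_div_of_le (by positivity) (by nlinarith)

lemma derivAbs_pos (hx : 0 ≤ x) : 0 < derivAbs ω x := by
  obtain ⟨C, D, hC, hD, hDC, hd, -⟩ := wordMap_geometry ω h
  rw [hd x hx]
  positivity

lemma dist_wordMap_le (hx : 0 ≤ x) (hy : 0 ≤ y) :
    |wordMap ω x - wordMap ω y| ≤ rho ω * |x - y| := by
  obtain ⟨C, D, hC, hD, hDC, hd, he⟩ := wordMap_geometry ω h
  rw [rho, hd 0 le_rfl, he x y hx hy, mul_zero, add_zero, one_div, mul_comm (C ^ 2)⁻¹,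
    ← div_eq_mul_inv, pow_two]
  have : 0 ≤ D * x := by positivity
  have : 0 ≤ D * y := by positivity
  gcongr <;> linarith

lemma le_dist_wordMap (hx : 0 ≤ x) (hx1 : x ≤ 1) (hy : 0 ≤ y) (hy1 : y ≤ 1) :
    rho ω / 4 * |x - y| ≤ |wordMap ω x - wordMap ω y| := by
  obtain ⟨C, D, hC, hD, hDC, hd, he⟩ := wordMap_geometry ω h
  rw [rho, hd 0 le_rfl, he x y hx hy, mul_zero, add_zero, one_div, mul_comm, div_eq_mul_inv,
    div_eq_mul_inv |x - y|, ← mul_inv]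
  have h1 : D * x ≤ C := by nlinarith
  have h2 : D * y ≤ C := by nlinarith
  have h3 : 0 ≤ D * x := by positivity
  have h4 : 0 ≤ D * y := by positivity
  have h5 : (C + D * x) * (C + D * y) ≤ (2 * C) * (2 * C) := by gcongr <;> linarith
  exact mul_le_mul_of_nonneg_left (inv_anti₀ (by positivity) (by linarith)) (abs_nonneg _)

lemma wordMap_nonneg (hx : 0 ≤ x) : 0 ≤ wordMap ω x := by
  obtain ⟨A, B, C, D, hA, hB, hC, hD, -, -, -, hx'⟩ := wordMap_moebius ω h
  rw [(hx' x hx).1]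
  positivity

lemma wordMap_le_one (hx : 0 ≤ x) (hx1 : x ≤ 1) : wordMap ω x ≤ 1 := by
  cases ω with
  | nil => exact hx1
  | cons a ω =>
    have ha : (1 : ℝ) ≤ a := by exact_mod_cast h a List.mem_cons_self
    have h0 := wordMap_nonneg (ω := ω) (fun b hb => h b (List.mem_cons_of_mem _ hb)) hx
    show 1 / ((a : ℝ) + wordMap ω x) ≤ 1
    rw [div_le_one (by linarith)]
    linarith

lemma hasDerivAt_wordMap (hx : 0 ≤ x) :
    ∃ s, HasDerivAt (wordMap ω) s x ∧ |s| = derivAbs ω x := by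
  induction ω with
  | nil => exact ⟨1, hasDerivAt_id x, by simp [derivAbs]⟩
  | cons a ω ih =>
    have hω : PosWord ω := fun b hb => h b (List.mem_cons_of_mem _ hb)
    obtain ⟨s, hs, hs'⟩ := ih hω
    have ha : (1 : ℝ) ≤ a := by exact_mod_cast h a List.mem_cons_self
    have h0 := wordMap_nonneg hω hx
    have hne : (a : ℝ) + wordMap ω x ≠ 0 := by linarith
    refine ⟨-s / (a + wordMap ω x) ^ 2, ?_, ?_⟩
    · have := (hs.const_add (a : ℝ)).inv hne
      have hf : wordMap (a :: ω) = (fun x => (a : ℝ) + wordMap ω x)⁻¹ := by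
        funext z
        simp [wordMap, gaussMap]
      rw [hf]
      exact this
    · rw [abs_div, abs_neg, hs', abs_of_nonneg (sq_nonneg _), derivAbs]
      field_simp

lemma derivNorm_eq_rho : derivNorm ω = rho ω := by
  have hd : ∀ x : Icc (0 : ℝ) 1, |deriv (wordMap ω) (x : ℝ)| = derivAbs ω x := fun x => by
    obtain ⟨s, hs, hs'⟩ := hasDerivAt_wordMap h x.2.1
    rw [hs.deriv, hs']
  simp only [derivNorm, hd]
  apply le_antisymm
  · exact ciSup_le fun x => derivAbs_le h x.2.1
  · exact le_ciSup (f := fun x : Icc (0 : ℝ) 1 => derivAbs ω x)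
      ⟨rho ω, by rintro _ ⟨x, rfl⟩; exact derivAbs_le h x.2.1⟩ ⟨0, by simp⟩

lemma rho_append_le {τ : List ℕ} (hτ : PosWord τ) : rho (ω ++ τ) ≤ rho ω * rho τ := by
  rw [rho, derivAbs_append]
  exact mul_le_mul_of_nonneg_right (derivAbs_le h (wordMap_nonneg hτ le_rfl)) (rho_pos hτ).le

lemma le_rho_append {τ : List ℕ} (hτ : PosWord τ) : rho ω * rho τ / 4 ≤ rho (ω ++ τ) := by
  rw [show rho (ω ++ τ) = _ from derivAbs_append ω τ 0]
  have := mul_le_mul_of_nonneg_right (le_derivAbs h (wordMap_nonneg hτ le_rfl)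
    (wordMap_le_one hτ le_rfl zero_le_one)) (rho_pos hτ).le
  calc rho ω * rho τ / 4 = rho ω / 4 * rho τ := by ring
    _ ≤ _ := this

end geometry

lemma rho_nil : rho [] = 1 := rfl

lemma rho_singleton (a : ℕ) : rho [a] = ((a : ℝ) ^ 2)⁻¹ := by
  simp [rho, derivAbs, wordMap]

/-- Words over the alphabet of primes. -/
def PrimeWord (ω : List ℕ) : Prop := ∀ a ∈ ω, a.Prime

lemma PrimeWord.posWord {ω : List ℕ} (h : PrimeWord ω) : PosWord ω := fun a ha => (h a ha).one_le

lemma PrimeWord.append {ω τ : List ℕ} (hω : PrimeWord ω) (hτ : PrimeWord τ) :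
    PrimeWord (ω ++ τ) := by
  intro a ha
  rcases List.mem_append.1 ha with h | h
  exacts [hω a h, hτ a h]

lemma primeWord_singleton {a : ℕ} (ha : a.Prime) : PrimeWord [a] := by
  intro b hb
  rwa [List.mem_singleton.1 hb]

lemma primeWord_nil : PrimeWord [] := by simp [PrimeWord]

lemma PrimeWord.of_cons {a : ℕ} {ω : List ℕ} (h : PrimeWord (a :: ω)) : a.Prime ∧ PrimeWord ω :=
  ⟨h a List.mem_cons_self, fun b hb => h b (List.mem_cons_of_mem _ hb)⟩

lemma primeWord_ofFn {n : ℕ} (f : Fin n → ℕ) (h : ∀ i, (f i).Prime) :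
    PrimeWord (List.ofFn f) := by
  intro a ha
  obtain ⟨i, rfl⟩ := (List.mem_ofFn' f a).1 ha
  exact h i

lemma rho_singleton_le {a : ℕ} (ha : a.Prime) : rho [a] ≤ 1 / 4 := by
  have h2 : (2 : ℝ) ≤ a := by exact_mod_cast ha.two_le
  rw [rho_singleton, one_div]
  exact inv_anti₀ (by norm_num) (by nlinarith)

lemma rho_le_pow {ω : List ℕ} (h : PrimeWord ω) : rho ω ≤ (1 / 4) ^ ω.length := by
  induction ω with
  | nil => simp [rho_nil]
  | cons a ω ih =>
    obtain ⟨ha, hω⟩ := h.of_cons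
    calc rho ([a] ++ ω) ≤ rho [a] * rho ω :=
          rho_append_le (posWord_singleton ha.one_le) hω.posWord
      _ ≤ 1 / 4 * (1 / 4) ^ ω.length :=
          mul_le_mul (rho_singleton_le ha) (ih hω) (rho_pos hω.posWord).le (by norm_num)
      _ = _ := by rw [List.length_cons, pow_succ']

lemma tendsto_codingMap {ω : ℕ → ℕ} (h : ∀ n, (ω n).Prime) :
    Tendsto (fun n => wordMap (List.ofFn fun i : Fin n => ω i) 0) atTop (𝓝 (codingMap ω)) := by
  apply tendsto_nhds_limUnder
  apply cauchySeq_tendsto_of_complete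
  apply cauchySeq_of_le_geometric (1 / 4) 1 (by norm_num)
  intro n
  have hn : PrimeWord (List.ofFn fun i : Fin n => ω i) := primeWord_ofFn _ fun i => h i
  have h1 : (List.ofFn fun i : Fin (n + 1) => ω i) = (List.ofFn fun i : Fin n => ω i) ++ [ω n] := by
    rw [List.ofFn_succ', List.concat_eq_append]
    simp
  have hs := posWord_singleton (h n).one_le
  have h0 := wordMap_nonneg hs (le_refl (0 : ℝ))
  have h1' := wordMap_le_one hs (le_refl (0 : ℝ)) zero_le_one
  rw [h1, wordMap_append, Real.dist_eq, one_mul]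
  refine (dist_wordMap_le hn.posWord le_rfl h0).trans ?_
  have h2 := rho_le_pow hn
  rw [List.length_ofFn] at h2
  have h3 : |0 - wordMap [ω n] 0| ≤ 1 := by
    rw [zero_sub, abs_neg, abs_of_nonneg h0]
    exact h1'
  calc _ ≤ rho (List.ofFn fun i : Fin n => ω i) * 1 :=
        mul_le_mul_of_nonneg_left h3 (rho_pos hn.posWord).le
    _ ≤ _ := by rw [mul_one]; exact h2

lemma codingMap_mem_Icc {ω : ℕ → ℕ} (h : ∀ n, (ω n).Prime) : codingMap ω ∈ Icc (0 : ℝ) 1 := by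
  have hn : ∀ n, PrimeWord (List.ofFn fun i : Fin n => ω i) := fun n =>
    primeWord_ofFn _ fun i => h i
  exact isClosed_Icc.mem_of_tendsto (tendsto_codingMap h) (.of_forall fun n =>
    ⟨wordMap_nonneg (hn n).posWord le_rfl, wordMap_le_one (hn n).posWord le_rfl zero_le_one⟩)

lemma codingMap_eq {ω : ℕ → ℕ} (h : ∀ n, (ω n).Prime) :
    codingMap ω = gaussMap (ω 0) (codingMap fun n => ω (n + 1)) := by
  have h' : ∀ n, (ω (n + 1)).Prime := fun n => h _
  have h1 := (tendsto_add_atTop_iff_nat 1).2 (tendsto_codingMap h)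
  have h2 := tendsto_codingMap h'
  have h3 : (1 : ℝ) ≤ ω 0 := by exact_mod_cast (h 0).one_le
  have hm := (codingMap_mem_Icc h').1
  refine tendsto_nhds_unique h1 ?_
  have h4 : ∀ n, wordMap (List.ofFn fun i : Fin (n + 1) => ω i) 0 =
      gaussMap (ω 0) (wordMap (List.ofFn fun i : Fin n => ω (i + 1)) 0) := fun n => by
    rw [List.ofFn_succ]
    rfl
  simp only [h4]
  exact tendsto_const_nhds.div (tendsto_const_nhds.add h2) (by linarith)

/-- The prime Cantor set. -/
abbrev primeCantor : Set ℝ := limitSet primes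

/-- The first continued fraction digit. -/
def digit (x : ℝ) : ℕ := ⌊1 / x⌋₊

/-- The Gauss transformation. -/
def shift (x : ℝ) : ℝ := 1 / x - digit x

/-- The word formed by the first `n` continued fraction digits. -/
def digits : ℕ → ℝ → List ℕ
  | 0, _ => []
  | n + 1, x => digit x :: digits n (shift x)

lemma gaussMap_digit_shift (x : ℝ) : gaussMap (digit x) (shift x) = x := by
  simp [gaussMap, shift]

lemma digits_length (n : ℕ) (x : ℝ) : (digits n x).length = n := by
  induction n generalizing x with
  | zero => rfl
  | succ n ih => simp [digits, ih]

lemma digits_succ' (n : ℕ) (x : ℝ) : digits (n + 1) x = digits n x ++ [digit (shift^[n] x)] := by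
  induction n generalizing x with
  | zero => rfl
  | succ n ih =>
    rw [digits, ih]
    rfl

lemma digits_eq_ofFn (n : ℕ) (x : ℝ) :
    digits n x = List.ofFn fun i : Fin n => digit (shift^[i] x) := by
  induction n generalizing x with
  | zero => rfl
  | succ n ih =>
    rw [digits, ih, List.ofFn_succ]
    rfl

lemma wordMap_digits (n : ℕ) (x : ℝ) : wordMap (digits n x) (shift^[n] x) = x := by
  induction n generalizing x with
  | zero => rfl
  | succ n ih =>
    rw [digits, Function.iterate_succ_apply]
    show gaussMap (digit x) (wordMap (digits n (shift x)) (shift^[n] (shift x))) = x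
    rw [ih, gaussMap_digit_shift]

lemma gaussMap_mem_Ioc {a : ℕ} (ha : a.Prime) {y : ℝ} (hy : 0 ≤ y) :
    gaussMap a y ∈ Ioc (0 : ℝ) (1 / 2) := by
  have h2 : (2 : ℝ) ≤ a := by exact_mod_cast ha.two_le
  refine ⟨by unfold gaussMap; positivity, ?_⟩
  exact one_div_le_one_div_of_le (by norm_num) (by linarith)

lemma primeCantor_subset : primeCantor ⊆ Ioc (0 : ℝ) (1 / 2) := by
  rintro _ ⟨ω, hω, rfl⟩
  rw [codingMap_eq hω]
  exact gaussMap_mem_Ioc (hω 0) (codingMap_mem_Icc fun n => hω (n + 1)).1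

lemma primeCantor_subset_Icc : primeCantor ⊆ Icc (0 : ℝ) 1 := fun x hx => by
  have := primeCantor_subset hx
  exact ⟨this.1.le, by linarith [this.2]⟩

lemma gaussMap_mem {a : ℕ} (ha : a.Prime) {y : ℝ} (hy : y ∈ primeCantor) :
    gaussMap a y ∈ primeCantor := by
  obtain ⟨ω, hω, rfl⟩ := hy
  let ω' : ℕ → ℕ := fun n => Nat.casesOn n a ω
  have h' : ∀ n, (ω' n).Prime := by
    intro n
    cases n with
    | zero => exact ha
    | succ n => exact hω n
  exact ⟨ω', h', codingMap_eq h'⟩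

lemma digit_gaussMap {a : ℕ} {y : ℝ} (hy : y ∈ primeCantor) : digit (gaussMap a y) = a := by
  have h := primeCantor_subset hy
  rw [digit, gaussMap, one_div_one_div, Nat.floor_eq_iff (by linarith [h.1, Nat.cast_nonneg (α := ℝ) a])]
  constructor <;> linarith [h.1, h.2]

lemma shift_gaussMap {a : ℕ} {y : ℝ} (hy : y ∈ primeCantor) : shift (gaussMap a y) = y := by
  rw [shift, digit_gaussMap hy, gaussMap, one_div_one_div]
  ring

lemma digit_prime_and_shift_mem {x : ℝ} (hx : x ∈ primeCantor) :
    (digit x).Prime ∧ shift x ∈ primeCantor := by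
  obtain ⟨ω, hω, rfl⟩ := hx
  have h : codingMap (fun n => ω (n + 1)) ∈ primeCantor := ⟨_, fun n => hω (n + 1), rfl⟩
  rw [codingMap_eq hω, digit_gaussMap h, shift_gaussMap h]
  exact ⟨hω 0, h⟩

lemma shift_iterate_mem {x : ℝ} (hx : x ∈ primeCantor) (n : ℕ) : shift^[n] x ∈ primeCantor := by
  induction n generalizing x with
  | zero => exact hx
  | succ n ih => exact ih (digit_prime_and_shift_mem hx).2

lemma digits_primeWord {x : ℝ} (hx : x ∈ primeCantor) (n : ℕ) : PrimeWord (digits n x) := by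
  rw [digits_eq_ofFn]
  exact primeWord_ofFn _ fun i => (digit_prime_and_shift_mem (shift_iterate_mem hx i)).1

lemma mem_primeCantor_of_forall {x : ℝ} (h : ∀ n, (digit (shift^[n] x)).Prime)
    (h' : ∀ n, shift^[n] x ∈ Icc (0 : ℝ) 1) : x ∈ primeCantor := by
  refine ⟨fun n => digit (shift^[n] x), h, ?_⟩
  refine tendsto_nhds_unique (tendsto_codingMap h) ?_
  simp only [← digits_eq_ofFn]
  have hw : ∀ n, PrimeWord (digits n x) := fun n => by
    rw [digits_eq_ofFn]
    exact primeWord_ofFn _ fun i => h i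
  rw [tendsto_iff_dist_tendsto_zero]
  refine squeeze_zero (fun _ => dist_nonneg) (fun n => ?_)
    (tendsto_pow_atTop_nhds_zero_of_lt_one (r := (1 / 4 : ℝ)) (by norm_num) (by norm_num))
  have hd := dist_wordMap_le (hw n).posWord le_rfl (h' n).1
  rw [wordMap_digits] at hd
  rw [Real.dist_eq]
  refine hd.trans ?_
  have h2 := rho_le_pow (hw n)
  rw [digits_length] at h2
  have h3 : |0 - shift^[n] x| ≤ 1 := by
    rw [zero_sub, abs_neg, abs_of_nonneg (h' n).1]
    exact (h' n).2
  calc _ ≤ rho (digits n x) * 1 := mul_le_mul_of_nonneg_left h3 (rho_pos (hw n).posWord).le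
    _ ≤ _ := by rw [mul_one]; exact h2

lemma measurable_digit : Measurable digit :=
  Nat.measurable_floor.comp (measurable_const.div measurable_id)

lemma measurable_shift : Measurable shift :=
  (measurable_const.div measurable_id).sub (measurable_from_nat.comp measurable_digit)

lemma measurableSet_primeCantor : MeasurableSet primeCantor := by
  have h : primeCantor = ⋂ n : ℕ, {x | (digit (shift^[n] x)).Prime ∧ shift^[n] x ∈ Icc (0 : ℝ) 1} := by
    ext x
    rw [mem_iInter]
    refine ⟨fun hx n => ?_, fun hx => mem_primeCantor_of_forall (fun n => (hx n).1) fun n => (hx n).2⟩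
    have := shift_iterate_mem hx n
    exact ⟨(digit_prime_and_shift_mem this).1, primeCantor_subset_Icc this⟩
  rw [h]
  refine MeasurableSet.iInter fun n => ?_
  have hm : Measurable (shift^[n]) := measurable_shift.iterate n
  exact (measurable_digit.comp hm (MeasurableSet.of_discrete (s := {p : ℕ | p.Prime}))).inter
    (hm measurableSet_Icc)

lemma measurableSet_digits_eq (n : ℕ) (ω : List ℕ) : MeasurableSet {x | digits n x = ω} := by
  induction n generalizing ω with
  | zero =>
    show MeasurableSet {_x : ℝ | ([] : List ℕ) = ω}
    exact MeasurableSet.const _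
  | succ n ih =>
    cases ω with
    | nil => simp [digits]
    | cons a ω =>
      have : {x | digits (n + 1) x = a :: ω} = digit ⁻¹' {a} ∩ shift ⁻¹' {x | digits n x = ω} := by
        ext x
        simp [digits]
      rw [this]
      exact (measurable_digit (measurableSet_singleton a)).inter (measurable_shift (ih ω))

lemma wordMap_spec {ω : List ℕ} (h : PrimeWord ω) {y : ℝ} (hy : y ∈ primeCantor) :
    wordMap ω y ∈ primeCantor ∧ digits ω.length (wordMap ω y) = ω ∧
      shift^[ω.length] (wordMap ω y) = y := by
  induction ω with
  | nil => exact ⟨hy, rfl, rfl⟩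
  | cons a ω ih =>
    obtain ⟨ha, hω⟩ := h.of_cons
    obtain ⟨h1, h2, h3⟩ := ih hω
    refine ⟨gaussMap_mem ha h1, ?_, ?_⟩
    · show digit (gaussMap a (wordMap ω y)) ::
        digits ω.length (shift (gaussMap a (wordMap ω y))) = a :: ω
      rw [digit_gaussMap h1, shift_gaussMap h1, h2]
    · show shift^[ω.length] (shift (gaussMap a (wordMap ω y))) = y
      rw [shift_gaussMap h1, h3]

lemma image_wordMap_eq {ω : List ℕ} (h : PrimeWord ω) {A : Set ℝ} (hA : A ⊆ primeCantor) :
    wordMap ω '' A = primeCantor ∩ {x | digits ω.length x = ω} ∩ shift^[ω.length] ⁻¹' A := by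
  ext x
  constructor
  · rintro ⟨y, hy, rfl⟩
    obtain ⟨h1, h2, h3⟩ := wordMap_spec h (hA hy)
    exact ⟨⟨h1, h2⟩, by rwa [mem_preimage, h3]⟩
  · rintro ⟨⟨-, h2⟩, h3⟩
    refine ⟨_, h3, ?_⟩
    conv_rhs => rw [← wordMap_digits ω.length x]
    rw [show digits ω.length x = ω from h2]

lemma measurableSet_image_wordMap {ω : List ℕ} (h : PrimeWord ω) {A : Set ℝ}
    (hA : A ⊆ primeCantor) (hm : MeasurableSet A) : MeasurableSet (wordMap ω '' A) := by
  rw [image_wordMap_eq h hA]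
  exact (measurableSet_primeCantor.inter (measurableSet_digits_eq _ _)).inter
    (measurable_shift.iterate _ hm)

lemma image_wordMap_primeCantor {ω : List ℕ} (h : PrimeWord ω) :
    wordMap ω '' primeCantor = primeCantor ∩ {x | digits ω.length x = ω} := by
  rw [image_wordMap_eq h subset_rfl, inter_eq_left]
  exact fun x hx => shift_iterate_mem hx.1 _

lemma inv_sub_inv_lower {a b : ℕ} (ha : 2 ≤ a) (hb : 2 ≤ b) (hab : a ≠ b) {u v : ℝ}
    (hu : u ∈ Icc (0 : ℝ) (1 / 2)) (hv : v ∈ Icc (0 : ℝ) (1 / 2)) :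
    1 / (8 * (a : ℝ) ^ 2) ≤ |gaussMap a u - gaussMap b v| := by
  obtain ⟨hu0, hu1⟩ := hu
  obtain ⟨hv0, hv1⟩ := hv
  have ha' : (2 : ℝ) ≤ a := by exact_mod_cast ha
  have hb' : (2 : ℝ) ≤ b := by exact_mod_cast hb
  have hp : 0 < (a : ℝ) + u := by linarith
  have hq : 0 < (b : ℝ) + v := by linarith
  rw [gaussMap, gaussMap, div_sub_div _ _ hp.ne' hq.ne', abs_div, abs_of_pos (mul_pos hp hq),
    div_le_div_iff₀ (by positivity) (by positivity)]
  rcases lt_or_gt_of_ne hab with h | h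
  · have h' : (a : ℝ) + 1 ≤ b := by exact_mod_cast h
    have : (b : ℝ) + v - (a + u) ≤ |1 * (b + v) - (a + u) * 1| := by
      rw [one_mul, mul_one]; exact le_abs_self _
    have h5 : 1 * (((a : ℝ) + u) * (b + v)) ≤ (b + v - (a + u)) * (8 * (a : ℝ) ^ 2) := by
      nlinarith [mul_nonneg hu0 hv0, mul_nonneg (sub_nonneg.2 ha') (sub_nonneg.2 h')]
    nlinarith [sq_nonneg (a : ℝ)]
  · have h' : (b : ℝ) + 1 ≤ a := by exact_mod_cast h
    have : (a : ℝ) + u - (b + v) ≤ |1 * (b + v) - (a + u) * 1| := by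
      rw [one_mul, mul_one, abs_sub_comm]; exact le_abs_self _
    have h5 : 1 * (((a : ℝ) + u) * (b + v)) ≤ (a + u - (b + v)) * (8 * (a : ℝ) ^ 2) := by
      nlinarith [mul_nonneg hu0 hv0, mul_nonneg (sub_nonneg.2 hb') (sub_nonneg.2 h')]
    nlinarith [sq_nonneg (a : ℝ)]

/-- Points of the prime Cantor set outside a cylinder are at distance comparable to its size. -/
lemma cylinder_separation {τ ω : List ℕ} (hτ : PrimeWord τ) (hω : PrimeWord ω) {x y : ℝ}
    (hx : x ∈ wordMap ω '' primeCantor) (hy : y ∈ primeCantor)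
    (hy' : y ∉ wordMap ω '' primeCantor) :
    rho (τ ++ ω) / 32 ≤ |wordMap τ x - wordMap τ y| := by
  induction ω generalizing τ x y with
  | nil => exact absurd ⟨y, hy, rfl⟩ hy'
  | cons a ω ih =>
    obtain ⟨ha, hω'⟩ := hω.of_cons
    obtain ⟨hb, hv⟩ := digit_prime_and_shift_mem hy
    obtain ⟨z, hz, rfl⟩ := hx
    have hwz : wordMap ω z ∈ primeCantor := (wordMap_spec hω' hz).1
    by_cases hab : a = digit y
    · have h1 := ih (hτ.append (primeWord_singleton ha)) hω' ⟨z, hz, rfl⟩ hv (by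
        rintro ⟨t, ht, hte⟩
        refine hy' ⟨t, ht, ?_⟩
        show gaussMap a (wordMap ω t) = y
        rw [hte, hab, gaussMap_digit_shift])
      rw [List.append_assoc, wordMap_append, wordMap_append] at h1
      have h2 : wordMap [a] (shift y) = y := by
        rw [hab]
        exact gaussMap_digit_shift y
      rw [h2] at h1
      exact h1
    · have h1 := inv_sub_inv_lower ha.two_le hb.two_le hab
        (Ioc_subset_Icc_self (primeCantor_subset hwz)) (Ioc_subset_Icc_self (primeCantor_subset hv))
      rw [gaussMap_digit_shift] at h1
      have h3 : wordMap (a :: ω) z = gaussMap a (wordMap ω z) := rfl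
      rw [← h3] at h1
      have hx1 := primeCantor_subset_Icc (wordMap_spec hω hz).1
      have hy1 := primeCantor_subset_Icc hy
      refine le_trans ?_ (le_dist_wordMap hτ.posWord hx1.1 hx1.2 hy1.1 hy1.2)
      have h4 : rho (τ ++ a :: ω) ≤ rho τ * ((a : ℝ) ^ 2)⁻¹ := by
        calc rho (τ ++ ([a] ++ ω)) ≤ rho τ * rho ([a] ++ ω) :=
              rho_append_le hτ.posWord hω.posWord
          _ ≤ rho τ * (rho [a] * rho ω) := mul_le_mul_of_nonneg_left
              (rho_append_le (posWord_singleton ha.one_le) hω'.posWord) (rho_pos hτ.posWord).le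
          _ ≤ rho τ * (rho [a] * 1) := by
              have := rho_le_one hω'.posWord
              have := (rho_pos hτ.posWord).le
              have := (rho_pos (posWord_singleton ha.one_le)).le
              gcongr
          _ = _ := by rw [mul_one, rho_singleton]
      calc rho (τ ++ a :: ω) / 32 ≤ rho τ * ((a : ℝ) ^ 2)⁻¹ / 32 := by gcongr
        _ = rho τ / 4 * (1 / (8 * (a : ℝ) ^ 2)) := by
          rw [one_div, mul_inv]
          ring
        _ ≤ _ := mul_le_mul_of_nonneg_left h1 (by linarith [rho_pos hτ.posWord])

/-! ### Partition functions and the pressure -/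

/-- The word with letters `ω`. -/
def wordOf {n : ℕ} (ω : Fin n → primes) : List ℕ := List.ofFn fun i => (ω i : ℕ)

lemma primeWord_wordOf {n : ℕ} (ω : Fin n → primes) : PrimeWord (wordOf ω) :=
  primeWord_ofFn _ fun i => (ω i).2

lemma wordOf_append {m n : ℕ} (ω : Fin m → primes) (τ : Fin n → primes) :
    wordOf (Fin.append ω τ) = wordOf ω ++ wordOf τ := by
  rw [wordOf, wordOf, wordOf, ← List.ofFn_fin_append]
  congr 1
  funext i
  refine Fin.addCases (fun j => ?_) (fun j => ?_) i <;> simp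

/-- The partition function `∑_{|ω| = n} |φ_ω'(x)|^s`. -/
def partitionFn (s : ℝ) (n : ℕ) (x : ℝ) : ℝ≥0∞ :=
  ∑' ω : Fin n → primes, ENNReal.ofReal (derivAbs (wordOf ω) x ^ s)

lemma partitionFn_add (s : ℝ) (m n : ℕ) {x : ℝ} (hx : 0 ≤ x) :
    partitionFn s (m + n) x = ∑' τ : Fin n → primes,
      partitionFn s m (wordMap (wordOf τ) x) * ENNReal.ofReal (derivAbs (wordOf τ) x ^ s) := by
  rw [partitionFn, ← (Fin.appendEquiv m n).tsum_eq, ENNReal.tsum_prod', ENNReal.tsum_comm]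
  refine tsum_congr fun τ => ?_
  rw [partitionFn, ← ENNReal.tsum_mul_right]
  refine tsum_congr fun ω => ?_
  have h1 := wordMap_nonneg (primeWord_wordOf τ).posWord hx
  rw [← ENNReal.ofReal_mul (by
    have := derivAbs_pos (primeWord_wordOf ω).posWord h1
    positivity)]
  show ENNReal.ofReal (derivAbs (wordOf (Fin.append ω τ)) x ^ s) = _
  rw [wordOf_append, derivAbs_append, Real.mul_rpow
    (derivAbs_pos (primeWord_wordOf ω).posWord h1).le
    (derivAbs_pos (primeWord_wordOf τ).posWord hx).le]

lemma tsum_fin_one (f : List ℕ → ℝ≥0∞) :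
    ∑' τ : Fin 1 → primes, f (wordOf τ) = ∑' a : primes, f [(a : ℕ)] := by
  rw [← (Equiv.funUnique (Fin 1) primes).symm.tsum_eq]
  refine tsum_congr fun a => ?_
  simp [wordOf]

lemma partitionFn_succ (s : ℝ) (n : ℕ) {x : ℝ} (hx : 0 ≤ x) :
    partitionFn s (n + 1) x = ∑' a : primes,
      partitionFn s n (gaussMap a x) * ENNReal.ofReal (derivAbs [(a : ℕ)] x ^ s) := by
  rw [partitionFn_add s n 1 hx]
  exact tsum_fin_one fun τ => partitionFn s n (wordMap τ x) * ENNReal.ofReal (derivAbs τ x ^ s)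

lemma partitionFn_zero (s x : ℝ) : partitionFn s 0 x = 1 := by
  rw [partitionFn, tsum_fintype]
  simp [wordOf, derivAbs]

section

variable {s : ℝ} (hs : 0 ≤ s)
include hs

lemma partitionFn_le (n : ℕ) {x : ℝ} (hx : 0 ≤ x) : partitionFn s n x ≤ partitionFn s n 0 :=
  ENNReal.tsum_le_tsum fun ω => ENNReal.ofReal_le_ofReal <|
    Real.rpow_le_rpow (derivAbs_pos (primeWord_wordOf ω).posWord hx).le
      (derivAbs_le (primeWord_wordOf ω).posWord hx) hs

lemma le_partitionFn (n : ℕ) {x : ℝ} (hx : x ∈ Icc (0 : ℝ) 1) :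
    ENNReal.ofReal ((1 / 4) ^ s) * partitionFn s n 0 ≤ partitionFn s n x := by
  rw [partitionFn, ← ENNReal.tsum_mul_left]
  refine ENNReal.tsum_le_tsum fun ω => ?_
  rw [← ENNReal.ofReal_mul (by positivity)]
  refine ENNReal.ofReal_le_ofReal ?_
  have h0 := rho_pos (primeWord_wordOf ω).posWord
  have h1 := le_derivAbs (primeWord_wordOf ω).posWord hx.1 hx.2
  change (1 / 4) ^ s * rho (wordOf ω) ^ s ≤ _
  rw [← Real.mul_rpow (by norm_num) h0.le]
  refine Real.rpow_le_rpow (by positivity) ?_ hs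
  linarith

lemma partitionFn_add_le (m n : ℕ) :
    partitionFn s (m + n) 0 ≤ partitionFn s m 0 * partitionFn s n 0 := by
  rw [partitionFn_add s m n le_rfl]
  conv_rhs => rw [partitionFn.eq_def s n, ← ENNReal.tsum_mul_left]
  refine ENNReal.tsum_le_tsum fun τ => ?_
  gcongr
  exact partitionFn_le hs m (wordMap_nonneg (primeWord_wordOf τ).posWord le_rfl)

lemma le_partitionFn_add (m n : ℕ) :
    ENNReal.ofReal ((1 / 4) ^ s) * (partitionFn s m 0 * partitionFn s n 0) ≤
      partitionFn s (m + n) 0 := by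
  rw [partitionFn_add s m n le_rfl]
  conv_lhs => rw [partitionFn.eq_def s n, ← ENNReal.tsum_mul_left, ← ENNReal.tsum_mul_left]
  refine ENNReal.tsum_le_tsum fun τ => ?_
  rw [← mul_assoc]
  gcongr
  exact le_partitionFn hs m ⟨wordMap_nonneg (primeWord_wordOf τ).posWord le_rfl,
    wordMap_le_one (primeWord_wordOf τ).posWord le_rfl zero_le_one⟩

lemma partitionFn_le_pow (n : ℕ) : partitionFn s n 0 ≤ partitionFn s 1 0 ^ n := by
  induction n with
  | zero => simp [partitionFn_zero]
  | succ n ih =>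
    rw [pow_succ]
    exact (partitionFn_add_le hs n 1).trans (by gcongr)

lemma pow_le_partitionFn (n : ℕ) :
    (ENNReal.ofReal ((1 / 4) ^ s) * partitionFn s 1 0) ^ n ≤ partitionFn s n 0 := by
  induction n with
  | zero => simp [partitionFn_zero]
  | succ n ih =>
    rw [pow_succ]
    refine le_trans ?_ (le_partitionFn_add hs n 1)
    calc _ ≤ partitionFn s n 0 * (ENNReal.ofReal ((1 / 4) ^ s) * partitionFn s 1 0) := by gcongr
      _ = _ := by ring

end

lemma partitionFn_one (s : ℝ) :
    partitionFn s 1 0 = ∑' a : primes, ENNReal.ofReal (((a : ℕ) : ℝ) ^ (-(2 * s))) := by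
  rw [partitionFn, tsum_fin_one fun τ => ENNReal.ofReal (derivAbs τ 0 ^ s)]
  refine tsum_congr fun a => ?_
  show ENNReal.ofReal (rho [(a : ℕ)] ^ s) = _
  rw [rho_singleton, ← Real.rpow_natCast, ← Real.rpow_neg (by positivity),
    ← Real.rpow_mul (by positivity)]
  norm_num

lemma partitionFn_one_ne_top {s : ℝ} (hs : 1 / 2 < s) : partitionFn s 1 0 ≠ ⊤ := by
  rw [partitionFn_one]
  have h : Summable fun n : ℕ => (n : ℝ) ^ (-(2 * s)) :=
    Real.summable_nat_rpow.2 (by linarith)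
  exact (h.subtype primes).tsum_ofReal_ne_top

lemma partitionFn_one_pos (s : ℝ) : 0 < partitionFn s 1 0 := by
  rw [partitionFn_one]
  refine lt_of_lt_of_le ?_ (ENNReal.le_tsum (⟨2, Nat.prime_two⟩ : primes))
  rw [ENNReal.ofReal_pos]
  positivity

lemma partitionFn_ne_top {s : ℝ} (hs : 1 / 2 < s) (n : ℕ) : partitionFn s n 0 ≠ ⊤ :=
  ne_top_of_le_ne_top (ENNReal.pow_ne_top (partitionFn_one_ne_top hs))
    (partitionFn_le_pow (by linarith) n)

lemma partitionFn_pos {s : ℝ} (hs : 0 ≤ s) (n : ℕ) : 0 < partitionFn s n 0 := by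
  refine lt_of_lt_of_le (ENNReal.pow_pos (ENNReal.mul_pos ?_ (partitionFn_one_pos s).ne') n)
    (pow_le_partitionFn hs n)
  rw [ne_eq, ENNReal.ofReal_eq_zero, not_le]
  positivity

lemma partitionFn_toReal (s : ℝ) (n : ℕ) :
    (partitionFn s n 0).toReal =
      ∑' ω : Fin n → primes, derivNorm (List.ofFn fun i => (ω i : ℕ)) ^ s := by
  rw [partitionFn, ENNReal.tsum_toReal_eq fun _ => ENNReal.ofReal_ne_top]
  refine tsum_congr fun ω => ?_
  have h := (primeWord_wordOf ω).posWord
  have h1 := rho_pos h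
  show (ENNReal.ofReal (rho _ ^ s)).toReal = derivNorm (wordOf ω) ^ s
  rw [derivNorm_eq_rho h, ENNReal.toReal_ofReal (by positivity)]

/-- If the pressure vanishes, the partition functions are bounded above and below. -/
lemma partitionFn_bounds {δ : ℝ} (hδ : 1 / 2 < δ) (hp : pressure primes δ = 0) (n : ℕ) :
    1 ≤ partitionFn δ n 0 ∧ partitionFn δ n 0 ≤ ENNReal.ofReal (4 ^ δ) := by
  set Z : ℕ → ℝ := fun n => (partitionFn δ n 0).toReal with hZ
  have hδ0 : 0 ≤ δ := by linarith
  have hfin := partitionFn_ne_top hδ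
  have hpos : ∀ n, 0 < Z n := fun n => ENNReal.toReal_pos (partitionFn_pos hδ0 n).ne' (hfin n)
  have h4 : (0 : ℝ) < (1 / 4) ^ δ := by positivity
  have hup : ∀ m n, Z (m + n) ≤ Z m * Z n := fun m n => by
    rw [hZ, ← ENNReal.toReal_mul]
    exact ENNReal.toReal_mono (ENNReal.mul_ne_top (hfin m) (hfin n)) (partitionFn_add_le hδ0 m n)
  have hlo : ∀ m n, (1 / 4) ^ δ * (Z m * Z n) ≤ Z (m + n) := fun m n => by
    have := ENNReal.toReal_mono (hfin (m + n)) (le_partitionFn_add hδ0 m n)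
    rwa [ENNReal.toReal_mul, ENNReal.toReal_mul, ENNReal.toReal_ofReal h4.le] at this
  have hup1 : ∀ n, Z n ≤ Z 1 ^ n := fun n => by
    rw [hZ, ← ENNReal.toReal_pow]
    exact ENNReal.toReal_mono (ENNReal.pow_ne_top (hfin 1)) (partitionFn_le_pow hδ0 n)
  have hlo1 : ∀ n, ((1 / 4) ^ δ * Z 1) ^ n ≤ Z n := fun n => by
    have := ENNReal.toReal_mono (hfin n) (pow_le_partitionFn hδ0 n)
    rwa [ENNReal.toReal_pow, ENNReal.toReal_mul, ENNReal.toReal_ofReal h4.le] at this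
  have hu : Subadditive fun n => Real.log (Z n) := fun m n => by
    rw [← Real.log_mul (hpos m).ne' (hpos n).ne']
    exact Real.log_le_log (hpos _) (hup m n)
  have hv : Subadditive fun n => -Real.log ((1 / 4) ^ δ * Z n) := fun m n => by
    have h1 := mul_pos h4 (hpos m)
    have h2 := mul_pos h4 (hpos n)
    have := Real.log_le_log (mul_pos h1 h2)
      (by nlinarith [hlo m n] : (1 / 4) ^ δ * Z m * ((1 / 4) ^ δ * Z n) ≤ (1 / 4) ^ δ * Z (m + n))
    rw [Real.log_mul h1.ne' h2.ne'] at this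
    linarith
  have hbu : BddBelow (range fun n : ℕ => Real.log (Z n) / n) := by
    refine ⟨min 0 (Real.log ((1 / 4) ^ δ * Z 1)), ?_⟩
    rintro _ ⟨n, rfl⟩
    rcases n.eq_zero_or_pos with rfl | hn
    · simp
    · refine min_le_of_right_le ?_
      have hn' : (0 : ℝ) < n := by exact_mod_cast hn
      show _ ≤ Real.log (Z n) / n
      rw [le_div_iff₀ hn', mul_comm, ← Real.log_pow]
      exact Real.log_le_log (pow_pos (mul_pos h4 (hpos 1)) n) (hlo1 n)
  have hlim := hu.tendsto_lim hbu
  have hlim0 : hu.lim = 0 := by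
    rw [← hp, pressure]
    refine (Tendsto.limUnder_eq ?_).symm
    refine hlim.congr fun n => ?_
    rw [hZ, ← partitionFn_toReal, div_eq_inv_mul]
  rw [hlim0] at hlim
  have hbv : BddBelow (range fun n : ℕ => -Real.log ((1 / 4) ^ δ * Z n) / n) := by
    refine ⟨min 0 (-Real.log (Z 1)), ?_⟩
    rintro _ ⟨n, rfl⟩
    rcases n.eq_zero_or_pos with rfl | hn
    · simp
    · refine min_le_of_right_le ?_
      have hn' : (0 : ℝ) < n := by exact_mod_cast hn
      show _ ≤ -Real.log ((1 / 4) ^ δ * Z n) / n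
      rw [le_div_iff₀ hn', neg_mul, neg_le_neg_iff, mul_comm (Real.log (Z 1)), ← Real.log_pow]
      refine Real.log_le_log (mul_pos h4 (hpos n)) ((mul_le_of_le_one_left (hpos n).le ?_).trans
        (hup1 n))
      exact Real.rpow_le_one (by norm_num) (by norm_num) hδ0
  have hvlim := hv.tendsto_lim hbv
  have hvlim0 : hv.lim = 0 := by
    refine tendsto_nhds_unique hvlim ?_
    have h1 : Tendsto (fun n : ℕ => -Real.log ((1 / 4) ^ δ) / n - Real.log (Z n) / n) atTop
        (𝓝 (0 - 0)) := (tendsto_const_div_atTop_nhds_zero_nat _).sub hlim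
    rw [sub_zero] at h1
    refine h1.congr fun n => ?_
    rw [Real.log_mul h4.ne' (hpos n).ne']
    ring
  rcases n.eq_zero_or_pos with rfl | hn
  · rw [partitionFn_zero]
    refine ⟨le_rfl, ?_⟩
    rw [ENNReal.one_le_ofReal]
    exact Real.one_le_rpow (by norm_num) hδ0
  · have hn' : (0 : ℝ) < n := by exact_mod_cast hn
    have h1 := hu.lim_le_div hbu hn.ne'
    have h2 := hv.lim_le_div hbv hn.ne'
    rw [hlim0, le_div_iff₀ hn', zero_mul] at h1
    rw [hvlim0, le_div_iff₀ hn', zero_mul, Left.nonneg_neg_iff] at h2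
    have h3 : 1 ≤ Z n := (Real.log_nonneg_iff (hpos n)).1 h1
    have h4' : (1 / 4) ^ δ * Z n ≤ 1 := (Real.log_nonpos_iff (mul_pos h4 (hpos n)).le).1 h2
    rw [← ENNReal.ofReal_toReal (hfin n), ENNReal.one_le_ofReal]
    refine ⟨h3, ENNReal.ofReal_le_ofReal ?_⟩
    have h5 : ((1 : ℝ) / 4) ^ δ = (4 ^ δ)⁻¹ := by rw [one_div, Real.inv_rpow (by norm_num)]
    rw [h5, inv_mul_le_iff₀ (by positivity), mul_one] at h4'
    exact h4'

/-! ### Hausdorff measures -/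

/-- The psiGauge function defining `hausdorffPsi`. -/
def psiGauge (ψ : ℝ → ℝ) (d : ℝ≥0∞) : ℝ≥0∞ := if d = 0 then 0 else ENNReal.ofReal (ψ d.toReal)

lemma hausdorffPsi_apply (ψ : ℝ → ℝ) (S : Set ℝ) :
    hausdorffPsi ψ S = ⨆ (r : ℝ≥0∞) (_ : 0 < r),
      ⨅ (t : ℕ → Set ℝ) (_ : S ⊆ iUnion t) (_ : ∀ n, ediam (t n) ≤ r),
        ∑' n, ⨆ _ : (t n).Nonempty, psiGauge ψ (ediam (t n)) := by
  rw [hausdorffPsi, Measure.mkMetric_apply]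
  simp only [psiGauge]

lemma hausdorffPsi_image_le {ψ : ℝ → ℝ} (hψ : MonotoneOn ψ (Ioi 0)) {f : ℝ → ℝ} {S : Set ℝ}
    {K B : ℝ} (hK : 0 < K) (hB : 0 < B)
    (hf : ∀ x ∈ S, ∀ y ∈ S, |f x - f y| ≤ K * |x - y|)
    (hKB : ∀ r, 0 < r → ψ (K * r) ≤ B * ψ r) :
    hausdorffPsi ψ (f '' S) ≤ ENNReal.ofReal B * hausdorffPsi ψ S := by
  have hB0 : ENNReal.ofReal B ≠ 0 := by simpa using hB
  have hK0 : ENNReal.ofReal K ≠ 0 := by simpa using hK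
  rw [hausdorffPsi_apply ψ (f '' S)]
  refine iSup₂_le fun ε hε => ?_
  rw [mul_comm, ← ENNReal.div_le_iff_le_mul (Or.inl hB0) (Or.inl ENNReal.ofReal_ne_top),
    hausdorffPsi_apply]
  have hε' : 0 < min 1 (ε / ENNReal.ofReal K) :=
    lt_min one_pos (ENNReal.div_pos hε.ne' ENNReal.ofReal_ne_top)
  refine le_iSup₂_of_le (min 1 (ε / ENNReal.ofReal K)) hε' (le_iInf fun t => le_iInf fun ht =>
    le_iInf fun hd => ?_)
  rw [ENNReal.div_le_iff_le_mul (Or.inl hB0) (Or.inl ENNReal.ofReal_ne_top)]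
  have hdiam : ∀ n, ediam (f '' (t n ∩ S)) ≤ ENNReal.ofReal K * ediam (t n) := by
    intro n
    refine ediam_le ?_
    rintro _ ⟨x, hx, rfl⟩ _ ⟨y, hy, rfl⟩
    calc edist (f x) (f y) ≤ ENNReal.ofReal K * edist x y := by
          rw [edist_dist, edist_dist, ← ENNReal.ofReal_mul hK.le, Real.dist_eq, Real.dist_eq]
          exact ENNReal.ofReal_le_ofReal (hf x hx.2 y hy.2)
      _ ≤ _ := by
          gcongr
          exact edist_le_ediam_of_mem hx.1 hy.1
  refine (iInf_le _ fun n => f '' (t n ∩ S)).trans ((iInf₂_le ?_ ?_).trans ?_)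
  · rintro _ ⟨x, hx, rfl⟩
    obtain ⟨n, hn⟩ := mem_iUnion.1 (ht hx)
    exact mem_iUnion.2 ⟨n, x, ⟨hn, hx⟩, rfl⟩
  · intro n
    refine (hdiam n).trans ?_
    calc _ ≤ ENNReal.ofReal K * (ε / ENNReal.ofReal K) := by
          gcongr
          exact (hd n).trans (min_le_right _ _)
      _ = ε := ENNReal.mul_div_cancel hK0 ENNReal.ofReal_ne_top
  · rw [mul_comm, ← ENNReal.tsum_mul_left]
    refine ENNReal.tsum_le_tsum fun n => iSup_le fun hne => ?_
    have hne' : (t n).Nonempty := by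
      obtain ⟨_, x, hx, _⟩ := hne
      exact ⟨x, hx.1⟩
    rw [iSup_pos hne']
    by_cases h0 : ediam (f '' (t n ∩ S)) = 0
    · simp [psiGauge, h0]
    have htop : ediam (t n) ≠ ⊤ :=
      ne_top_of_le_ne_top ENNReal.one_ne_top ((hd n).trans (min_le_left _ _))
    have hdn : ediam (t n) ≠ 0 := fun h => h0 (by
      have := hdiam n
      rw [h, mul_zero] at this
      exact le_antisymm this bot_le)
    rw [psiGauge, psiGauge, if_neg h0, if_neg hdn, ← ENNReal.ofReal_mul hB.le]
    refine ENNReal.ofReal_le_ofReal ((hψ ?_ ?_ ?_).trans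
      (hKB (ediam (t n)).toReal (ENNReal.toReal_pos hdn htop)))
    · exact ENNReal.toReal_pos h0
        (ne_top_of_le_ne_top (ENNReal.mul_ne_top ENNReal.ofReal_ne_top htop) (hdiam n))
    · exact mul_pos hK (ENNReal.toReal_pos hdn htop)
    · have := ENNReal.toReal_mono (ENNReal.mul_ne_top ENNReal.ofReal_ne_top htop) (hdiam n)
      rwa [ENNReal.toReal_mul, ENNReal.toReal_ofReal hK.le] at this

/-- The mass distribution principle. -/
lemma measure_le_hausdorffPsi {ψ : ℝ → ℝ} (hψ0 : Tendsto ψ (𝓝[>] (0 : ℝ)) (𝓝 0))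
    {ν : Measure ℝ} {G : Set ℝ} {κ ε : ℝ} (hκ : 0 ≤ κ) (hε : 0 < ε)
    (h : ∀ x ∈ G, ∀ r, 0 < r → r < ε → ν (closedBall x r) ≤ ENNReal.ofReal (κ * ψ r)) :
    ν G ≤ ENNReal.ofReal κ * hausdorffPsi ψ G := by
  have hpt : ∀ x ∈ G, ν {x} = 0 := by
    intro x hx
    have h1 : Tendsto (fun r => ENNReal.ofReal (κ * ψ r)) (𝓝[>] (0 : ℝ)) (𝓝 0) := by
      have := ENNReal.tendsto_ofReal (hψ0.const_mul κ)
      rwa [mul_zero, ENNReal.ofReal_zero] at this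
    refine le_antisymm (ge_of_tendsto h1 ?_) bot_le
    filter_upwards [Ioo_mem_nhdsGT hε] with r hr
    refine le_trans (measure_mono ?_) (h x hx r hr.1 hr.2)
    exact singleton_subset_iff.2 (mem_closedBall_self hr.1.le)
  rw [hausdorffPsi_apply]
  refine le_trans ?_ (mul_le_mul_right (le_iSup₂_of_le (ENNReal.ofReal (ε / 2))
    (ENNReal.ofReal_pos.2 (by positivity)) le_rfl) _)
  by_cases hκ0 : ENNReal.ofReal κ = 0
  · have hκ0' : κ = 0 := le_antisymm (ENNReal.ofReal_eq_zero.1 hκ0) hκ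
    rw [hκ0, zero_mul, nonpos_iff_eq_zero]
    refine measure_null_of_locally_null G fun x hx => ⟨G ∩ closedBall x (ε / 2), ?_, ?_⟩
    · rw [inter_comm]
      exact mem_nhdsWithin_of_mem_nhds (closedBall_mem_nhds x (by positivity)) |> fun h =>
        inter_mem h self_mem_nhdsWithin
    · refine measure_mono_null inter_subset_right (le_antisymm ?_ bot_le)
      have := h x hx (ε / 2) (by positivity) (by linarith)
      simpa [hκ0'] using this
  rw [mul_comm, ← ENNReal.div_le_iff_le_mul (Or.inl hκ0) (Or.inl ENNReal.ofReal_ne_top)]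
  refine le_iInf fun t => le_iInf fun ht => le_iInf fun hd => ?_
  rw [ENNReal.div_le_iff_le_mul (Or.inl hκ0) (Or.inl ENNReal.ofReal_ne_top), mul_comm,
    ← ENNReal.tsum_mul_left]
  calc ν G ≤ ν (⋃ n, t n ∩ G) := measure_mono fun x hx => by
        obtain ⟨n, hn⟩ := mem_iUnion.1 (ht hx)
        exact mem_iUnion.2 ⟨n, hn, hx⟩
    _ ≤ ∑' n, ν (t n ∩ G) := measure_iUnion_le _
    _ ≤ _ := ENNReal.tsum_le_tsum fun n => by
        rcases (t n ∩ G).eq_empty_or_nonempty with he | ⟨x, hx⟩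
        · simp [he]
        rw [iSup_pos ⟨x, hx.1⟩]
        have htop : ediam (t n) ≠ ⊤ := ne_top_of_le_ne_top ENNReal.ofReal_ne_top (hd n)
        by_cases h0 : ediam (t n) = 0
        · have : t n ∩ G ⊆ {x} := fun y hy => by
            have hs := ediam_eq_zero_iff.1 h0
            exact hs hy.1 hx.1
          rw [measure_mono_null this (hpt x hx.2)]
          exact bot_le
        · rw [psiGauge, if_neg h0, ← ENNReal.ofReal_mul hκ]
          have h1 := ENNReal.toReal_mono ENNReal.ofReal_ne_top (hd n)
          rw [ENNReal.toReal_ofReal (by positivity)] at h1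
          refine le_trans (measure_mono fun y hy => ?_) (h x hx.2 (ediam (t n)).toReal
            (ENNReal.toReal_pos h0 htop) (by linarith))
          rw [mem_closedBall, dist_edist]
          exact ENNReal.toReal_mono htop (edist_le_ediam_of_mem hy.1 hx.1)

/-- Points of high upper density form a set of small Hausdorff measure. -/
lemma hausdorffPsi_le_of_density {ψ : ℝ → ℝ} {ν : Measure ℝ}
    {S : Set ℝ} {K C : ℝ} (hK : 0 < K) (hC : 0 < C) (hC10 : ∀ r, 0 < r → ψ (10 * r) ≤ C * ψ r)
    (h : ∀ x ∈ S, ∀ ε, 0 < ε → ∃ r, 0 < r ∧ r < ε ∧ ENNReal.ofReal (K * ψ r) ≤ ν (closedBall x r)) :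
    hausdorffPsi ψ S ≤ ENNReal.ofReal (C / K) * ν univ := by
  let T : ℕ → Set (ℝ × ℝ) := fun n => {p | p.1 ∈ S ∧ 0 < p.2 ∧ p.2 < 1 / ((n : ℝ) + 1) ∧
    ENNReal.ofReal (K * ψ p.2) ≤ ν (closedBall p.1 p.2)}
  have hV := fun n => Vitali.exists_disjoint_subfamily_covering_enlargement_closedBall (T n)
    (fun p : ℝ × ℝ => p.1) (fun p => p.2) (1 / ((n : ℝ) + 1)) (fun p hp => hp.2.2.1.le) 5
    (by norm_num)
  choose u huT hdisj hcov using hV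
  have hcount : ∀ n, (u n).Countable := fun n =>
    (hdisj n).countable_of_nonempty_interior fun p hp => by
      have : 0 < p.2 := (huT n hp).2.1
      rw [interior_closedBall _ this.ne']
      exact nonempty_ball.2 this
  have : ∀ n, Countable (u n) := fun n => (hcount n).to_subtype
  have hdiam : ∀ n (p : u n), ediam (closedBall (p : ℝ × ℝ).1 (5 * (p : ℝ × ℝ).2)) =
      ENNReal.ofReal (10 * (p : ℝ × ℝ).2) := fun n p => by
    rw [Real.closedBall_eq_Icc, Real.ediam_Icc]
    congr 1
    ring
  have key := Measure.mkMetric_le_liminf_tsum (ι := fun n => u n) S (l := atTop)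
    (fun n : ℕ => ENNReal.ofReal (10 * (1 / ((n : ℝ) + 1))))
    (by
      have := ENNReal.tendsto_ofReal
        ((tendsto_one_div_add_atTop_nhds_zero_nat (𝕜 := ℝ)).const_mul 10)
      rwa [mul_zero, ENNReal.ofReal_zero] at this)
    (fun n p => closedBall (p : ℝ × ℝ).1 (5 * (p : ℝ × ℝ).2))
    (Eventually.of_forall fun n p => by
      rw [hdiam]
      refine ENNReal.ofReal_le_ofReal ?_
      have := (huT n p.2).2.2.1
      linarith)
    (Eventually.of_forall fun n x hx => by
      obtain ⟨r, h0, h1, h2⟩ := h x hx (1 / ((n : ℝ) + 1)) (by positivity)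
      obtain ⟨q, hq, hsub⟩ := hcov n (x, r) ⟨hx, h0, h1, h2⟩
      exact mem_iUnion.2 ⟨⟨q, hq⟩, hsub (mem_closedBall_self h0.le)⟩)
    (psiGauge ψ)
  have e : hausdorffPsi ψ = Measure.mkMetric (psiGauge ψ) := by
    rw [hausdorffPsi]
    congr
  rw [e]
  refine key.trans (liminf_le_of_le (by isBoundedDefault) ?_)
  intro b hb
  obtain ⟨n, hn⟩ := hb.exists
  refine hn.trans ?_
  calc ∑' p : u n, psiGauge ψ (ediam (closedBall (p : ℝ × ℝ).1 (5 * (p : ℝ × ℝ).2)))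
      ≤ ∑' p : u n, ENNReal.ofReal (C / K) * ν (closedBall (p : ℝ × ℝ).1 (p : ℝ × ℝ).2) := by
        refine ENNReal.tsum_le_tsum fun p => ?_
        obtain ⟨-, h1, -, h2⟩ := huT n p.2
        rw [hdiam, psiGauge, if_neg (by simpa using h1), ENNReal.toReal_ofReal (by positivity)]
        refine le_trans (ENNReal.ofReal_le_ofReal (hC10 _ h1)) ?_
        refine le_trans (le_of_eq ?_) (mul_le_mul_right h2 _)
        rw [← ENNReal.ofReal_mul (by positivity)]
        congr 1
        field_simp
    _ = ENNReal.ofReal (C / K) * ν (⋃ p ∈ u n, closedBall p.1 p.2) := by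
        rw [ENNReal.tsum_mul_left, measure_biUnion (hcount n) (hdisj n)
          fun p _ => measurableSet_closedBall]
    _ ≤ _ := by
        gcongr
        exact subset_univ _

/-! ### Conformality of the restricted Hausdorff measure -/

lemma measurable_gaussMap (a : ℕ) : Measurable (gaussMap a) :=
  measurable_const.div (measurable_const.add measurable_id)

lemma measurable_wordMap (ω : List ℕ) : Measurable (wordMap ω) := by
  induction ω with
  | nil => exact measurable_id
  | cons a ω ih => exact (measurable_gaussMap a).comp ih

lemma measurable_derivAbs (ω : List ℕ) : Measurable (derivAbs ω) := by
  induction ω with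
  | nil => exact measurable_const
  | cons a ω ih =>
    exact ((measurable_const.div (measurable_const.add (measurable_wordMap ω))).pow_const 2).mul ih

lemma derivAbs_singleton (a : ℕ) (x : ℝ) : derivAbs [a] x = (1 / ((a : ℝ) + x)) ^ 2 := by
  simp [derivAbs, wordMap]

lemma gaussMap_sub {a : ℕ} (ha : a.Prime) {x y : ℝ} (hx : 0 ≤ x) (hy : 0 ≤ y) :
    |gaussMap a x - gaussMap a y| = |x - y| / ((a + x) * (a + y)) := by
  have h1 : (0 : ℝ) < a := by exact_mod_cast ha.pos
  have h2 : gaussMap a x - gaussMap a y = (y - x) / ((a + x) * (a + y)) := by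
    rw [gaussMap, gaussMap]
    field_simp
    ring
  rw [h2, abs_div, abs_sub_comm, abs_of_pos (by positivity : 0 < ((a : ℝ) + x) * (a + y))]

lemma image_gaussMap_eq {a : ℕ} (ha : a.Prime) {A : Set ℝ} (hA : A ⊆ primeCantor) :
    gaussMap a '' A = {x | digit x = a} ∩ shift ⁻¹' A ∩ primeCantor := by
  have := image_wordMap_eq (primeWord_singleton ha) hA
  rw [show wordMap [a] = gaussMap a from rfl] at this
  rw [this]
  ext x
  simp [digits]
  tauto

lemma measurableSet_image_gaussMap {a : ℕ} (ha : a.Prime) {A : Set ℝ} (hA : A ⊆ primeCantor)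
    (hm : MeasurableSet A) : MeasurableSet (gaussMap a '' A) :=
  measurableSet_image_wordMap (primeWord_singleton ha) hA hm

/-- The points of `A` in the `j`-th interval of length `1 / (N + 1)`. -/
def slice (A : Set ℝ) (N j : ℕ) : Set ℝ := A ∩ {x | ⌊((N : ℝ) + 1) * x⌋₊ = j}

lemma measurableSet_slice {A : Set ℝ} (hA : MeasurableSet A) (N j : ℕ) :
    MeasurableSet (slice A N j) :=
  hA.inter (Nat.measurable_floor.comp (measurable_const.mul measurable_id)
    (measurableSet_singleton j))

lemma iUnion_slice (A : Set ℝ) (N : ℕ) : ⋃ j, slice A N j = A := by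
  ext x
  simp [slice]

lemma pairwise_disjoint_slice (A : Set ℝ) (N : ℕ) :
    Pairwise (Function.onFun Disjoint (slice A N)) := by
  intro i j hij
  refine disjoint_left.2 fun x hi hj => hij ?_
  exact hi.2.symm.trans hj.2

lemma slice_bounds {A : Set ℝ} (hA : A ⊆ primeCantor) {a : ℕ} (ha : a.Prime) {N j : ℕ} {x : ℝ}
    (hx : x ∈ slice A N j) :
    (a : ℝ) + j / (N + 1) ≤ a + x ∧
      (a : ℝ) + x ≤ (a + j / (N + 1)) * (1 + 1 / (N + 1)) := by
  have hx0 := (primeCantor_subset (hA hx.1)).1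
  have hN : (0 : ℝ) < (N : ℝ) + 1 := by positivity
  have ha1 : (1 : ℝ) ≤ a := by exact_mod_cast ha.one_le
  have h1 : (j : ℝ) ≤ ((N : ℝ) + 1) * x := by
    have := Nat.floor_le (by positivity : 0 ≤ ((N : ℝ) + 1) * x)
    rwa [hx.2] at this
  have h2 : ((N : ℝ) + 1) * x < j + 1 := by
    have := Nat.lt_floor_add_one (((N : ℝ) + 1) * x)
    rwa [hx.2] at this
  constructor
  · gcongr
    rw [div_le_iff₀ hN]
    linarith
  · have h3 : x ≤ j / (N + 1) + 1 / (N + 1) := by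
      rw [← add_div, le_div_iff₀ hN]
      linarith
    have h4 : 0 ≤ (j : ℝ) / (N + 1) := by positivity
    have h5 : 0 < (1 : ℝ) / (N + 1) := by positivity
    nlinarith

section

variable {ψ : ℝ → ℝ} {δ : ℝ} (hδ : 0 ≤ δ) (hψ : MonotoneOn ψ (Ioi 0))
include hδ hψ

lemma slice_estimate_of_antitone
    (hanti : AntitoneOn (fun r : ℝ => r ^ (-δ) * ψ r) (Ioi 0)) {a : ℕ} (ha : a.Prime)
    {A : Set ℝ} (hA : A ⊆ primeCantor) (N j : ℕ) :
    ∫⁻ x in slice A N j, ENNReal.ofReal (derivAbs [a] x ^ δ) ∂(hausdorffPsi ψ) ≤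
      ENNReal.ofReal ((1 + 1 / (N + 1)) ^ (2 * δ)) *
        hausdorffPsi ψ (gaussMap a '' slice A N j) := by
  set t : ℝ := 1 + 1 / (N + 1) with ht
  set u : ℝ := (a : ℝ) + j / (N + 1) with hu
  have ha2 : (1 : ℝ) ≤ a := by exact_mod_cast ha.one_le
  have hu1 : 1 ≤ u := by
    have : 0 ≤ (j : ℝ) / (N + 1) := by positivity
    linarith
  have ht1 : 1 ≤ t := by
    have : (0 : ℝ) ≤ 1 / (N + 1) := by positivity
    linarith
  have hsA : slice A N j ⊆ primeCantor := inter_subset_left.trans hA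
  have hK1 : 1 ≤ (u * t) ^ 2 := one_le_pow₀ (one_le_mul_of_one_le_of_one_le hu1 ht1)
  have hK0 : 0 < (u * t) ^ 2 := by positivity
  have himg : shift '' (gaussMap a '' slice A N j) = slice A N j := by
    rw [image_image]
    conv_rhs => rw [← image_id (slice A N j)]
    exact image_congr fun x hx => shift_gaussMap (hsA hx)
  have h1 : hausdorffPsi ψ (slice A N j) ≤
      ENNReal.ofReal (((u * t) ^ 2) ^ δ) * hausdorffPsi ψ (gaussMap a '' slice A N j) := by
    conv_lhs => rw [← himg]
    refine hausdorffPsi_image_le hψ hK0 (by positivity) ?_ fun r hr => ?_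
    · rintro _ ⟨x, hx, rfl⟩ _ ⟨y, hy, rfl⟩
      have hx0 := (primeCantor_subset (hsA hx)).1
      have hy0 := (primeCantor_subset (hsA hy)).1
      have hbx := slice_bounds hA ha hx
      have hby := slice_bounds hA ha hy
      rw [shift_gaussMap (hsA hx), shift_gaussMap (hsA hy), gaussMap_sub ha hx0.le hy0.le]
      have hp : 0 < ((a : ℝ) + x) * (a + y) := by positivity
      rw [mul_div_assoc', le_div_iff₀ hp, mul_comm |x - y|]
      refine mul_le_mul_of_nonneg_right ?_ (abs_nonneg _)
      rw [sq]
      exact mul_le_mul hbx.2 hby.2 (by positivity) (by positivity)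
    · have := hanti (mem_Ioi.2 hr) (mem_Ioi.2 (mul_pos hK0 hr)) (le_mul_of_one_le_left hr.le hK1)
      simp only at this
      rw [Real.mul_rpow hK0.le hr.le, Real.rpow_neg hK0.le, Real.rpow_neg hr.le, mul_assoc,
        inv_mul_le_iff₀ (by positivity), mul_left_comm] at this
      exact le_of_mul_le_mul_left this (by positivity)
  calc _ ≤ ∫⁻ x in slice A N j, ENNReal.ofReal ((u ^ 2)⁻¹ ^ δ) ∂(hausdorffPsi ψ) := by
        refine setLIntegral_mono measurable_const fun x hx => ENNReal.ofReal_le_ofReal ?_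
        have hx0 := (primeCantor_subset (hsA hx)).1
        rw [derivAbs_singleton]
        refine Real.rpow_le_rpow (by positivity) ?_ hδ
        rw [one_div, inv_pow]
        have := (slice_bounds hA ha hx).1
        gcongr
    _ = ENNReal.ofReal ((u ^ 2)⁻¹ ^ δ) * hausdorffPsi ψ (slice A N j) := by
        rw [setLIntegral_const]
    _ ≤ ENNReal.ofReal ((u ^ 2)⁻¹ ^ δ) * (ENNReal.ofReal (((u * t) ^ 2) ^ δ) *
        hausdorffPsi ψ (gaussMap a '' slice A N j)) := by gcongr
    _ = _ := by
        rw [← mul_assoc, ← ENNReal.ofReal_mul (by positivity),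
          ← Real.mul_rpow (by positivity) (by positivity), Real.rpow_mul (by positivity)]
        congr 3
        rw [Real.rpow_two]
        field_simp

lemma slice_estimate_of_monotone
    (hmono : MonotoneOn (fun r : ℝ => r ^ (-δ) * ψ r) (Ioi 0)) {a : ℕ} (ha : a.Prime)
    {A : Set ℝ} (hA : A ⊆ primeCantor) (hm : MeasurableSet A) (N j : ℕ) :
    hausdorffPsi ψ (gaussMap a '' slice A N j) ≤
      ENNReal.ofReal ((1 + 1 / (N + 1)) ^ (2 * δ)) *
        ∫⁻ x in slice A N j, ENNReal.ofReal (derivAbs [a] x ^ δ) ∂(hausdorffPsi ψ) := by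
  set t : ℝ := 1 + 1 / (N + 1) with ht
  set u : ℝ := (a : ℝ) + j / (N + 1) with hu
  have ha2 : (1 : ℝ) ≤ a := by exact_mod_cast ha.one_le
  have hu1 : 1 ≤ u := by
    have : 0 ≤ (j : ℝ) / (N + 1) := by positivity
    linarith
  have ht1 : 1 ≤ t := by
    have : (0 : ℝ) ≤ 1 / (N + 1) := by positivity
    linarith
  have hsA : slice A N j ⊆ primeCantor := inter_subset_left.trans hA
  have hK1 : (u ^ 2)⁻¹ ≤ 1 := inv_le_one_of_one_le₀ (one_le_pow₀ hu1)
  have hK0 : 0 < (u ^ 2)⁻¹ := by positivity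
  have h1 : hausdorffPsi ψ (gaussMap a '' slice A N j) ≤
      ENNReal.ofReal ((u ^ 2)⁻¹ ^ δ) * hausdorffPsi ψ (slice A N j) := by
    refine hausdorffPsi_image_le hψ hK0 (by positivity) ?_ fun r hr => ?_
    · intro x hx y hy
      have hx0 := (primeCantor_subset (hsA hx)).1
      have hy0 := (primeCantor_subset (hsA hy)).1
      rw [gaussMap_sub ha hx0.le hy0.le, div_eq_inv_mul]
      refine mul_le_mul_of_nonneg_right ?_ (abs_nonneg _)
      rw [sq]
      have hbx := (slice_bounds hA ha hx).1
      have hby := (slice_bounds hA ha hy).1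
      gcongr
    · have := hmono (mem_Ioi.2 (mul_pos hK0 hr)) (mem_Ioi.2 hr) (mul_le_of_le_one_left hr.le hK1)
      simp only at this
      rw [Real.mul_rpow hK0.le hr.le, Real.rpow_neg hK0.le, Real.rpow_neg hr.le, mul_assoc,
        inv_mul_le_iff₀ (by positivity), mul_left_comm] at this
      exact le_of_mul_le_mul_left this (by positivity)
  calc _ ≤ ENNReal.ofReal ((u ^ 2)⁻¹ ^ δ) * hausdorffPsi ψ (slice A N j) := h1
    _ = ∫⁻ x in slice A N j, ENNReal.ofReal ((u ^ 2)⁻¹ ^ δ) ∂(hausdorffPsi ψ) := by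
        rw [setLIntegral_const]
    _ ≤ ∫⁻ x in slice A N j, ENNReal.ofReal (t ^ (2 * δ)) *
          ENNReal.ofReal (derivAbs [a] x ^ δ) ∂(hausdorffPsi ψ) := by
        refine setLIntegral_mono' (measurableSet_slice hm N j) fun x hx => ?_
        have hx0 := (primeCantor_subset (hsA hx)).1
        rw [derivAbs_singleton, ← ENNReal.ofReal_mul (by positivity),
          Real.rpow_mul (by positivity), ← Real.mul_rpow (by positivity) (by positivity)]
        refine ENNReal.ofReal_le_ofReal (Real.rpow_le_rpow hK0.le ?_ hδ)
        rw [Real.rpow_two, ← mul_pow, ← inv_pow]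
        have hb := (slice_bounds hA ha hx).2
        refine pow_le_pow_left₀ (by positivity) ?_ 2
        rw [mul_one_div, inv_le_iff_one_le_mul₀ (by positivity), div_mul_eq_mul_div,
          one_le_div (by positivity), mul_comm t]
        exact hb
    _ = _ := by
        rw [lintegral_const_mul]
        exact ((measurable_derivAbs [a]).pow_const δ).ennreal_ofReal

omit hδ hψ in
lemma measure_image_gaussMap_eq_tsum (μ : Measure ℝ) {a : ℕ} (ha : a.Prime)
    {A : Set ℝ} (hA : A ⊆ primeCantor) (hm : MeasurableSet A) (N : ℕ) :
    μ (gaussMap a '' A) = ∑' j, μ (gaussMap a '' slice A N j) := by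
  conv_lhs => rw [← iUnion_slice A N, image_iUnion]
  refine measure_iUnion (fun i j hij => ?_) fun j => measurableSet_image_gaussMap ha
    (inter_subset_left.trans hA) (measurableSet_slice hm N j)
  refine disjoint_left.2 ?_
  rintro _ ⟨x, hx, rfl⟩ ⟨y, hy, hxy⟩
  have h := congrArg shift hxy
  rw [shift_gaussMap (hA hx.1), shift_gaussMap (hA hy.1)] at h
  rw [h] at hy
  exact disjoint_left.1 (pairwise_disjoint_slice A N hij) hx hy

omit hδ hψ in
lemma le_of_forall_rpow_mul_le {x y : ℝ≥0∞}
    (h : ∀ N : ℕ, x ≤ ENNReal.ofReal ((1 + 1 / ((N : ℝ) + 1)) ^ (2 * δ)) * y) : x ≤ y := by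
  have h1 : Tendsto (fun N : ℕ => (1 + 1 / ((N : ℝ) + 1)) ^ (2 * δ)) atTop (𝓝 1) := by
    have h2 : Tendsto (fun N : ℕ => (1 : ℝ) + 1 / ((N : ℝ) + 1)) atTop (𝓝 1) := by
      simpa using tendsto_one_div_add_atTop_nhds_zero_nat (𝕜 := ℝ) |>.const_add 1
    have h3 := h2.rpow_const (p := 2 * δ) (Or.inl one_ne_zero)
    rwa [Real.one_rpow] at h3
  have h2 := ENNReal.tendsto_ofReal h1
  rw [ENNReal.ofReal_one] at h2
  have h3 := ENNReal.Tendsto.mul_const (b := y) h2 (Or.inl one_ne_zero)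
  rw [one_mul] at h3
  exact ge_of_tendsto' h3 h

lemma lintegral_le_image_of_antitone
    (hanti : AntitoneOn (fun r : ℝ => r ^ (-δ) * ψ r) (Ioi 0)) {a : ℕ} (ha : a.Prime)
    {A : Set ℝ} (hA : A ⊆ primeCantor) (hm : MeasurableSet A) :
    ∫⁻ x in A, ENNReal.ofReal (derivAbs [a] x ^ δ) ∂(hausdorffPsi ψ) ≤
      hausdorffPsi ψ (gaussMap a '' A) := by
  refine le_of_forall_rpow_mul_le (δ := δ) fun N => ?_
  rw [measure_image_gaussMap_eq_tsum _ ha hA hm N, ← ENNReal.tsum_mul_left]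
  conv_lhs => rw [← iUnion_slice A N]
  rw [lintegral_iUnion (fun j => measurableSet_slice hm N j) (pairwise_disjoint_slice A N)]
  exact ENNReal.tsum_le_tsum fun j => slice_estimate_of_antitone hδ hψ hanti ha hA N j

lemma image_le_lintegral_of_monotone
    (hmono : MonotoneOn (fun r : ℝ => r ^ (-δ) * ψ r) (Ioi 0)) {a : ℕ} (ha : a.Prime)
    {A : Set ℝ} (hA : A ⊆ primeCantor) (hm : MeasurableSet A) :
    hausdorffPsi ψ (gaussMap a '' A) ≤
      ∫⁻ x in A, ENNReal.ofReal (derivAbs [a] x ^ δ) ∂(hausdorffPsi ψ) := by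
  refine le_of_forall_rpow_mul_le (δ := δ) fun N => ?_
  rw [measure_image_gaussMap_eq_tsum _ ha hA hm N]
  conv_rhs => rw [← iUnion_slice A N]
  rw [lintegral_iUnion (fun j => measurableSet_slice hm N j) (pairwise_disjoint_slice A N),
    ← ENNReal.tsum_mul_left]
  exact ENNReal.tsum_le_tsum fun j => slice_estimate_of_monotone hδ hψ hmono ha hA hm N j

end

/-! ### Conformal measures -/

/-- The dual transfer operator at exponent `δ`. -/
def transfer (δ : ℝ) (ν : Measure ℝ) : Measure ℝ :=
  Measure.sum fun a : primes =>
    (ν.withDensity fun x => ENNReal.ofReal (derivAbs [(a : ℕ)] x ^ δ)).map (gaussMap a)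

lemma measurable_derivAbs_rpow (δ : ℝ) (ω : List ℕ) :
    Measurable fun x => ENNReal.ofReal (derivAbs ω x ^ δ) :=
  ((measurable_derivAbs ω).pow_const δ).ennreal_ofReal

lemma lintegral_transfer (δ : ℝ) (ν : Measure ℝ) {f : ℝ → ℝ≥0∞} (hf : Measurable f) :
    ∫⁻ x, f x ∂(transfer δ ν) = ∑' a : primes,
      ∫⁻ x, ENNReal.ofReal (derivAbs [(a : ℕ)] x ^ δ) * f (gaussMap a x) ∂ν := by
  rw [transfer, lintegral_sum_measure]
  refine tsum_congr fun a => ?_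
  rw [lintegral_map hf (measurable_gaussMap a)]
  exact lintegral_withDensity_eq_lintegral_mul _ (measurable_derivAbs_rpow δ [(a : ℕ)])
    (hf.comp (measurable_gaussMap a))

lemma measurable_partitionFn (s : ℝ) (n : ℕ) : Measurable (partitionFn s n) :=
  Measurable.tsum fun ω => measurable_derivAbs_rpow s (wordOf ω)

lemma transfer_apply (δ : ℝ) (ν : Measure ℝ) {B : Set ℝ} (hB : MeasurableSet B) :
    transfer δ ν B = ∑' a : primes,
      ∫⁻ x in gaussMap a ⁻¹' B, ENNReal.ofReal (derivAbs [(a : ℕ)] x ^ δ) ∂ν := by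
  rw [transfer, Measure.sum_apply _ hB]
  refine tsum_congr fun a => ?_
  rw [Measure.map_apply (measurable_gaussMap a) hB,
    withDensity_apply _ (measurable_gaussMap a hB)]

section

variable {δ : ℝ} {ν : Measure ℝ} (hν : ν primeCantorᶜ = 0)
include hν

lemma setLIntegral_inter_primeCantor (f : ℝ → ℝ≥0∞) {B : Set ℝ} :
    ∫⁻ x in B, f x ∂ν = ∫⁻ x in B ∩ primeCantor, f x ∂ν := by
  refine setLIntegral_congr ?_
  refine (inter_ae_eq_left_of_ae_eq_univ ?_).symm
  rwa [ae_eq_univ]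

lemma measure_inter_primeCantor (B : Set ℝ) : ν (B ∩ primeCantor) = ν B := by
  refine measure_congr (inter_ae_eq_left_of_ae_eq_univ ?_)
  rwa [ae_eq_univ]

lemma measure_eq_tsum_image {B : Set ℝ} (hB : MeasurableSet B) :
    ν B = ∑' a : primes, ν (gaussMap a '' (gaussMap a ⁻¹' B ∩ primeCantor)) := by
  rw [← measure_iUnion, ← measure_inter_primeCantor hν B]
  · congr 1
    ext x
    simp only [mem_inter_iff, mem_iUnion, mem_image, mem_preimage]
    constructor
    · rintro ⟨hx, hxΛ⟩
      obtain ⟨hp, hs⟩ := digit_prime_and_shift_mem hxΛ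
      refine ⟨⟨digit x, hp⟩, shift x, ⟨?_, hs⟩, gaussMap_digit_shift x⟩
      show gaussMap (digit x) (shift x) ∈ B
      rwa [gaussMap_digit_shift]
    · rintro ⟨a, y, ⟨hy, hyΛ⟩, rfl⟩
      exact ⟨hy, gaussMap_mem a.2 hyΛ⟩
  · intro a b hab
    refine disjoint_left.2 ?_
    rintro _ ⟨x, hx, rfl⟩ ⟨y, hy, hxy⟩
    have h := congrArg digit hxy
    rw [digit_gaussMap hx.2, digit_gaussMap hy.2] at h
    exact hab (Subtype.ext h.symm)
  · exact fun a => measurableSet_image_gaussMap a.2 inter_subset_right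
      ((measurable_gaussMap a hB).inter measurableSet_primeCantor)

lemma transfer_compl : transfer δ ν primeCantorᶜ = 0 := by
  rw [transfer_apply δ ν measurableSet_primeCantor.compl, ENNReal.tsum_eq_zero]
  intro a
  rw [setLIntegral_inter_primeCantor hν]
  have : gaussMap (a : ℕ) ⁻¹' primeCantorᶜ ∩ primeCantor = ∅ := by
    ext x
    simp only [mem_inter_iff, mem_preimage, mem_compl_iff, mem_empty_iff_false, iff_false, not_and]
    exact fun h hx => h (gaussMap_mem a.2 hx)
  rw [this, Measure.restrict_empty, lintegral_zero_measure]

lemma transfer_le (h : ∀ a : ℕ, a.Prime → ∀ A ⊆ primeCantor, MeasurableSet A →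
    ∫⁻ x in A, ENNReal.ofReal (derivAbs [a] x ^ δ) ∂ν ≤ ν (gaussMap a '' A)) :
    transfer δ ν ≤ ν := by
  refine Measure.le_iff.2 fun B hB => ?_
  rw [transfer_apply δ ν hB, measure_eq_tsum_image hν hB]
  refine ENNReal.tsum_le_tsum fun a => ?_
  rw [setLIntegral_inter_primeCantor hν]
  exact h a a.2 _ inter_subset_right
    ((measurable_gaussMap a hB).inter measurableSet_primeCantor)

lemma le_transfer (h : ∀ a : ℕ, a.Prime → ∀ A ⊆ primeCantor, MeasurableSet A →
    ν (gaussMap a '' A) ≤ ∫⁻ x in A, ENNReal.ofReal (derivAbs [a] x ^ δ) ∂ν) :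
    ν ≤ transfer δ ν := by
  refine Measure.le_iff.2 fun B hB => ?_
  rw [transfer_apply δ ν hB, measure_eq_tsum_image hν hB]
  refine ENNReal.tsum_le_tsum fun a => ?_
  rw [setLIntegral_inter_primeCantor hν]
  exact h a a.2 _ inter_subset_right
    ((measurable_gaussMap a hB).inter measurableSet_primeCantor)

lemma ae_mem_primeCantor : ∀ᵐ x ∂ν, x ∈ primeCantor := hν

lemma lintegral_partitionFn_transfer (n : ℕ) :
    ∫⁻ x, partitionFn δ n x ∂(transfer δ ν) = ∫⁻ x, partitionFn δ (n + 1) x ∂ν := by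
  rw [lintegral_transfer δ ν (measurable_partitionFn δ n), ← lintegral_tsum]
  · refine lintegral_congr_ae ?_
    filter_upwards [ae_mem_primeCantor hν] with x hx
    rw [partitionFn_succ δ n (primeCantor_subset hx).1.le]
    exact tsum_congr fun a => mul_comm _ _
  · exact fun a => ((measurable_derivAbs_rpow δ _).mul
      ((measurable_partitionFn δ n).comp (measurable_gaussMap a))).aemeasurable

omit hν in
lemma eq_zero_of_forall_nat_mul_le {x M : ℝ≥0∞} (hM : M ≠ ⊤) (h : ∀ n : ℕ, n * x ≤ M) : x = 0 := by
  by_contra hx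
  obtain ⟨n, hn⟩ := ENNReal.exists_nat_mul_gt hx hM
  exact (h n).not_gt hn

/-- A finite measure that is sub- or super-invariant under the critical transfer operator is
invariant. -/
lemma transfer_eq [IsFiniteMeasure ν] (hδ : 1 / 2 < δ) (hp : pressure primes δ = 0)
    (h : transfer δ ν ≤ ν ∨ ν ≤ transfer δ ν) : transfer δ ν = ν := by
  have hδ0 : 0 ≤ δ := by linarith
  set c : ℝ≥0∞ := ENNReal.ofReal ((1 / 4) ^ δ) with hc
  have hc0 : c ≠ 0 := by
    rw [hc, ne_eq, ENNReal.ofReal_eq_zero, not_le]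
    positivity
  set I : ℕ → ℝ≥0∞ := fun n => ∫⁻ x, partitionFn δ n x ∂ν with hI
  have hIle : ∀ n, I n ≤ ENNReal.ofReal (4 ^ δ) * ν univ := fun n => by
    rw [← lintegral_const]
    refine lintegral_mono_ae ?_
    filter_upwards [ae_mem_primeCantor hν] with x hx
    exact (partitionFn_le hδ0 n (primeCantor_subset hx).1.le).trans (partitionFn_bounds hδ hp n).2
  have hM : ENNReal.ofReal (4 ^ δ) * ν univ ≠ ⊤ :=
    ENNReal.mul_ne_top ENNReal.ofReal_ne_top (measure_ne_top _ _)
  have hlow : ∀ σ : Measure ℝ, σ primeCantorᶜ = 0 → ∀ n,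
      c * σ univ ≤ ∫⁻ x, partitionFn δ n x ∂σ := fun σ hσ n => by
    rw [← lintegral_const]
    refine lintegral_mono_ae ?_
    filter_upwards [ae_mem_primeCantor hσ] with x hx
    refine le_trans ?_ (le_partitionFn hδ0 n (primeCantor_subset_Icc hx))
    exact le_mul_of_one_le_right bot_le (partitionFn_bounds hδ hp n).1
  have htfin : IsFiniteMeasure (transfer δ ν) := ⟨by
    have h1 := lintegral_partitionFn_transfer hν (δ := δ) 0
    simp only [partitionFn_zero, lintegral_one] at h1
    rw [h1]
    exact ((hIle 1).trans_lt hM.lt_top)⟩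
  rcases h with h | h
  · set σ := ν - transfer δ ν with hσ
    have hsum : σ + transfer δ ν = ν := Measure.sub_add_cancel_of_le h
    have hσΛ : σ primeCantorᶜ = 0 := Measure.absolutelyContinuous_of_le Measure.sub_le hν
    have hstep : ∀ n, c * σ univ + I (n + 1) ≤ I n := fun n => by
      have : I n = ∫⁻ x, partitionFn δ n x ∂(σ + transfer δ ν) := by rw [hsum]
      rw [this, lintegral_add_measure, lintegral_partitionFn_transfer hν]
      gcongr
      exact hlow σ hσΛ n
    have hind : ∀ n : ℕ, n * (c * σ univ) + I n ≤ I 0 := fun n => by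
      induction n with
      | zero => simp
      | succ n ih =>
        refine le_trans ?_ ih
        rw [Nat.cast_succ, add_mul, one_mul, add_assoc]
        gcongr
        exact hstep n
    have hz : c * σ univ = 0 := eq_zero_of_forall_nat_mul_le hM fun n =>
      (le_self_add.trans (hind n)).trans (hIle 0)
    have : σ = 0 := Measure.measure_univ_eq_zero.1 ((mul_eq_zero.1 hz).resolve_left hc0)
    rwa [this, zero_add] at hsum
  · set σ := transfer δ ν - ν with hσ
    have hsum : σ + ν = transfer δ ν := Measure.sub_add_cancel_of_le h
    have hσΛ : σ primeCantorᶜ = 0 :=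
      Measure.absolutelyContinuous_of_le Measure.sub_le (transfer_compl hν)
    have hstep : ∀ n, c * σ univ + I n ≤ I (n + 1) := fun n => by
      have : I (n + 1) = ∫⁻ x, partitionFn δ n x ∂(σ + ν) := by
        rw [hsum, lintegral_partitionFn_transfer hν]
      rw [this, lintegral_add_measure]
      gcongr
      exact hlow σ hσΛ n
    have hind : ∀ n : ℕ, n * (c * σ univ) ≤ I n := fun n => by
      induction n with
      | zero => simp
      | succ n ih =>
        refine le_trans ?_ (hstep n)
        rw [Nat.cast_succ, add_mul, one_mul, add_comm]
        gcongr
    have hz : c * σ univ = 0 := eq_zero_of_forall_nat_mul_le hM fun n =>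
      (hind n).trans (hIle n)
    have : σ = 0 := Measure.measure_univ_eq_zero.1 ((mul_eq_zero.1 hz).resolve_left hc0)
    rw [this, zero_add] at hsum
    exact hsum.symm

lemma lintegral_image_gaussMap (ht : transfer δ ν = ν) {a : ℕ} (ha : a.Prime)
    {A : Set ℝ} (hA : A ⊆ primeCantor) (hm : MeasurableSet A) {f : ℝ → ℝ≥0∞} (hf : Measurable f) :
    ∫⁻ x in gaussMap a '' A, f x ∂ν =
      ∫⁻ x in A, ENNReal.ofReal (derivAbs [a] x ^ δ) * f (gaussMap a x) ∂ν := by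
  have hmA := measurableSet_image_gaussMap ha hA hm
  rw [← lintegral_indicator hmA, ← lintegral_indicator hm]
  conv_lhs => rw [← ht]
  rw [lintegral_transfer δ ν (hf.indicator hmA), tsum_eq_single (⟨a, ha⟩ : primes)]
  · refine lintegral_congr_ae ?_
    filter_upwards [ae_mem_primeCantor hν] with x hx
    by_cases hxA : x ∈ A
    · rw [indicator_of_mem hxA, indicator_of_mem (mem_image_of_mem _ hxA)]
    · rw [indicator_of_notMem hxA, indicator_of_notMem, mul_zero]
      rintro ⟨y, hy, hxy⟩
      have h := congrArg shift hxy
      rw [shift_gaussMap (hA hy), shift_gaussMap hx] at h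
      exact hxA (h ▸ hy)
  · intro b hb
    refine (lintegral_eq_zero_iff' ((measurable_derivAbs_rpow δ _).mul
      ((hf.indicator hmA).comp (measurable_gaussMap b))).aemeasurable).2 ?_
    filter_upwards [ae_mem_primeCantor hν] with x hx
    rw [Pi.mul_apply, Function.comp_apply, indicator_of_notMem, mul_zero, Pi.zero_apply]
    rintro ⟨y, hy, hxy⟩
    have h := congrArg digit hxy
    rw [digit_gaussMap (hA hy), digit_gaussMap hx] at h
    exact hb (Subtype.ext h.symm)

lemma lintegral_image_wordMap (ht : transfer δ ν = ν) {ω : List ℕ} (hω : PrimeWord ω)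
    {A : Set ℝ} (hA : A ⊆ primeCantor) (hm : MeasurableSet A) {f : ℝ → ℝ≥0∞} (hf : Measurable f) :
    ∫⁻ x in wordMap ω '' A, f x ∂ν =
      ∫⁻ x in A, ENNReal.ofReal (derivAbs ω x ^ δ) * f (wordMap ω x) ∂ν := by
  induction ω generalizing f with
  | nil => simp [wordMap, derivAbs]
  | cons a ω ih =>
    obtain ⟨ha, hω'⟩ := hω.of_cons
    have hsub : wordMap ω '' A ⊆ primeCantor := by
      rintro _ ⟨x, hx, rfl⟩
      exact (wordMap_spec hω' (hA hx)).1
    have himg : wordMap (a :: ω) '' A = gaussMap a '' (wordMap ω '' A) := by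
      rw [image_image]
      rfl
    rw [himg, lintegral_image_gaussMap hν ht ha hsub (measurableSet_image_wordMap hω' hA hm) hf]
    refine (ih hω' ((measurable_derivAbs_rpow δ _).mul (hf.comp (measurable_gaussMap a)))).trans ?_
    refine setLIntegral_congr_fun hm fun x hx => ?_
    have hx0 := (primeCantor_subset (hA hx)).1.le
    have h1 := wordMap_nonneg hω'.posWord hx0
    have h2 := derivAbs_pos hω'.posWord hx0
    have h3 := derivAbs_pos (primeWord_singleton ha).posWord h1
    have h4 : derivAbs (a :: ω) x = derivAbs [a] (wordMap ω x) * derivAbs ω x :=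
      derivAbs_append [a] ω x
    simp only [Pi.mul_apply, Function.comp_apply]
    rw [h4, Real.mul_rpow h3.le h2.le, ENNReal.ofReal_mul (by positivity), ← mul_assoc,
      mul_comm (ENNReal.ofReal (derivAbs ω x ^ δ))]
    rfl

end

/-- A finite measure on the prime Cantor set that scales by `|φ_ω'|^δ`, up to a constant. -/
structure IsQuasiConformal (δ : ℝ) (ν : Measure ℝ) : Prop where
  finite : ν univ ≠ ⊤
  compl_null : ν primeCantorᶜ = 0
  image_le : ∀ ω, PrimeWord ω → ∀ A ⊆ primeCantor, MeasurableSet A →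
    ν (wordMap ω '' A) ≤ ENNReal.ofReal (rho ω ^ δ) * ν A
  le_image : ∀ ω, PrimeWord ω → ∀ A ⊆ primeCantor, MeasurableSet A →
    ENNReal.ofReal (rho ω ^ δ / 4) * ν A ≤ ν (wordMap ω '' A)

lemma isQuasiConformal_of_transfer_eq {δ : ℝ} (hδ₀ : 0 ≤ δ) (hδ₁ : δ ≤ 1) {ν : Measure ℝ}
    [IsFiniteMeasure ν] (hν : ν primeCantorᶜ = 0) (ht : transfer δ ν = ν) :
    IsQuasiConformal δ ν where
  finite := measure_ne_top _ _
  compl_null := hν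
  image_le ω hω A hA hm := by
    have h := lintegral_image_wordMap hν ht hω hA hm (measurable_const (a := (1 : ℝ≥0∞)))
    simp only [setLIntegral_one, mul_one] at h
    rw [h, ← setLIntegral_const]
    refine setLIntegral_mono measurable_const fun x hx => ENNReal.ofReal_le_ofReal ?_
    have hx0 := (primeCantor_subset (hA hx)).1.le
    exact Real.rpow_le_rpow (derivAbs_pos hω.posWord hx0).le (derivAbs_le hω.posWord hx0) hδ₀
  le_image ω hω A hA hm := by
    have h := lintegral_image_wordMap hν ht hω hA hm (measurable_const (a := (1 : ℝ≥0∞)))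
    simp only [setLIntegral_one, mul_one] at h
    rw [h, ← setLIntegral_const]
    refine setLIntegral_mono (measurable_derivAbs_rpow δ ω) fun x hx =>
      ENNReal.ofReal_le_ofReal ?_
    have hx0 := primeCantor_subset_Icc (hA hx)
    have h0 := rho_pos hω.posWord
    refine le_trans ?_ (Real.rpow_le_rpow (by positivity) (le_derivAbs hω.posWord hx0.1 hx0.2) hδ₀)
    rw [Real.div_rpow h0.le (by norm_num)]
    gcongr
    calc (4 : ℝ) ^ δ ≤ 4 ^ (1 : ℝ) := Real.rpow_le_rpow_of_exponent_le (by norm_num) hδ₁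
      _ = 4 := Real.rpow_one _

/-! ### Sums over primes -/

/-- The measure on `ℕ` giving mass `p^(-2δ)` to each prime `p`. -/
def primeMass (δ : ℝ) : Measure ℕ :=
  Measure.sum fun p : primes => ENNReal.ofReal (((p : ℕ) : ℝ) ^ (-(2 * δ))) • Measure.dirac (p : ℕ)

lemma primeMass_apply (δ : ℝ) (J : Set ℕ) :
    primeMass δ J = ∑' p : primes,
      ENNReal.ofReal (((p : ℕ) : ℝ) ^ (-(2 * δ))) * J.indicator 1 (p : ℕ) := by
  rw [primeMass, Measure.sum_apply _ (MeasurableSet.of_discrete)]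
  refine tsum_congr fun p => ?_
  rw [Measure.smul_apply, Measure.dirac_apply, smul_eq_mul]

lemma primeMass_singleton (δ : ℝ) {p : ℕ} (hp : p.Prime) :
    primeMass δ {p} = ENNReal.ofReal ((p : ℝ) ^ (-(2 * δ))) := by
  rw [primeMass_apply, tsum_eq_single (⟨p, hp⟩ : primes)]
  · simp
  · intro b hb
    rw [indicator_of_notMem, mul_zero]
    exact fun h => hb (Subtype.ext h)

lemma primeMass_not_prime (δ : ℝ) : primeMass δ {p | ¬ p.Prime} = 0 := by
  rw [primeMass_apply, ENNReal.tsum_eq_zero]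
  intro p
  rw [indicator_of_notMem, mul_zero]
  exact fun h => h p.2

lemma primeMass_finset (δ : ℝ) (F : Finset ℕ) (hF : ∀ p ∈ F, p.Prime) :
    primeMass δ F = ENNReal.ofReal (∑ p ∈ F, (p : ℝ) ^ (-(2 * δ))) := by
  rw [← sum_measure_singleton, ENNReal.ofReal_sum_of_nonneg fun p _ => by positivity]
  exact Finset.sum_congr rfl fun p hp => primeMass_singleton δ (hF p hp)

lemma primeMass_le_of_subset (δ : ℝ) {J : Set ℕ} {F : Finset ℕ} (hF : ∀ p ∈ F, p.Prime)
    (h : ∀ p ∈ J, p.Prime → p ∈ F) :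
    primeMass δ J ≤ ENNReal.ofReal (∑ p ∈ F, (p : ℝ) ^ (-(2 * δ))) := by
  rw [← primeMass_finset δ F hF]
  calc primeMass δ J ≤ primeMass δ (F ∪ {p | ¬ p.Prime}) := measure_mono fun p hp => by
        by_cases hp' : p.Prime
        · exact Or.inl (h p hp hp')
        · exact Or.inr hp'
    _ ≤ _ := (measure_union_le _ _).trans (by rw [primeMass_not_prime, add_zero])

lemma primeMass_ne_top {δ : ℝ} (hδ : 1 / 2 < δ) (J : Set ℕ) : primeMass δ J ≠ ⊤ := by
  refine ne_top_of_le_ne_top (partitionFn_one_ne_top hδ) ?_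
  rw [partitionFn_one, primeMass_apply]
  refine ENNReal.tsum_le_tsum fun p => mul_le_of_le_one_right bot_le ?_
  exact indicator_le_self' (by simp) _ |>.trans (by simp)

lemma sum_log_Ioc (m n : ℕ) (h : m ≤ n) :
    ∑ p ∈ Finset.Ioc m n with p.Prime, Real.log p = Chebyshev.theta n - Chebyshev.theta m := by
  rw [Chebyshev.theta, Chebyshev.theta, Nat.floor_natCast, Nat.floor_natCast, eq_sub_iff_add_eq,
    ← Finset.sum_union]
  · congr 1
    ext p
    simp only [Finset.mem_union, Finset.mem_filter, Finset.mem_Ioc]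
    constructor
    · rintro (⟨⟨h1, h2⟩, h3⟩ | ⟨⟨h1, h2⟩, h3⟩)
      · exact ⟨⟨by omega, h2⟩, h3⟩
      · exact ⟨⟨h1, by omega⟩, h3⟩
    · rintro ⟨⟨h1, h2⟩, h3⟩
      by_cases h4 : m < p
      · exact Or.inl ⟨⟨h4, h2⟩, h3⟩
      · exact Or.inr ⟨⟨h1, by omega⟩, h3⟩
  · refine Finset.disjoint_left.2 fun p hp hp' => ?_
    simp only [Finset.mem_filter, Finset.mem_Ioc] at hp hp'
    omega

lemma log_nat_pos {N : ℕ} (hN : 2 ≤ N) : 0 < Real.log N :=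
  Real.log_pos (by exact_mod_cast hN)

/-- The order of magnitude of `∑_{p ≥ N} p^(-2δ)`. -/
def primeTail (δ : ℝ) (N : ℕ) : ℝ := (N : ℝ) ^ (1 - 2 * δ) / Real.log N

lemma primeTail_pos (δ : ℝ) {N : ℕ} (hN : 2 ≤ N) : 0 < primeTail δ N := by
  have := log_nat_pos hN
  have : (0 : ℝ) < N := by exact_mod_cast (by omega : 0 < N)
  rw [primeTail]
  positivity

section

variable {δ : ℝ} (hδ : 1 / 2 < δ)
include hδ

lemma primeMass_block_le {N : ℕ} (hN : 2 ≤ N) :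
    primeMass δ (Ico N (2 * N)) ≤ ENNReal.ofReal (2 * Real.log 4 * primeTail δ N) := by
  have hN0 : (0 : ℝ) < N := by exact_mod_cast (by omega : 0 < N)
  have hl := log_nat_pos hN
  refine (primeMass_le_of_subset δ (F := {p ∈ Finset.Ioc (N - 1) (2 * N) | p.Prime})
    (fun p hp => (Finset.mem_filter.1 hp).2) fun p hp hp' => ?_).trans
    (ENNReal.ofReal_le_ofReal ?_)
  · rw [Finset.mem_filter, Finset.mem_Ioc]
    have := hp.1
    have := hp.2
    exact ⟨by omega, hp'⟩
  · have h1 : ∀ p ∈ ({p ∈ Finset.Ioc (N - 1) (2 * N) | p.Prime} : Finset ℕ),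
        (p : ℝ) ^ (-(2 * δ)) ≤ (N : ℝ) ^ (-(2 * δ)) / Real.log N * Real.log p := by
      intro p hp
      rw [Finset.mem_filter, Finset.mem_Ioc] at hp
      have hNp : (N : ℝ) ≤ p := by exact_mod_cast (by omega : N ≤ p)
      have h2 : Real.log N ≤ Real.log p := Real.log_le_log hN0 hNp
      have h3 : (p : ℝ) ^ (-(2 * δ)) ≤ (N : ℝ) ^ (-(2 * δ)) :=
        Real.rpow_le_rpow_of_nonpos hN0 hNp (by linarith)
      refine h3.trans ?_
      rw [div_mul_eq_mul_div, le_div_iff₀ hl]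
      gcongr
    refine (Finset.sum_le_sum h1).trans ?_
    rw [← Finset.mul_sum, sum_log_Ioc _ _ (by omega), primeTail]
    have h4 : Chebyshev.theta ((2 * N : ℕ) : ℝ) ≤ Real.log 4 * ((2 * N : ℕ) : ℝ) :=
      Chebyshev.theta_le_log4_mul_x (by positivity)
    have h5 : 0 ≤ Chebyshev.theta ((N - 1 : ℕ) : ℝ) := Chebyshev.theta_nonneg _
    push_cast at h4
    have h6 : (N : ℝ) ^ (1 - 2 * δ) = (N : ℝ) ^ (-(2 * δ)) * N := by
      rw [← Real.rpow_add_one hN0.ne']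
      congr 1
      ring
    rw [h6]
    calc _ ≤ (N : ℝ) ^ (-(2 * δ)) / Real.log N * (Real.log 4 * (2 * N)) := by
          refine mul_le_mul_of_nonneg_left ?_ (by positivity)
          push_cast
          linarith
      _ = _ := by ring

omit hδ in
lemma primeTail_pow_mul_le {N : ℕ} (hN : 2 ≤ N) (k : ℕ) :
    primeTail δ (2 ^ k * N) ≤ ((2 : ℝ) ^ (1 - 2 * δ)) ^ k * primeTail δ N := by
  have hN0 : (0 : ℝ) < N := by exact_mod_cast (by omega : 0 < N)
  have hl := log_nat_pos hN
  rw [primeTail, primeTail]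
  push_cast
  rw [Real.mul_rpow (by positivity) hN0.le, mul_div_assoc', ← Real.rpow_natCast,
    ← Real.rpow_natCast, ← Real.rpow_mul (by norm_num), ← Real.rpow_mul (by norm_num),
    mul_comm (1 - 2 * δ)]
  refine div_le_div_of_nonneg_left (by positivity) hl (Real.log_le_log hN0 ?_)
  exact le_mul_of_one_le_left hN0.le (Real.one_le_rpow (by norm_num) (by positivity))

lemma exists_primeMass_le : ∃ C : ℝ, 0 < C ∧ ∀ N : ℕ, 2 ≤ N →
    primeMass δ (Ici N) ≤ ENNReal.ofReal (C * primeTail δ N) := by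
  set q : ℝ := 2 ^ (1 - 2 * δ) with hq
  have hq0 : 0 < q := by positivity
  have hq1 : q < 1 := Real.rpow_lt_one_of_one_lt_of_neg (by norm_num) (by linarith)
  have hl4 : 0 < Real.log 4 := Real.log_pos (by norm_num)
  refine ⟨2 * Real.log 4 * (1 - q)⁻¹, mul_pos (by positivity) (by
    rw [inv_pos]; linarith), fun N hN => ?_⟩
  have hT := primeTail_pos δ hN
  have hsub : Ici N ⊆ ⋃ k : ℕ, Ico (2 ^ k * N) (2 * (2 ^ k * N)) := by
    intro p hp
    have hp' : N ≤ p := hp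
    have h0 : p / N ≠ 0 := (Nat.div_pos hp' (by omega)).ne'
    refine mem_iUnion.2 ⟨Nat.log 2 (p / N), ?_, ?_⟩
    · exact (Nat.le_div_iff_mul_le (by omega)).1 (Nat.pow_log_le_self 2 h0)
    · have h1 := Nat.lt_pow_succ_log_self (b := 2) (by norm_num) (p / N)
      have h2 := (Nat.div_lt_iff_lt_mul (by omega : 0 < N)).1 h1
      rw [pow_succ] at h2
      linarith
  calc primeMass δ (Ici N) ≤ ∑' k : ℕ, primeMass δ (Ico (2 ^ k * N) (2 * (2 ^ k * N))) :=
        (measure_mono hsub).trans (measure_iUnion_le _)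
    _ ≤ ∑' k : ℕ, ENNReal.ofReal (2 * Real.log 4 * primeTail δ N * q ^ k) := by
        refine ENNReal.tsum_le_tsum fun k => ?_
        have hk : 2 ≤ 2 ^ k * N := hN.trans (Nat.le_mul_of_pos_left N (by positivity))
        refine (primeMass_block_le hδ hk).trans (ENNReal.ofReal_le_ofReal ?_)
        rw [mul_assoc _ (primeTail δ N), mul_comm (primeTail δ N)]
        exact mul_le_mul_of_nonneg_left (primeTail_pow_mul_le hN k) (by positivity)
    _ = ENNReal.ofReal (∑' k : ℕ, 2 * Real.log 4 * primeTail δ N * q ^ k) :=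
        (ENNReal.ofReal_tsum_of_nonneg (fun k => by positivity)
          ((summable_geometric_of_lt_one hq0.le hq1).mul_left _)).symm
    _ = _ := by
        rw [tsum_mul_left, tsum_geometric_of_lt_one hq0.le hq1]
        congr 1
        ring

omit hδ in
lemma exists_theta_ge : ∃ n₀ : ℕ, ∀ n : ℕ, n₀ ≤ n → (n : ℝ) / 2 ≤ Chebyshev.theta n := by
  obtain ⟨C, hC⟩ := Chebyshev.psi_sub_theta_le_mul_sqrt
  have hl2 : (0.69 : ℝ) < Real.log 2 := by linarith [Real.log_two_gt_d9]
  obtain ⟨m, hm⟩ := exists_nat_gt ((|C| + 4) / 0.19)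
  refine ⟨m ^ 2 + 1, fun n hn => ?_⟩
  have h1 := Chebyshev.psi_ge n
  have h2 := hC n
  have hn1 : (1 : ℝ) ≤ n := by exact_mod_cast (by omega : 1 ≤ n)
  set u : ℝ := √n with hu
  have hu2 : u * u = n := Real.mul_self_sqrt (by positivity)
  have hu0 : 1 ≤ u := Real.one_le_sqrt.2 hn1
  have hum : (m : ℝ) ≤ u := Real.le_sqrt_of_sq_le (by exact_mod_cast (by omega : m ^ 2 ≤ n))
  have h3 : Real.log (n + 1) ≤ 4 * u := by
    have h4 : ((n : ℝ) + 1) ≤ (2 * u) ^ 2 := by nlinarith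
    have h5 : Real.log (n + 1) ≤ Real.log ((2 * u) ^ 2) := Real.log_le_log (by positivity) h4
    rw [Real.log_pow] at h5
    have h6 := Real.log_le_sub_one_of_pos (by positivity : 0 < 2 * u)
    push_cast at h5
    linarith
  have h7 : C * u ≤ |C| * u := mul_le_mul_of_nonneg_right (le_abs_self C) (by linarith)
  have h8 : |C| + 4 ≤ 0.19 * u := by
    have := (div_lt_iff₀ (by norm_num : (0 : ℝ) < 0.19)).1 (hm.trans_le hum)
    linarith
  have h9 : (|C| + 4) * u ≤ 0.19 * n := by nlinarith
  nlinarith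

lemma exists_le_primeMass : ∃ c : ℝ, 0 < c ∧ ∀ N : ℕ, 2 ≤ N →
    ENNReal.ofReal (c * primeTail δ N) ≤ primeMass δ (Ici N) := by
  obtain ⟨n₀, hn₀⟩ := exists_theta_ge
  set M : ℕ := n₀ + 5 with hM
  have hM2 : 2 ≤ M := by omega
  have hM0 : (0 : ℝ) < M := by positivity
  have hlM := log_nat_pos hM2
  have hl2 : 0 < Real.log 2 := Real.log_pos (by norm_num)
  refine ⟨(M : ℝ) ^ (-(2 * δ)) / (Real.log M / Real.log 2 + 1), by positivity, fun N hN => ?_⟩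
  have hN0 : (0 : ℝ) < N := by exact_mod_cast (by omega : 0 < N)
  have hl := log_nat_pos hN
  have hMN : N ≤ M * N := Nat.le_mul_of_pos_left N (by omega)
  have hlMN := log_nat_pos (hN.trans hMN)
  have hsub : (({p ∈ Finset.Ioc N (M * N) | p.Prime} : Finset ℕ) : Set ℕ) ⊆ Ici N := by
    intro p hp
    simp only [Finset.coe_filter, Finset.mem_Ioc, Set.mem_ofPred_eq] at hp
    exact hp.1.1.le
  refine le_trans ?_ (measure_mono hsub)
  rw [primeMass_finset _ _ fun p hp => (Finset.mem_filter.1 hp).2]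
  refine ENNReal.ofReal_le_ofReal ?_
  have h1 : ∀ p ∈ ({p ∈ Finset.Ioc N (M * N) | p.Prime} : Finset ℕ),
      ((M * N : ℕ) : ℝ) ^ (-(2 * δ)) / Real.log (M * N : ℕ) * Real.log p ≤
        (p : ℝ) ^ (-(2 * δ)) := by
    intro p hp
    rw [Finset.mem_filter, Finset.mem_Ioc] at hp
    have hp0 : (0 : ℝ) < p := by exact_mod_cast hp.2.pos
    have hp1 : (p : ℝ) ≤ (M * N : ℕ) := by exact_mod_cast hp.1.2
    have h2 : Real.log p ≤ Real.log (M * N : ℕ) := Real.log_le_log hp0 hp1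
    have h3 : ((M * N : ℕ) : ℝ) ^ (-(2 * δ)) ≤ (p : ℝ) ^ (-(2 * δ)) :=
      Real.rpow_le_rpow_of_nonpos hp0 hp1 (by linarith)
    refine le_trans ?_ h3
    rw [div_mul_eq_mul_div, div_le_iff₀ hlMN]
    gcongr
  refine le_trans ?_ (Finset.sum_le_sum h1)
  rw [← Finset.mul_sum, sum_log_Ioc _ _ hMN, primeTail]
  have h4 := hn₀ (M * N) (by nlinarith)
  have h5 : Chebyshev.theta (N : ℝ) ≤ Real.log 4 * N := Chebyshev.theta_le_log4_mul_x hN0.le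
  have h6 : Real.log 4 ≤ 1.4 := by
    rw [show (4 : ℝ) = 2 ^ 2 by norm_num, Real.log_pow]
    have := Real.log_two_lt_d9
    push_cast
    linarith
  have hM5 : (5 : ℝ) ≤ M := by exact_mod_cast (by omega : 5 ≤ M)
  have h7 : (N : ℝ) ≤ Chebyshev.theta (M * N : ℕ) - Chebyshev.theta N := by
    push_cast at h4 ⊢
    nlinarith
  have h8 : Real.log (M * N : ℕ) ≤ (Real.log M / Real.log 2 + 1) * Real.log N := by
    push_cast
    rw [Real.log_mul hM0.ne' hN0.ne', add_mul, one_mul]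
    gcongr
    rw [div_mul_eq_mul_div, le_div_iff₀ hl2]
    gcongr
    exact_mod_cast hN
  have h9 : (N : ℝ) ^ (1 - 2 * δ) = (N : ℝ) ^ (-(2 * δ)) * N := by
    rw [← Real.rpow_add_one hN0.ne']
    congr 1
    ring
  calc (M : ℝ) ^ (-(2 * δ)) / (Real.log M / Real.log 2 + 1) * ((N : ℝ) ^ (1 - 2 * δ) / Real.log N)
      = ((M * N : ℕ) : ℝ) ^ (-(2 * δ)) / ((Real.log M / Real.log 2 + 1) * Real.log N) * N := by
        rw [h9]
        push_cast
        rw [Real.mul_rpow hM0.le hN0.le]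
        field_simp
    _ ≤ ((M * N : ℕ) : ℝ) ^ (-(2 * δ)) / Real.log (M * N : ℕ) * N := by gcongr
    _ ≤ _ := by gcongr

end

/-! ### Primes in short intervals -/

lemma card_primes_le_eight_mul {a : ℕ} (ha : 2 ≤ a) {F : Finset ℕ}
    (hF : ∀ b ∈ F, b.Prime ∧ b ≤ 8 * a) : (F.card : ℝ) ≤ 40 * a / Real.log a := by
  have hl := log_nat_pos ha
  have ha0 : (0 : ℝ) < a := by positivity
  have hcard : F.card ≤ Nat.primeCounting (8 * a) := by
    rw [Nat.primeCounting, Nat.primeCounting', Nat.count_eq_card_filter_range]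
    refine Finset.card_le_card fun b hb => ?_
    rw [Finset.mem_filter, Finset.mem_range]
    exact ⟨Nat.lt_succ_of_le (hF b hb).2, (hF b hb).1⟩
  have h8 : (1 : ℝ) < ((8 * a : ℕ) : ℝ) := by exact_mod_cast (by omega : 1 < 8 * a)
  have hpi := Chebyshev.pi_le_log4_mul_div h8
  rw [Nat.floor_natCast] at hpi
  have hlog8 : Real.log a ≤ Real.log ((8 * a : ℕ) : ℝ) :=
    Real.log_le_log ha0 (by exact_mod_cast (by omega : a ≤ 8 * a))
  have hl4 : Real.log 4 ≤ 2 := by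
    rw [show (4 : ℝ) = 2 ^ 2 by norm_num, Real.log_pow]
    have := Real.log_two_lt_d9
    push_cast
    linarith
  have hl40 : 0 < Real.log 4 := Real.log_pos (by norm_num)
  have hsq : √((8 * a : ℕ) : ℝ) ≤ 3 * √(a : ℝ) := by
    rw [Real.sqrt_le_left (by positivity), mul_pow, Real.sq_sqrt ha0.le]
    push_cast
    linarith
  have hls : Real.log a ≤ 2 * √(a : ℝ) := by
    have := Real.log_le_sub_one_of_pos (Real.sqrt_pos.2 ha0)
    rw [Real.log_sqrt ha0.le] at this
    linarith [Real.sqrt_nonneg (a : ℝ)]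
  have h1 : Real.log 4 * ((8 * a : ℕ) : ℝ) / Real.log √((8 * a : ℕ) : ℝ) ≤
      32 * a / Real.log a := by
    rw [Real.log_sqrt (by positivity)]
    refine (div_le_div_of_nonneg_left (by positivity) (by positivity)
      (by linarith : Real.log a / 2 ≤ _)).trans ?_
    rw [div_div_eq_mul_div]
    refine div_le_div_of_nonneg_right ?_ hl.le
    push_cast
    nlinarith
  have h2 : √((8 * a : ℕ) : ℝ) ≤ 6 * a / Real.log a := by
    rw [le_div_iff₀ hl]
    calc √((8 * a : ℕ) : ℝ) * Real.log a ≤ 3 * √(a : ℝ) * (2 * √(a : ℝ)) := by gcongr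
      _ = 6 * (√(a : ℝ) * √(a : ℝ)) := by ring
      _ = 6 * a := by rw [Real.mul_self_sqrt ha0.le]
  calc (F.card : ℝ) ≤ Nat.primeCounting (8 * a) := by exact_mod_cast hcard
    _ ≤ 32 * a / Real.log a + 6 * a / Real.log a := by linarith
    _ ≤ 40 * a / Real.log a := by
      rw [← add_div]
      gcongr
      linarith

lemma choose_add_le {x M : ℕ} (hM : 1 ≤ M) :
    ((M + x).choose M : ℝ) ≤ Real.exp (M * (1 + Real.log ((M + x : ℕ) / M))) := by
  have hM0 : (0 : ℝ) < M := by exact_mod_cast hM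
  have hy : (0 : ℝ) < ((M + x : ℕ) : ℝ) := by exact_mod_cast (by omega : 0 < M + x)
  refine (Nat.choose_le_pow_div M (M + x)).trans ?_
  rw [mul_add, mul_one, Real.exp_add, mul_comm (M : ℝ) (Real.log _), Real.exp_mul,
    Real.exp_log (by positivity), Real.rpow_natCast, div_pow, mul_div_assoc']
  rw [le_div_iff₀ (by positivity), div_mul_eq_mul_div, mul_div_assoc, mul_comm]
  gcongr
  exact Real.pow_div_factorial_le_exp _ hM0.le M

lemma prod_primes_le_choose {x M : ℕ} {F : Finset ℕ}
    (hF : ∀ b ∈ F, b.Prime ∧ x < b ∧ M < b ∧ b ≤ M + x) : ∏ b ∈ F, b ≤ (M + x).choose M := by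
  refine Nat.le_of_dvd (Nat.choose_pos (Nat.le_add_right _ _)) ?_
  refine Finset.prod_primes_dvd _ (fun b hb => (hF b hb).1.prime) fun b hb => ?_
  obtain ⟨h1, h2, h3, h4⟩ := hF b hb
  exact h1.dvd_choose_add h3 h2 h4

lemma card_primes_near_le {δ : ℝ} (hδ0 : 0 < δ) (hδ : δ < 1) {a : ℕ} {H : ℝ}
    (hH : 1 ≤ H) (hHa : 8 * H ≤ a) {F : Finset ℕ}
    (hF : ∀ b ∈ F, b.Prime ∧ |(b : ℝ) - a| ≤ H) :
    (F.card : ℝ) ≤ 8 * (1 + 1 / (1 - δ)) * ((a : ℝ) ^ (1 - δ) * H ^ δ) / Real.log a := by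
  have ha8 : (8 : ℝ) ≤ a := by linarith
  have ha0 : (0 : ℝ) < a := by linarith
  have hl : 0 < Real.log a := Real.log_pos (by linarith)
  have hH0 : 0 < H := by linarith
  set M : ℕ := ⌈2 * H⌉₊ + 1 with hM
  set x : ℕ := ⌈(a : ℝ) - H⌉₊ - 1 with hx
  have hxc : 1 ≤ ⌈(a : ℝ) - H⌉₊ := Nat.one_le_ceil_iff.2 (by linarith)
  have hx1 : (x : ℝ) = ⌈(a : ℝ) - H⌉₊ - 1 := by
    rw [hx, Nat.cast_sub hxc, Nat.cast_one]
  have hc1 := Nat.le_ceil ((a : ℝ) - H)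
  have hc2 := Nat.ceil_lt_add_one (by linarith : 0 ≤ (a : ℝ) - H)
  have hd1 := Nat.le_ceil (2 * H)
  have hd2 := Nat.ceil_lt_add_one (by linarith : 0 ≤ 2 * H)
  have hMr : (M : ℝ) = ⌈2 * H⌉₊ + 1 := by rw [hM]; push_cast; ring
  have hM4 : (M : ℝ) ≤ 4 * H := by linarith
  have hM2 : 2 * H ≤ M := by linarith
  have hM0 : (0 : ℝ) < M := by linarith
  have hF' : ∀ b ∈ F, b.Prime ∧ x < b ∧ M < b ∧ b ≤ M + x := fun b hb => by
    obtain ⟨hp, hab⟩ := hF b hb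
    rw [abs_le] at hab
    refine ⟨hp, ?_, ?_, ?_⟩
    · have : (x : ℝ) < b := by linarith
      exact_mod_cast this
    · have : (M : ℝ) < b := by linarith
      exact_mod_cast this
    · have : (b : ℝ) ≤ ((M + x : ℕ) : ℝ) := by push_cast; linarith
      exact_mod_cast this
  have hprod : (3 * (a : ℝ) / 4) ^ F.card ≤ ∏ b ∈ F, (b : ℝ) := by
    rw [← Finset.prod_const]
    refine Finset.prod_le_prod (fun _ _ => by positivity) fun b hb => ?_
    have := (abs_le.1 (hF b hb).2).1
    linarith
  have hle : (3 * (a : ℝ) / 4) ^ F.card ≤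
      Real.exp (M * (1 + Real.log ((M + x : ℕ) / M))) := by
    refine hprod.trans (le_trans ?_ (choose_add_le (by omega)))
    rw [← Nat.cast_prod]
    exact_mod_cast prod_primes_le_choose hF'
  have hlog : F.card * Real.log (3 * a / 4) ≤ M * (1 + Real.log ((M + x : ℕ) / M)) := by
    have := Real.log_le_log (by positivity) hle
    rwa [Real.log_exp, Real.log_pow] at this
  have hl34 : Real.log a ≤ 2 * Real.log (3 * a / 4) := by
    have : Real.log a ≤ Real.log ((3 * a / 4) ^ 2) := Real.log_le_log ha0 (by nlinarith)
    rw [Real.log_pow] at this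
    exact_mod_cast this
  have hδ1 : 0 < 1 - δ := by linarith
  have ht1 : (1 : ℝ) ≤ a / H := by rw [le_div_iff₀ hH0]; linarith
  have hlt : Real.log ((M + x : ℕ) / M) ≤ Real.log (a / H) := by
    have hy0 : (0 : ℝ) < ((M + x : ℕ) : ℝ) := by push_cast; positivity
    refine Real.log_le_log (by positivity) ?_
    rw [div_le_div_iff₀ hM0 hH0]
    have : ((M + x : ℕ) : ℝ) ≤ 2 * a := by push_cast; linarith
    nlinarith
  have hpow : 1 + Real.log (a / H) ≤ (1 + 1 / (1 - δ)) * (a / H) ^ (1 - δ) := by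
    have h1 := Real.log_le_rpow_div (by positivity : 0 ≤ (a : ℝ) / H) hδ1
    have h2 := Real.one_le_rpow ht1 hδ1.le
    rw [add_mul, one_mul, div_mul_eq_mul_div, one_mul]
    linarith
  have hid : H * ((a : ℝ) / H) ^ (1 - δ) = a ^ (1 - δ) * H ^ δ := by
    rw [Real.div_rpow ha0.le hH0.le, mul_div_assoc', mul_comm H, mul_div_assoc]
    congr 1
    nth_rewrite 1 [← Real.rpow_one H]
    rw [← Real.rpow_sub hH0]
    congr 1
    ring
  have hnn : 0 ≤ 1 + Real.log (a / H) := by linarith [Real.log_nonneg ht1]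
  rw [le_div_iff₀ hl]
  calc F.card * Real.log a ≤ 2 * (F.card * Real.log (3 * a / 4)) := by
        have : (0 : ℝ) ≤ F.card := by positivity
        nlinarith
    _ ≤ 2 * (M * (1 + Real.log (a / H))) := by
        have : (M : ℝ) * (1 + Real.log ((M + x : ℕ) / M)) ≤ M * (1 + Real.log (a / H)) := by
          gcongr
        linarith
    _ ≤ 2 * (4 * H * ((1 + 1 / (1 - δ)) * (a / H) ^ (1 - δ))) := by gcongr
    _ = 8 * (1 + 1 / (1 - δ)) * (H * ((a : ℝ) / H) ^ (1 - δ)) := by ring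
    _ = _ := by rw [hid]

lemma exists_card_primes_near_le {δ : ℝ} (hδ0 : 0 < δ) (hδ : δ < 1) :
    ∃ C : ℝ, 0 < C ∧ ∀ (a : ℕ) (H : ℝ) (F : Finset ℕ), 2 ≤ a → 1 ≤ H →
      (∀ b ∈ F, b.Prime ∧ |(b : ℝ) - a| ≤ H ∧ b ≤ 8 * a) →
        (F.card : ℝ) ≤ C * ((a : ℝ) ^ (1 - δ) * H ^ δ) / Real.log a := by
  have hδ1 : 0 < 1 - δ := by linarith
  refine ⟨max (8 * (1 + 1 / (1 - δ))) 320, by positivity, fun a H F ha hH hF => ?_⟩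
  have hl := log_nat_pos ha
  have ha0 : (0 : ℝ) < a := by positivity
  have hH0 : 0 < H := by linarith
  by_cases hHa : 8 * H ≤ a
  · refine (card_primes_near_le hδ0 hδ hH hHa fun b hb => ⟨(hF b hb).1, (hF b hb).2.1⟩).trans ?_
    gcongr
    exact le_max_left _ _
  · refine (card_primes_le_eight_mul ha fun b hb => ⟨(hF b hb).1, (hF b hb).2.2⟩).trans ?_
    refine div_le_div_of_nonneg_right ?_ hl.le
    have h1 : (a : ℝ) / 8 ≤ a ^ (1 - δ) * H ^ δ := by
      calc (a : ℝ) / 8 ≤ a * (1 / 8 : ℝ) ^ δ := by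
            rw [div_eq_mul_one_div]
            gcongr
            nth_rewrite 1 [← Real.rpow_one (1 / 8 : ℝ)]
            exact Real.rpow_le_rpow_of_exponent_ge (by norm_num) (by norm_num) hδ.le
        _ = a ^ (1 - δ) * (a / 8 : ℝ) ^ δ := by
            rw [div_eq_mul_one_div (a : ℝ) 8, Real.mul_rpow ha0.le (by norm_num), ← mul_assoc,
              ← Real.rpow_add ha0]
            norm_num
        _ ≤ _ := by
            gcongr
            linarith
    have h2 : (320 : ℝ) ≤ max (8 * (1 + 1 / (1 - δ))) 320 := le_max_right _ _
    nlinarith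

/-! ### Prescribing the next digit -/

lemma measurableSet_digits_mem (n : ℕ) (V : Set (List ℕ)) : MeasurableSet {x | digits n x ∈ V} := by
  have : {x | digits n x ∈ V} = ⋃ ω ∈ V, {x | digits n x = ω} := by
    ext x
    simp
  rw [this]
  exact MeasurableSet.biUnion V.to_countable fun ω _ => measurableSet_digits_eq n ω

/-- The points of the prime Cantor set whose first digit lies in `J`. -/
def firstDigitIn (J : Set ℕ) : Set ℝ := primeCantor ∩ digit ⁻¹' J

/-- The points whose digit after the first `n` ones lies in a set depending on these. -/
def nextDigitIn (n : ℕ) (J : List ℕ → Set ℕ) : Set ℝ :=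
  {x | x ∈ primeCantor ∧ digit (shift^[n] x) ∈ J (digits n x)}

lemma firstDigitIn_subset (J : Set ℕ) : firstDigitIn J ⊆ primeCantor := inter_subset_left

lemma measurableSet_firstDigitIn (J : Set ℕ) : MeasurableSet (firstDigitIn J) :=
  measurableSet_primeCantor.inter (measurable_digit MeasurableSet.of_discrete)

lemma nextDigitIn_eq (n : ℕ) (J : List ℕ → Set ℕ) :
    nextDigitIn n J = primeCantor ∩
      {x | digits (n + 1) x ∈ {τ | ∃ ω a, τ = ω ++ [a] ∧ a ∈ J ω}} := by
  ext x
  simp only [nextDigitIn, mem_inter_iff, Set.mem_ofPred_eq, digits_succ']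
  refine and_congr_right fun _ => ⟨fun h => ⟨_, _, rfl, h⟩, ?_⟩
  rintro ⟨ω, a, h, ha⟩
  obtain ⟨rfl, h2⟩ := List.append_inj' h rfl
  rw [List.cons.injEq] at h2
  rwa [h2.1]

lemma measurableSet_nextDigitIn (n : ℕ) (J : List ℕ → Set ℕ) :
    MeasurableSet (nextDigitIn n J) := by
  rw [nextDigitIn_eq]
  exact measurableSet_primeCantor.inter (measurableSet_digits_mem _ _)

lemma nextDigitIn_inter {ω : List ℕ} (h : PrimeWord ω) (J : List ℕ → Set ℕ) :
    nextDigitIn ω.length J ∩ {x | digits ω.length x = ω} =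
      wordMap ω '' firstDigitIn (J ω) := by
  rw [image_wordMap_eq h (firstDigitIn_subset _)]
  ext x
  constructor
  · rintro ⟨⟨h1, h2⟩, h3⟩
    refine ⟨⟨h1, h3⟩, shift_iterate_mem h1 _, ?_⟩
    have h3' : digits ω.length x = ω := h3
    rw [h3'] at h2
    exact h2
  · rintro ⟨⟨h1, h3⟩, h4⟩
    refine ⟨⟨h1, ?_⟩, h3⟩
    have h3' : digits ω.length x = ω := h3
    rw [h3']
    exact h4.2

lemma measure_eq_tsum_digits (ν : Measure ℝ) (n : ℕ) {S : Set ℝ} (hS : MeasurableSet S) :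
    ν S = ∑' ω : List ℕ, ν (S ∩ {x | digits n x = ω}) := by
  rw [← measure_iUnion]
  · congr 1
    ext x
    simp
  · intro ω τ hne
    rw [Function.onFun, Set.disjoint_left]
    rintro x ⟨_, hx⟩ ⟨_, hx'⟩
    exact hne (Eq.trans (Eq.symm hx) hx')
  · exact fun ω => hS.inter (measurableSet_digits_eq n ω)

lemma firstDigitIn_inter_digits (J : Set ℕ) {p : ℕ} (hp : p.Prime) (hpJ : p ∈ J) :
    firstDigitIn J ∩ {x | digits 1 x = [p]} = wordMap [p] '' primeCantor := by
  rw [image_wordMap_primeCantor (primeWord_singleton hp)]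
  ext x
  constructor
  · exact fun h => ⟨h.1.1, h.2⟩
  · rintro ⟨h1, h2⟩
    refine ⟨⟨h1, ?_⟩, h2⟩
    have h2' : [digit x] = [p] := h2
    rw [List.cons.injEq] at h2'
    show digit x ∈ J
    rwa [h2'.1]

lemma measure_firstDigitIn (ν : Measure ℝ) (J : Set ℕ) :
    ν (firstDigitIn J) = ∑' p : primes, J.indicator 1 (p : ℕ) *
      ν (wordMap [(p : ℕ)] '' primeCantor) := by
  have h : firstDigitIn J = ⋃ p : primes, firstDigitIn J ∩ {x | digits 1 x = [(p : ℕ)]} := by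
    ext x
    simp only [mem_iUnion, mem_inter_iff]
    refine ⟨fun hx => ⟨⟨digit x, (digit_prime_and_shift_mem hx.1).1⟩, hx, rfl⟩, ?_⟩
    rintro ⟨_, hx, _⟩
    exact hx
  rw [h, measure_iUnion]
  · refine tsum_congr fun p => ?_
    by_cases hp : (p : ℕ) ∈ J
    · rw [firstDigitIn_inter_digits J p.2 hp, indicator_of_mem hp, Pi.one_apply, one_mul]
    · rw [indicator_of_notMem hp, zero_mul]
      convert measure_empty (μ := ν)
      rw [eq_empty_iff_forall_notMem]
      rintro x ⟨hx, hx'⟩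
      have h2' : [digit x] = [(p : ℕ)] := hx'
      rw [List.cons.injEq] at h2'
      exact hp (h2'.1 ▸ hx.2)
  · intro p q hne
    rw [Function.onFun, Set.disjoint_left]
    rintro x ⟨_, hx⟩ ⟨_, hx'⟩
    have := Eq.trans (Eq.symm hx) hx'
    rw [List.cons.injEq] at this
    exact hne (Subtype.ext this.1)
  · exact fun p => (measurableSet_firstDigitIn J).inter (measurableSet_digits_eq _ _)

lemma rho_singleton_rpow (δ : ℝ) (p : ℕ) : rho [p] ^ δ = (p : ℝ) ^ (-(2 * δ)) := by
  rw [rho_singleton, Real.inv_rpow (by positivity), ← Real.rpow_natCast,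
    ← Real.rpow_mul (by positivity), ← Real.rpow_neg (by positivity)]
  norm_num

section

variable {δ : ℝ} {ν : Measure ℝ} (hν : IsQuasiConformal δ ν)
include hν

lemma IsQuasiConformal.measure_primeCantor : ν primeCantor = ν univ := by
  have := measure_inter_primeCantor hν.compl_null univ
  rwa [univ_inter] at this

lemma IsQuasiConformal.firstDigitIn_le (J : Set ℕ) :
    ν (firstDigitIn J) ≤ primeMass δ J * ν univ := by
  rw [measure_firstDigitIn, primeMass_apply, ← ENNReal.tsum_mul_right]
  refine ENNReal.tsum_le_tsum fun p => ?_
  rw [mul_comm (ENNReal.ofReal _), mul_assoc]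
  gcongr
  rw [← rho_singleton_rpow, ← hν.measure_primeCantor]
  exact hν.image_le _ (primeWord_singleton p.2) _ subset_rfl measurableSet_primeCantor

lemma IsQuasiConformal.le_firstDigitIn (J : Set ℕ) :
    ENNReal.ofReal (1 / 4) * (primeMass δ J * ν univ) ≤ ν (firstDigitIn J) := by
  rw [measure_firstDigitIn, primeMass_apply, ← ENNReal.tsum_mul_right, ← ENNReal.tsum_mul_left]
  refine ENNReal.tsum_le_tsum fun p => ?_
  calc _ = J.indicator 1 (p : ℕ) * (ENNReal.ofReal (rho [(p : ℕ)] ^ δ / 4) * ν primeCantor) := by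
        rw [hν.measure_primeCantor, div_eq_mul_one_div (rho _ ^ δ), ENNReal.ofReal_mul' (by norm_num),
          rho_singleton_rpow]
        ring
    _ ≤ _ := by
        gcongr
        exact hν.le_image _ (primeWord_singleton p.2) _ subset_rfl measurableSet_primeCantor

lemma IsQuasiConformal.image_firstDigitIn_le {ω : List ℕ} (h : PrimeWord ω) (J : Set ℕ) :
    ν (wordMap ω '' firstDigitIn J) ≤
      ENNReal.ofReal (rho ω ^ δ) * (primeMass δ J * ν univ) :=
  (hν.image_le ω h _ (firstDigitIn_subset J) (measurableSet_firstDigitIn J)).trans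
    (by gcongr; exact hν.firstDigitIn_le J)

lemma IsQuasiConformal.le_image_firstDigitIn {ω : List ℕ} (h : PrimeWord ω) (J : Set ℕ) :
    ENNReal.ofReal (rho ω ^ δ / 16) * (primeMass δ J * ν univ) ≤
      ν (wordMap ω '' firstDigitIn J) := by
  refine le_trans ?_ (hν.le_image ω h _ (firstDigitIn_subset J) (measurableSet_firstDigitIn J))
  refine le_trans (le_of_eq ?_) (mul_le_mul_right (hν.le_firstDigitIn J) _)
  rw [show rho ω ^ δ / 16 = rho ω ^ δ / 4 * (1 / 4) by ring, ENNReal.ofReal_mul' (by norm_num),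
    mul_assoc]

lemma IsQuasiConformal.nextDigitIn_le {n : ℕ} {J : List ℕ → Set ℕ} {s : ℝ≥0∞}
    (h : ∀ ω, PrimeWord ω → ω.length = n → primeMass δ (J ω) ≤ s) :
    ν (nextDigitIn n J) ≤ 4 * (s * ν univ) := by
  rw [measure_eq_tsum_digits ν n (measurableSet_nextDigitIn n J), ← hν.measure_primeCantor,
    measure_eq_tsum_digits ν n measurableSet_primeCantor, ← ENNReal.tsum_mul_left,
    ← ENNReal.tsum_mul_left]
  refine ENNReal.tsum_le_tsum fun ω => ?_
  by_cases hω : PrimeWord ω ∧ ω.length = n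
  · obtain ⟨hω, rfl⟩ := hω
    rw [nextDigitIn_inter hω, ← image_wordMap_primeCantor hω]
    refine (hν.image_firstDigitIn_le hω _).trans ?_
    have hle := hν.le_image ω hω _ subset_rfl measurableSet_primeCantor
    rw [hν.measure_primeCantor] at hle
    calc _ ≤ ENNReal.ofReal (rho ω ^ δ) * (s * ν univ) := by
          gcongr
          exact h ω hω rfl
      _ = 4 * (s * (ENNReal.ofReal (rho ω ^ δ / 4) * ν univ)) := by
          have h4 : ENNReal.ofReal (rho ω ^ δ) = 4 * ENNReal.ofReal (rho ω ^ δ / 4) := by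
            rw [show (4 : ℝ≥0∞) = ENNReal.ofReal 4 by norm_num, ← ENNReal.ofReal_mul (by norm_num)]
            congr 1
            ring
          rw [h4]
          ring
      _ ≤ _ := by gcongr
  · have : nextDigitIn n J ∩ {x | digits n x = ω} = ∅ := by
      rw [eq_empty_iff_forall_notMem]
      rintro x ⟨hx, hx'⟩
      have hx'' : digits n x = ω := hx'
      exact hω ⟨hx'' ▸ digits_primeWord hx.1 n, hx'' ▸ digits_length n x⟩
    rw [this, measure_empty]
    exact bot_le

lemma IsQuasiConformal.le_nextDigitIn {n : ℕ} {J : List ℕ → Set ℕ} {s : ℝ≥0∞}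
    {W : Set (List ℕ)} (h : ∀ ω ∈ W, s ≤ primeMass δ (J ω)) :
    ENNReal.ofReal (1 / 16) * (s * ν (primeCantor ∩ {x | digits n x ∈ W})) ≤
      ν (nextDigitIn n J ∩ {x | digits n x ∈ W}) := by
  rw [measure_eq_tsum_digits ν n ((measurableSet_nextDigitIn n J).inter
      (measurableSet_digits_mem n W)),
    measure_eq_tsum_digits ν n (measurableSet_primeCantor.inter
      (measurableSet_digits_mem n W)), ← ENNReal.tsum_mul_left, ← ENNReal.tsum_mul_left]
  refine ENNReal.tsum_le_tsum fun ω => ?_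
  by_cases hω : (PrimeWord ω ∧ ω.length = n) ∧ ω ∈ W
  · obtain ⟨⟨hω, rfl⟩, hW⟩ := hω
    have e : ∀ S : Set ℝ, S ∩ {x | digits ω.length x ∈ W} ∩ {x | digits ω.length x = ω} =
        S ∩ {x | digits ω.length x = ω} := fun S => by
      rw [inter_assoc]
      congr 1
      refine inter_eq_right.2 fun x hx => ?_
      have hx' : digits ω.length x = ω := hx
      show digits ω.length x ∈ W
      rwa [hx']
    rw [e, e, nextDigitIn_inter hω, ← image_wordMap_primeCantor hω]
    refine le_trans ?_ (hν.le_image_firstDigitIn hω _)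
    have hle := hν.image_le ω hω _ subset_rfl measurableSet_primeCantor
    rw [hν.measure_primeCantor] at hle
    calc _ ≤ ENNReal.ofReal (1 / 16) * (primeMass δ (J ω) *
          (ENNReal.ofReal (rho ω ^ δ) * ν univ)) := by
          gcongr
          exact h ω hW
      _ = _ := by
          rw [div_eq_mul_one_div (rho _ ^ δ), ENNReal.ofReal_mul' (by norm_num)]
          ring
  · have : primeCantor ∩ {x | digits n x ∈ W} ∩ {x | digits n x = ω} = ∅ := by
      rw [eq_empty_iff_forall_notMem]
      rintro x ⟨⟨hx, hW⟩, hx'⟩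
      have hx'' : digits n x = ω := hx'
      exact hω ⟨⟨hx'' ▸ digits_primeWord hx n, hx'' ▸ digits_length n x⟩, hx'' ▸ hW⟩
    rw [this, measure_empty, mul_zero, mul_zero]
    exact bot_le

end

/-! ### The divergence part of the Borel–Cantelli argument -/

lemma ENNReal.tsum_le_mul_tsum_of_antitone {f : ℕ → ℝ≥0∞} (hf : Antitone f) {k : ℕ} (hk : k ≠ 0) :
    ∑' n, f n ≤ k * ∑' n, f (k * n) := by
  have : NeZero k := ⟨hk⟩
  calc ∑' n, f n = ∑' p : ℕ × Fin k, f ((Nat.divModEquiv k).symm p) :=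
        ((Nat.divModEquiv k).symm.tsum_eq f).symm
    _ ≤ ∑' p : ℕ × Fin k, f (k * p.1) := by
        refine ENNReal.tsum_le_tsum fun p => hf ?_
        rw [Nat.divModEquiv_symm_apply, mul_comm]
        omega
    _ = ∑' n, ∑' _ : Fin k, f (k * n) := ENNReal.tsum_prod' (f := fun p : ℕ × Fin k => f (k * p.1))
    _ = k * ∑' n, f (k * n) := by
        rw [← ENNReal.tsum_mul_left]
        refine tsum_congr fun n => ?_
        rw [tsum_fintype, Finset.sum_const, Finset.card_univ, Fintype.card_fin, nsmul_eq_mul]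

lemma digits_eq_of_le {x y : ℝ} {m n : ℕ} (hmn : m ≤ n) (h : digits n x = digits n y) :
    digits m x = digits m y := by
  induction n, hmn using Nat.le_induction with
  | base => exact h
  | succ n hmn ih =>
    rw [digits_succ', digits_succ'] at h
    exact ih (List.append_inj h (by rw [digits_length, digits_length])).1

lemma mem_nextDigitIn_congr {x y : ℝ} (hx : x ∈ primeCantor) (hy : y ∈ primeCantor) {m n : ℕ}
    (hmn : m < n) (h : digits n x = digits n y) (J : List ℕ → Set ℕ) :
    x ∈ nextDigitIn m J ↔ y ∈ nextDigitIn m J := by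
  have h' := digits_eq_of_le hmn h
  simp only [nextDigitIn_eq, mem_inter_iff, Set.mem_ofPred_eq, h', hx, hy]

lemma digits_eq_wordOf {x : ℝ} (hx : x ∈ primeCantor) (n : ℕ) :
    ∃ ω : Fin n → primes, digits n x = wordOf ω :=
  ⟨fun i => ⟨digit (shift^[i] x), (digit_prime_and_shift_mem (shift_iterate_mem hx i)).1⟩,
    digits_eq_ofFn n x⟩

section

variable {δ : ℝ} (hδ : 1 / 2 < δ) {ν : Measure ℝ} (hν : IsQuasiConformal δ ν)
include hδ hν

lemma IsQuasiConformal.exists_measure_rho_lt_le : ∃ k : ℕ, k ≠ 0 ∧ ∀ n : ℕ, 1 ≤ n →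
    ν (primeCantor ∩ {x | rho (digits n x) < (1 / 4) ^ (k * n)}) ≤
      ENNReal.ofReal (1 / 4) * ν univ := by
  set η : ℝ := (δ - 1 / 2) / 2 with hη
  have hη0 : 0 < η := by rw [hη]; linarith
  have hs : 1 / 2 < δ - η := by rw [hη]; linarith
  have hZfin := partitionFn_one_ne_top hs
  set Z : ℝ := (partitionFn (δ - η) 1 0).toReal with hZ
  have hZ0 : 0 ≤ Z := ENNReal.toReal_nonneg
  set q : ℝ := (1 / 4) ^ η with hq
  have hq0 : 0 < q := by positivity
  have hq1 : q < 1 := Real.rpow_lt_one (by norm_num) (by norm_num) hη0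
  obtain ⟨k, hk⟩ := exists_pow_lt_of_lt_one (by positivity : 0 < 1 / (4 * (Z + 1))) hq1
  refine ⟨k, ?_, fun n hn => ?_⟩
  · rintro rfl
    rw [pow_zero, lt_div_iff₀ (by positivity)] at hk
    linarith
  have hkZ : q ^ k * Z ≤ 1 / 4 := by
    rw [lt_div_iff₀ (by positivity)] at hk
    nlinarith [pow_pos hq0 k]
  have hsub : primeCantor ∩ {x | rho (digits n x) < (1 / 4) ^ (k * n)} ⊆
      ⋃ ω : Fin n → primes, {x | x ∈ wordMap (wordOf ω) '' primeCantor ∧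
        rho (wordOf ω) < (1 / 4) ^ (k * n)} := by
    rintro x ⟨hx, hx'⟩
    obtain ⟨ω, hω⟩ := digits_eq_wordOf hx n
    refine mem_iUnion.2 ⟨ω, ?_, ?_⟩
    · refine ⟨shift^[n] x, shift_iterate_mem hx n, ?_⟩
      rw [← hω, wordMap_digits]
    · rw [← hω]
      exact hx'
  refine (measure_mono hsub).trans ((measure_iUnion_le _).trans ?_)
  have hterm : ∀ ω : Fin n → primes,
      ν {x | x ∈ wordMap (wordOf ω) '' primeCantor ∧ rho (wordOf ω) < (1 / 4) ^ (k * n)} ≤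
        ENNReal.ofReal ((q ^ k) ^ n) * ν univ *
          ENNReal.ofReal (derivAbs (wordOf ω) 0 ^ (δ - η)) := fun ω => by
    by_cases h : rho (wordOf ω) < (1 / 4) ^ (k * n)
    · have hpos := rho_pos (primeWord_wordOf ω).posWord
      refine (measure_mono fun x hx => hx.1).trans ((hν.image_le _ (primeWord_wordOf ω) _
        subset_rfl measurableSet_primeCantor).trans ?_)
      rw [hν.measure_primeCantor, mul_right_comm, ← ENNReal.ofReal_mul (by positivity)]
      gcongr
      change rho (wordOf ω) ^ δ ≤ _ * rho (wordOf ω) ^ (δ - η)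
      rw [Real.rpow_sub hpos, mul_div_assoc', le_div_iff₀ (by positivity), mul_comm]
      gcongr
      rw [← pow_mul, hq, ← Real.rpow_mul_natCast (by norm_num), mul_comm η,
        Real.rpow_mul (by norm_num), Real.rpow_natCast]
      exact Real.rpow_le_rpow hpos.le h.le hη0.le
    · simp only [h, and_false]
      rw [show {x : ℝ | False} = ∅ from rfl, measure_empty]
      exact bot_le
  refine (ENNReal.tsum_le_tsum hterm).trans ?_
  rw [ENNReal.tsum_mul_left]
  change _ * partitionFn (δ - η) n 0 ≤ _
  calc _ ≤ ENNReal.ofReal ((q ^ k) ^ n) * ν univ * partitionFn (δ - η) 1 0 ^ n := by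
        gcongr
        exact partitionFn_le_pow (by linarith) n
    _ = ENNReal.ofReal ((q ^ k * Z) ^ n) * ν univ := by
        rw [← ENNReal.ofReal_toReal hZfin, ← hZ, ← ENNReal.ofReal_pow hZ0, mul_right_comm,
          ← ENNReal.ofReal_mul (by positivity), mul_pow]
    _ ≤ _ := by
        gcongr
        calc (q ^ k * Z) ^ n ≤ (1 / 4) ^ n := by gcongr
          _ ≤ 1 / 4 := pow_le_of_le_one (by norm_num) (by norm_num) (by omega)

lemma IsQuasiConformal.le_measure_iUnion_nextDigitIn {J : ℝ → Set ℕ}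
    (hJ : ∀ r r', 0 < r → r ≤ r' → J r ⊆ J r')
    (hdiv : ∑' n : ℕ, primeMass δ (J ((1 / 4) ^ n)) = ⊤) {n₀ : ℕ} (hn₀ : 1 ≤ n₀) :
    ENNReal.ofReal (1 / 4) * ν univ ≤ ν (⋃ j, nextDigitIn (n₀ + j) fun ω => J (rho ω)) := by
  obtain ⟨k, hk0, hk⟩ := hν.exists_measure_rho_lt_le hδ
  set A : ℕ → Set ℝ := fun j => nextDigitIn (n₀ + j) fun ω => J (rho ω) with hA
  by_contra! hlt
  set W : ℕ → Set (List ℕ) := fun j => {ω | (1 / 4) ^ (k * (n₀ + j)) ≤ rho ω ∧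
    ∃ y ∈ primeCantor, digits (n₀ + j) y = ω ∧ ∀ i < j, y ∉ A i} with hW
  have hsum : ∑' j, ν (A j ∩ {x | digits (n₀ + j) x ∈ W j}) ≤ ν (⋃ j, A j) := by
    rw [← measure_iUnion]
    · exact measure_mono (iUnion_mono fun j => inter_subset_left)
    · have key : ∀ i j, i < j → Disjoint (A i ∩ {x | digits (n₀ + i) x ∈ W i})
          (A j ∩ {x | digits (n₀ + j) x ∈ W j}) := fun i j hij => by
        rw [Set.disjoint_left]
        rintro x ⟨hx, _⟩ ⟨_, -, y, hy, hxy, hyA⟩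
        exact hyA i hij ((mem_nextDigitIn_congr hx.1 hy (by omega) hxy.symm _).1 hx)
      intro i j hne
      rcases lt_or_gt_of_ne hne with h | h
      · exact key i j h
      · exact (key j i h).symm
    · exact fun j => (measurableSet_nextDigitIn _ _).inter (measurableSet_digits_mem _ _)
  have hmass : ∀ j, ENNReal.ofReal (1 / 2) * ν univ ≤
      ν (primeCantor ∩ {x | digits (n₀ + j) x ∈ W j}) := fun j => by
    have hcov : primeCantor ⊆ (primeCantor ∩ {x | digits (n₀ + j) x ∈ W j}) ∪
        ((⋃ j, A j) ∪ (primeCantor ∩ {x | rho (digits (n₀ + j) x) <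
          (1 / 4) ^ (k * (n₀ + j))})) := by
      intro x hx
      by_cases h1 : x ∈ ⋃ j, A j
      · exact Or.inr (Or.inl h1)
      by_cases h2 : rho (digits (n₀ + j) x) < (1 / 4) ^ (k * (n₀ + j))
      · exact Or.inr (Or.inr ⟨hx, h2⟩)
      refine Or.inl ⟨hx, not_lt.1 h2, x, hx, rfl, fun i _ hi => h1 (mem_iUnion.2 ⟨i, hi⟩)⟩
    have hle := (measure_mono hcov).trans ((measure_union_le _ _).trans
      (add_le_add_right ((measure_union_le _ _).trans (add_le_add hlt.le
        (hk (n₀ + j) (by omega)))) _))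
    rw [hν.measure_primeCantor] at hle
    have hfin := hν.finite
    have e : ENNReal.ofReal (1 / 4) * ν univ + ENNReal.ofReal (1 / 4) * ν univ =
        ENNReal.ofReal (1 / 2) * ν univ := by
      rw [← add_mul, ← ENNReal.ofReal_add (by norm_num) (by norm_num)]
      norm_num
    have e' : ENNReal.ofReal (1 / 2) * ν univ + ENNReal.ofReal (1 / 2) * ν univ = ν univ := by
      rw [← add_mul, ← ENNReal.ofReal_add (by norm_num) (by norm_num)]
      norm_num
    rw [e] at hle
    nth_rewrite 1 [← e'] at hle
    exact (ENNReal.add_le_add_iff_right (ENNReal.mul_ne_top ENNReal.ofReal_ne_top hfin)).1 hle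
  have hm0 : ν univ ≠ 0 := fun h => by
    rw [h, mul_zero] at hlt
    exact absurd hlt (by simp)
  set f : ℕ → ℝ≥0∞ := fun n => primeMass δ (J ((1 / 4) ^ n)) with hf
  have hfanti : Antitone f := fun m n hmn => measure_mono (hJ _ _ (by positivity)
    (pow_le_pow_of_le_one (by norm_num) (by norm_num) hmn))
  have hdiv' : ∑' n, f (k * n) = ⊤ := by
    by_contra h
    have := ENNReal.tsum_le_mul_tsum_of_antitone hfanti hk0
    rw [hdiv, top_le_iff] at this
    exact ENNReal.mul_ne_top (ENNReal.natCast_ne_top k) h this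
  have hdiv'' : ∑' j, f (k * (j + n₀)) = ⊤ := by
    by_contra h
    have h2 := (ENNReal.summable (f := fun j => f (k * (j + n₀)))).sum_add_tsum_nat_add'
      (f := fun n => f (k * n))
    rw [hdiv'] at h2
    exact ENNReal.add_ne_top.2 ⟨ENNReal.sum_ne_top.2 fun i _ => primeMass_ne_top hδ _, h⟩ h2
  have hbig : ∑' j, ν (A j ∩ {x | digits (n₀ + j) x ∈ W j}) = ⊤ := by
    rw [← top_le_iff]
    calc ⊤ = ∑' j, ENNReal.ofReal (1 / 16) * (f (k * (j + n₀)) *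
          (ENNReal.ofReal (1 / 2) * ν univ)) := by
          rw [ENNReal.tsum_mul_left, ENNReal.tsum_mul_right, hdiv'', ENNReal.top_mul,
            ENNReal.mul_top]
          · simp
          · exact mul_ne_zero (by simp) hm0
      _ ≤ _ := by
          refine ENNReal.tsum_le_tsum fun j => ?_
          refine le_trans ?_ (hν.le_nextDigitIn (s := f (k * (j + n₀))) fun ω hω => ?_)
          · gcongr
            exact hmass j
          · rw [add_comm]
            exact measure_mono (hJ _ _ (by positivity) hω.1)
  rw [hbig, top_le_iff] at hsum
  rw [hsum] at hlt
  exact absurd hlt (by simp)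

lemma IsQuasiConformal.le_measure_limsup_nextDigitIn {J : ℝ → Set ℕ}
    (hJ : ∀ r r', 0 < r → r ≤ r' → J r ⊆ J r')
    (hdiv : ∑' n : ℕ, primeMass δ (J ((1 / 4) ^ n)) = ⊤) :
    ENNReal.ofReal (1 / 4) * ν univ ≤
      ν (⋂ m : ℕ, ⋃ j, nextDigitIn (m + 1 + j) fun ω => J (rho ω)) := by
  have hanti : Antitone fun m : ℕ => ⋃ j, nextDigitIn (m + 1 + j) fun ω => J (rho ω) := by
    intro m n hmn x hx
    obtain ⟨j, hj⟩ := mem_iUnion.1 hx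
    refine mem_iUnion.2 ⟨n - m + j, ?_⟩
    rwa [show m + 1 + (n - m + j) = n + 1 + j by omega]
  rw [hanti.measure_iInter
    (fun m => (MeasurableSet.iUnion fun j => measurableSet_nextDigitIn _ _).nullMeasurableSet)
    ⟨0, ne_top_of_le_ne_top hν.finite (measure_mono (subset_univ _))⟩]
  exact le_iInf fun m => hν.le_measure_iUnion_nextDigitIn hδ hJ hdiv (by omega)

end

/-! ### The divergent case -/

lemma primeCantor_bounds {x : ℝ} (hx : x ∈ primeCantor) :
    1 / ((digit x : ℝ) + 1) ≤ x ∧ x ≤ 1 / digit x := by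
  obtain ⟨hp, hs⟩ := digit_prime_and_shift_mem hx
  have hs' := primeCantor_subset hs
  have hp0 : (0 : ℝ) < digit x := by exact_mod_cast hp.pos
  have hx' : x = 1 / (digit x + shift x) := (gaussMap_digit_shift x).symm
  constructor
  · conv_rhs => rw [hx']
    have := hs'.1
    gcongr
    linarith [hs'.2]
  · conv_lhs => rw [hx']
    gcongr
    linarith [hs'.1]

/-- The digits at scale `ρ` that produce intervals of density at least `α` with respect to `ψ`. -/
def heavyDigits (ψ : ℝ → ℝ) (δ α ρ : ℝ) : Set ℕ :=
  {a | ∃ N : ℕ, 2 ≤ N ∧ N ≤ a ∧ α * ψ (ρ / N) ≤ ρ ^ δ * primeTail δ N}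

lemma heavyDigits_mono {ψ : ℝ → ℝ} {δ α : ℝ} (hα : 0 ≤ α)
    (hanti : AntitoneOn (fun r : ℝ => r ^ (-δ) * ψ r) (Ioi 0)) {ρ ρ' : ℝ} (hρ : 0 < ρ)
    (hρ' : ρ ≤ ρ') : heavyDigits ψ δ α ρ ⊆ heavyDigits ψ δ α ρ' := by
  rintro a ⟨N, hN, hNa, h⟩
  refine ⟨N, hN, hNa, ?_⟩
  have hN0 : (0 : ℝ) < N := by positivity
  have hρ0' : 0 < ρ' := hρ.trans_le hρ'
  have key : ∀ r : ℝ, 0 < r → ψ (r / N) = r ^ δ * (N : ℝ) ^ (-δ) *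
      ((r / N) ^ (-δ) * ψ (r / N)) := fun r hr => by
    rw [Real.rpow_neg (by positivity), Real.rpow_neg (by positivity),
      Real.div_rpow hr.le hN0.le]
    have := Real.rpow_pos_of_pos hr δ
    have := Real.rpow_pos_of_pos hN0 δ
    field_simp
  have hle := hanti (mem_Ioi.2 (by positivity : 0 < ρ / N)) (mem_Ioi.2 (by positivity : 0 < ρ' / N))
    (by gcongr : ρ / N ≤ ρ' / N)
  simp only at hle
  have hp := Real.rpow_pos_of_pos hρ δ
  have hp' := Real.rpow_pos_of_pos hρ0' δ
  rw [key ρ hρ] at h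
  rw [key ρ' hρ0']
  have h1 : α * ((N : ℝ) ^ (-δ) * ((ρ / N) ^ (-δ) * ψ (ρ / N))) ≤ primeTail δ N := by
    have : ρ ^ δ * (α * ((N : ℝ) ^ (-δ) * ((ρ / N) ^ (-δ) * ψ (ρ / N)))) ≤
        ρ ^ δ * primeTail δ N := by linarith
    exact le_of_mul_le_mul_left this hp
  calc α * (ρ' ^ δ * (N : ℝ) ^ (-δ) * ((ρ' / N) ^ (-δ) * ψ (ρ' / N)))
      = ρ' ^ δ * (α * ((N : ℝ) ^ (-δ) * ((ρ' / N) ^ (-δ) * ψ (ρ' / N)))) := by ring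
    _ ≤ ρ' ^ δ * (α * ((N : ℝ) ^ (-δ) * ((ρ / N) ^ (-δ) * ψ (ρ / N)))) := by gcongr
    _ ≤ _ := by gcongr

lemma image_firstDigitIn_Ici_subset {x : ℝ} (hx : x ∈ primeCantor) {n N : ℕ} (hN : 1 ≤ N)
    (h : N ≤ digit (shift^[n] x)) :
    wordMap (digits n x) '' firstDigitIn (Ici N) ⊆ closedBall x (rho (digits n x) / N) := by
  rintro _ ⟨y, ⟨hy, hyN⟩, rfl⟩
  have hω := (digits_primeWord hx n).posWord
  have hz := shift_iterate_mem hx n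
  have hy1 := primeCantor_subset hy
  have hz1 := primeCantor_subset hz
  have hN0 : (0 : ℝ) < N := by exact_mod_cast hN
  rw [mem_closedBall, Real.dist_eq]
  nth_rewrite 2 [← wordMap_digits n x]
  refine (dist_wordMap_le hω hy1.1.le hz1.1.le).trans ?_
  rw [div_eq_mul_one_div]
  have hρ := rho_pos hω
  gcongr
  have b1 : y ≤ 1 / N := (primeCantor_bounds hy).2.trans (by
    have : (N : ℝ) ≤ digit y := by exact_mod_cast hyN
    gcongr)
  have b2 : shift^[n] x ≤ 1 / N := (primeCantor_bounds hz).2.trans (by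
    have : (N : ℝ) ≤ digit (shift^[n] x) := by exact_mod_cast h
    gcongr)
  rw [abs_le]
  constructor <;> linarith [hy1.1, hz1.1]

lemma exists_measure_lt_top_of_divergent {δ : ℝ} (hδ : 1 / 2 < δ) {ψ : ℝ → ℝ}
    {C : ℝ} (hC : 0 < C)
    (hC10 : ∀ r, 0 < r → ψ (10 * r) ≤ C * ψ r)
    (hν : IsQuasiConformal δ ((hausdorffPsi ψ).restrict primeCantor))
    (h0 : hausdorffPsi ψ primeCantor ≠ 0) :
    ∃ α : ℝ, 0 < α ∧ ∀ J : ℝ → Set ℕ, (∀ r r', 0 < r → r ≤ r' → J r ⊆ J r') →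
      (∀ r, 0 < r → r ≤ 1 → J r ⊆ heavyDigits ψ δ α r) →
      ∑' n : ℕ, primeMass δ (J ((1 / 4) ^ n)) ≠ ⊤ := by
  obtain ⟨c, hc, hcN⟩ := exists_le_primeMass hδ
  set ν := (hausdorffPsi ψ).restrict primeCantor with hνdef
  have hu : ν univ = hausdorffPsi ψ primeCantor := by
    rw [hνdef, Measure.restrict_apply_univ]
  set m : ℝ := (ν univ).toReal with hm
  have hmu : ν univ = ENNReal.ofReal m := (ENNReal.ofReal_toReal hν.finite).symm
  have hm0 : 0 < m := ENNReal.toReal_pos (by rwa [hu]) hν.finite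
  set α : ℝ := 128 * C / (c * m) with hα
  have hα0 : 0 < α := by positivity
  refine ⟨α, hα0, fun J hJ hJα hdiv => ?_⟩
  set L : Set ℝ := ⋂ m : ℕ, ⋃ j, nextDigitIn (m + 1 + j) fun ω => J (rho ω) with hL
  have hLΛ : L ⊆ primeCantor := fun x hx => by
    obtain ⟨j, hj⟩ := mem_iUnion.1 (mem_iInter.1 hx 0)
    exact hj.1
  have hlow := hν.le_measure_limsup_nextDigitIn hδ hJ hdiv
  have hK : 0 < c * m / 16 * α := by positivity
  have hup : hausdorffPsi ψ L ≤ ENNReal.ofReal (C / (c * m / 16 * α)) * ν univ := by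
    refine hausdorffPsi_le_of_density hK hC hC10 fun x hx ε hε => ?_
    obtain ⟨k, hk⟩ := exists_pow_lt_of_lt_one hε (by norm_num : (1 / 4 : ℝ) < 1)
    obtain ⟨j, hxΛ, hj⟩ := mem_iUnion.1 (mem_iInter.1 hx k)
    set n := k + 1 + j with hn
    have hω := digits_primeWord hxΛ n
    have hρ := rho_pos hω.posWord
    have hρ1 := rho_le_one hω.posWord
    obtain ⟨N, hN, hNa, hαN⟩ := hJα _ hρ hρ1 hj
    have hN1 : (1 : ℝ) ≤ N := by exact_mod_cast (by omega : 1 ≤ N)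
    set ρ := rho (digits n x) with hρdef
    have hle : ρ ≤ (1 / 4) ^ k := by
      refine (rho_le_pow hω).trans ?_
      rw [digits_length]
      exact pow_le_pow_of_le_one (by norm_num) (by norm_num) (by omega)
    refine ⟨ρ / N, by positivity, ?_, ?_⟩
    · calc ρ / N ≤ ρ := div_le_self hρ.le hN1
        _ < ε := hle.trans_lt hk
    · refine le_trans ?_ (measure_mono (image_firstDigitIn_Ici_subset hxΛ (by omega) hNa))
      refine le_trans ?_ (hν.le_image_firstDigitIn hω _)
      calc ENNReal.ofReal (c * m / 16 * α * ψ (ρ / N))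
          ≤ ENNReal.ofReal (c * m / 16 * (ρ ^ δ * primeTail δ N)) := by
            rw [mul_assoc]
            gcongr
        _ = ENNReal.ofReal (ρ ^ δ / 16) * (ENNReal.ofReal (c * primeTail δ N) *
              ENNReal.ofReal m) := by
            have := primeTail_pos δ hN
            rw [← ENNReal.ofReal_mul (by positivity), ← ENNReal.ofReal_mul (by positivity)]
            congr 1
            ring
        _ ≤ _ := by
            rw [hmu]
            gcongr
            exact hcN N hN
  have hνL : ν L ≤ hausdorffPsi ψ L := Measure.restrict_apply_le _ _
  have hfin := (hlow.trans hνL).trans hup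
  rw [hmu, ← ENNReal.ofReal_mul (by positivity), ← ENNReal.ofReal_mul (by positivity),
    ENNReal.ofReal_le_ofReal_iff (by positivity)] at hfin
  have hval : C / (c * m / 16 * α) = 1 / 8 := by
    rw [hα]
    field_simp
    norm_num
  rw [hval] at hfin
  linarith

/-! ### Independence of the threshold -/

lemma primeTail_four_pow_mul (δ : ℝ) (j : ℕ) {N : ℕ} (hN : 2 ≤ N) :
    ((4 : ℝ) ^ j) ^ (1 - 2 * δ) / (1 + 2 * j) * primeTail δ N ≤ primeTail δ (4 ^ j * N) := by
  have hN0 : (0 : ℝ) < N := by positivity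
  have hl := log_nat_pos hN
  have hl2 : Real.log 2 ≤ Real.log N := Real.log_le_log (by norm_num) (by exact_mod_cast hN)
  have hl4 : Real.log 4 = 2 * Real.log 2 := by
    rw [show (4 : ℝ) = 2 ^ 2 by norm_num, Real.log_pow]
    norm_num
  rw [primeTail, primeTail]
  push_cast
  rw [Real.mul_rpow (by positivity) hN0.le, Real.log_mul (by positivity) hN0.ne', Real.log_pow,
    div_mul_div_comm]
  have h2 : 0 < Real.log 2 := Real.log_pos (by norm_num)
  have hj : (0 : ℝ) ≤ j := Nat.cast_nonneg j
  gcongr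
  rw [hl4]
  nlinarith

lemma exists_four_pow_rpow_ge {e : ℝ} (he : 0 < e) (K : ℝ) :
    ∃ j : ℕ, K * (1 + 2 * j) ≤ ((4 : ℝ) ^ j) ^ e := by
  have hq : 1 < (4 : ℝ) ^ e := Real.one_lt_rpow (by norm_num) he
  have h1 := tendsto_pow_const_div_const_pow_of_one_lt 1 hq
  have h0 := tendsto_pow_const_div_const_pow_of_one_lt 0 hq
  have h := (h0.add (h1.const_mul 2)).const_mul K
  simp only [mul_zero, add_zero, pow_zero, pow_one] at h
  obtain ⟨j, hj⟩ := (h.eventually (gt_mem_nhds one_pos)).exists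
  refine ⟨j, ?_⟩
  have hp : 0 < ((4 : ℝ) ^ e) ^ j := by positivity
  rw [← Real.rpow_natCast_mul (by norm_num), mul_comm (j : ℝ), Real.rpow_mul_natCast (by norm_num)]
  rw [mul_div_assoc', ← add_div, mul_div_assoc', div_lt_one hp] at hj
  exact hj.le

lemma heavyDigits_eq_Ici {ψ : ℝ → ℝ} {δ α ρ : ℝ} (h : (heavyDigits ψ δ α ρ).Nonempty) :
    ∃ N : ℕ, 2 ≤ N ∧ α * ψ (ρ / N) ≤ ρ ^ δ * primeTail δ N ∧ heavyDigits ψ δ α ρ = Ici N := by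
  classical
  obtain ⟨a, N₁, h1, -, h2⟩ := h
  have hex : ∃ N : ℕ, 2 ≤ N ∧ α * ψ (ρ / N) ≤ ρ ^ δ * primeTail δ N := ⟨N₁, h1, h2⟩
  refine ⟨Nat.find hex, (Nat.find_spec hex).1, (Nat.find_spec hex).2, ?_⟩
  ext b
  constructor
  · rintro ⟨N, hN, hNb, h⟩
    exact (Nat.find_min' hex ⟨hN, h⟩).trans hNb
  · exact fun hb => ⟨_, (Nat.find_spec hex).1, hb, (Nat.find_spec hex).2⟩

lemma exists_primeMass_heavyDigits_le {δ : ℝ} (hδ : 1 / 2 < δ) (hδ₁ : δ < 1) (ψ : ℝ → ℝ)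
    (hpos : ∀ r, 0 < r → 0 < ψ r) {α β : ℝ} (hα : 0 < α) (hβ : 0 < β) :
    ∃ (j : ℕ) (K : ℝ), 0 < K ∧ ∀ ρ : ℝ, 0 < ρ →
      primeMass δ (heavyDigits ψ δ β ρ) ≤
        ENNReal.ofReal K * primeMass δ (heavyDigits ψ δ α (4 ^ j * ρ)) := by
  obtain ⟨c, hc, hcN⟩ := exists_le_primeMass hδ
  obtain ⟨C, hC, hCN⟩ := exists_primeMass_le hδ
  obtain ⟨j, hj⟩ := exists_four_pow_rpow_ge (by linarith : 0 < 1 - δ) (α / β)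
  set D : ℝ := ((4 : ℝ) ^ j) ^ (1 - 2 * δ) / (1 + 2 * j) with hD
  have hD0 : 0 < D := by positivity
  refine ⟨j, C / (c * D), by positivity, fun ρ hρ => ?_⟩
  rcases (heavyDigits ψ δ β ρ).eq_empty_or_nonempty with h | h
  · rw [h, measure_empty]
    exact bot_le
  obtain ⟨N, hN, hNβ, hJ⟩ := heavyDigits_eq_Ici h
  have hN0 : (0 : ℝ) < N := by positivity
  have hN' : 2 ≤ 4 ^ j * N := hN.trans (Nat.le_mul_of_pos_left N (by positivity))
  have hT := primeTail_pos δ hN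
  have hT' := primeTail_four_pow_mul δ j hN
  rw [← hD] at hT'
  have hsub : Ici (4 ^ j * N) ⊆ heavyDigits ψ δ α (4 ^ j * ρ) := by
    intro b hb
    refine ⟨4 ^ j * N, hN', hb, ?_⟩
    have e : (4 : ℝ) ^ j * ρ / ((4 ^ j * N : ℕ) : ℝ) = ρ / N := by
      push_cast
      rw [mul_div_mul_left _ _ (by positivity)]
    have hψ := hpos (ρ / N) (by positivity)
    have hp4 : ((4 : ℝ) ^ j) ^ δ * ((4 : ℝ) ^ j) ^ (1 - 2 * δ) = ((4 : ℝ) ^ j) ^ (1 - δ) := by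
      rw [← Real.rpow_add (by positivity)]
      congr 1
      ring
    have hαD : α / β ≤ ((4 : ℝ) ^ j) ^ δ * D := by
      rw [hD, mul_div_assoc', hp4, le_div_iff₀ (by positivity)]
      exact hj
    rw [e, Real.mul_rpow (by positivity) hρ.le]
    calc α * ψ (ρ / N) = α / β * (β * ψ (ρ / N)) := by field_simp
      _ ≤ ((4 : ℝ) ^ j) ^ δ * D * (ρ ^ δ * primeTail δ N) := by gcongr
      _ = ((4 : ℝ) ^ j) ^ δ * ρ ^ δ * (D * primeTail δ N) := by ring
      _ ≤ _ := by gcongr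
  rw [hJ]
  calc primeMass δ (Ici N) ≤ ENNReal.ofReal (C * primeTail δ N) := hCN N hN
    _ = ENNReal.ofReal (C / (c * D)) * ENNReal.ofReal (c * (D * primeTail δ N)) := by
        rw [← ENNReal.ofReal_mul (by positivity)]
        congr 1
        field_simp
    _ ≤ ENNReal.ofReal (C / (c * D)) * ENNReal.ofReal (c * primeTail δ (4 ^ j * N)) := by
        gcongr
    _ ≤ _ := by
        gcongr
        exact (hcN _ hN').trans (measure_mono hsub)

lemma tsum_primeMass_heavyDigits_ne_top {δ : ℝ} (hδ : 1 / 2 < δ) (hδ₁ : δ < 1) {ψ : ℝ → ℝ}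
    (hpos : ∀ r, 0 < r → 0 < ψ r) {α β : ℝ} (hα : 0 < α) (hβ : 0 < β)
    (h : ∑' n : ℕ, primeMass δ (heavyDigits ψ δ α ((1 / 4) ^ n)) ≠ ⊤) :
    ∑' n : ℕ, primeMass δ (heavyDigits ψ δ β ((1 / 4) ^ n)) ≠ ⊤ := by
  obtain ⟨j, K, hK, hle⟩ := exists_primeMass_heavyDigits_le hδ hδ₁ ψ hpos hα hβ
  have h2 := (ENNReal.summable (f := fun n : ℕ =>
    primeMass δ (heavyDigits ψ δ β ((1 / 4) ^ (n + j))))).sum_add_tsum_nat_add'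
    (f := fun n : ℕ => primeMass δ (heavyDigits ψ δ β ((1 / 4) ^ n)))
  rw [← h2]
  refine ENNReal.add_ne_top.2 ⟨ENNReal.sum_ne_top.2 fun i _ => primeMass_ne_top hδ _, ?_⟩
  refine ne_top_of_le_ne_top (ENNReal.mul_ne_top (ENNReal.ofReal_ne_top (r := K)) h) ?_
  rw [← ENNReal.tsum_mul_left]
  refine ENNReal.tsum_le_tsum fun n => (hle _ (by positivity)).trans (le_of_eq ?_)
  rw [pow_add, mul_comm ((1 / 4 : ℝ) ^ n), ← mul_assoc, ← mul_pow]
  norm_num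

/-! ### Mass of balls in terms of the next digit -/

/-- The first digits of the points of the prime Cantor set within distance `r` of `y`. -/
def nearDigits (y r : ℝ) : Set ℕ := {b | ∃ z ∈ primeCantor, digit z = b ∧ |z - y| ≤ r}

lemma primeCantor_mul_bounds {x : ℝ} (hx : x ∈ primeCantor) :
    0 < x ∧ x ≤ 1 / 2 ∧ x * digit x ≤ 1 ∧ 1 ≤ x * (digit x + 1 / 2) ∧
      0 ≤ shift x ∧ shift x ≤ 1 / 2 ∧ x * (digit x + shift x) = 1 ∧ 2 ≤ digit x := by
  obtain ⟨hp, hs⟩ := digit_prime_and_shift_mem hx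
  have h1 := primeCantor_subset hs
  have h2 := primeCantor_subset hx
  have e : x * (digit x + shift x) = 1 := by
    rw [shift, add_sub_cancel, mul_one_div, div_self h2.1.ne']
  refine ⟨h2.1, h2.2, ?_, ?_, h1.1.le, h1.2, e, hp.two_le⟩
  · nlinarith [h1.1, h2.1]
  · nlinarith [h1.2, h2.1]

section

variable {δ : ℝ} (hδ : 1 / 2 < δ)
include hδ

lemma exists_primeMass_nearDigits_le_tail : ∃ C : ℝ, 0 < C ∧ ∀ y r : ℝ, y ∈ primeCantor →
    r < 1 / 8 → 1 ≤ 4 * r * digit y →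
      ∃ N : ℕ, 2 ≤ N ∧ N ≤ digit y ∧ 1 ≤ 15 * r * N ∧
        primeMass δ (nearDigits y r) ≤ ENNReal.ofReal (C * primeTail δ N) := by
  obtain ⟨C, hC, hCN⟩ := exists_primeMass_le hδ
  refine ⟨C, hC, fun y r hy hr hra => ?_⟩
  obtain ⟨hy0, hy2, hya, hya', -, -, -, ha2⟩ := primeCantor_mul_bounds hy
  have ha0 : (2 : ℝ) ≤ digit y := by exact_mod_cast ha2
  have hr0 : 0 < r := by
    by_contra! h
    nlinarith
  set q : ℝ := 1 / (10 * r) with hq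
  have hqr : q * (10 * r) = 1 := by rw [hq]; field_simp
  have hq0 : 0 < q := by positivity
  refine ⟨max 2 ⌊q⌋₊, le_max_left _ _, max_le ha2 ?_, ?_, ?_⟩
  · refine Nat.floor_le_of_le (le_of_mul_le_mul_right ?_ (by positivity : 0 < 10 * r))
    nlinarith
  · have h1 := Nat.lt_floor_add_one q
    have h2 : (2 : ℝ) ≤ (max 2 ⌊q⌋₊ : ℕ) := by exact_mod_cast le_max_left _ _
    have h3 : (⌊q⌋₊ : ℝ) ≤ (max 2 ⌊q⌋₊ : ℕ) := by exact_mod_cast le_max_right _ _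
    nlinarith
  · refine (measure_mono ?_).trans (hCN _ (le_max_left _ _))
    rintro b ⟨z, hz, rfl, hzy⟩
    obtain ⟨hz0, -, -, hzb, -, -, -, hb2⟩ := primeCantor_mul_bounds hz
    refine max_le hb2 ?_
    have hb2' : (2 : ℝ) ≤ digit z := by exact_mod_cast hb2
    refine Nat.floor_le_of_le ?_
    have hz5 : z ≤ 5 * r := by
      have := (abs_le.1 hzy).2
      have : y ≤ 4 * r := by nlinarith
      linarith
    have : 2 * q ≤ digit z + 1 / 2 := by
      have h1 : 1 ≤ 5 * r * (digit z + 1 / 2) := hzb.trans (by gcongr)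
      have h2 : 2 * q * (5 * r) = 1 := by linarith
      have h3 : 2 * q * (5 * r) ≤ (digit z + 1 / 2) * (5 * r) := by linarith
      exact le_of_mul_le_mul_right h3 (by positivity)
    linarith

omit hδ in
lemma nearDigits_bounds {y r : ℝ} (hy : y ∈ primeCantor) (hra : 4 * r * digit y ≤ 1)
    (hra' : 1 ≤ 32 * r * (digit y : ℝ) ^ 2) {b : ℕ} (hb : b ∈ nearDigits y r) :
    |(b : ℝ) - digit y| ≤ 32 * r * (digit y : ℝ) ^ 2 ∧ b ≤ 2 * digit y ∧ digit y ≤ 3 * b := by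
  obtain ⟨z, hz, rfl, hzy⟩ := hb
  obtain ⟨hy0, hy2, hya, hya', hv0, hv1, hyv, ha2⟩ := primeCantor_mul_bounds hy
  obtain ⟨hz0, hz2, hzb, hzb', hu0, hu1, hzu, hb2⟩ := primeCantor_mul_bounds hz
  have ha2' : (2 : ℝ) ≤ digit y := by exact_mod_cast ha2
  have hb2' : (2 : ℝ) ≤ digit z := by exact_mod_cast hb2
  rw [← Nat.cast_le (α := ℝ), ← Nat.cast_le (α := ℝ)]
  push_cast
  set a : ℝ := (digit y : ℝ)
  set b : ℝ := (digit z : ℝ)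
  have hr0 : 0 < r := by
    by_contra! h
    nlinarith [sq_nonneg a]
  obtain ⟨h1, h2⟩ := abs_le.1 hzy
  have hya3 : 3 / 4 ≤ y * a := by linarith
  have hda := mul_le_mul_of_nonneg_right h1 (by linarith : 0 ≤ a)
  have hda' := mul_le_mul_of_nonneg_right h2 (by linarith : 0 ≤ a)
  have hza1 : 1 / 2 ≤ z * a := by linarith
  have hza2 : z * a ≤ 5 / 4 := by linarith
  refine ⟨?_, ?_, ?_⟩
  · have hprod : 3 / 8 ≤ (y * z) * a ^ 2 := by
      calc (3 : ℝ) / 8 = 3 / 4 * (1 / 2) := by norm_num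
        _ ≤ y * a * (z * a) := by gcongr
        _ = (y * z) * a ^ 2 := by ring
    have hdiff : |(b + shift z) - (a + shift y)| * (y * z) ≤ r := by
      rw [← abs_of_pos (mul_pos hy0 hz0), ← abs_mul]
      have : ((b + shift z) - (a + shift y)) * (y * z) = y - z := by
        calc _ = y * (z * (b + shift z)) - z * (y * (a + shift y)) := by ring
          _ = y - z := by rw [hzu, hyv, mul_one, mul_one]
      rw [this, abs_sub_comm]
      exact hzy
    set t := |(b + shift z) - (a + shift y)| with ht
    have ht0 : 0 ≤ t := abs_nonneg _
    have ht3 : t ≤ 3 * r * a ^ 2 := by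
      have : t * (y * z * a ^ 2) ≤ r * a ^ 2 := by
        rw [← mul_assoc]
        gcongr
      have h3 := mul_le_mul_of_nonneg_left hprod ht0
      linarith
    have htri : |b - a| ≤ t + 1 / 2 := by
      obtain ⟨h3, h4⟩ := abs_le.1 ht.ge
      rw [abs_le]
      constructor <;> linarith
    linarith
  · refine le_of_mul_le_mul_left ?_ hz0
    linarith
  · have h3 : a ≤ 5 / 4 * (b + 1 / 2) := by
      refine le_of_mul_le_mul_left ?_ hz0
      linarith
    linarith

lemma exists_primeMass_nearDigits_le_mul (hδ₁ : δ < 1) : ∃ C : ℝ, 0 < C ∧ ∀ y r : ℝ,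
    y ∈ primeCantor → 4 * r * digit y ≤ 1 → 1 ≤ 32 * r * (digit y : ℝ) ^ 2 →
      primeMass δ (nearDigits y r) ≤
        ENNReal.ofReal (C * ((digit y * r) ^ δ * primeTail δ (digit y))) := by
  obtain ⟨C, hC, hCF⟩ := exists_card_primes_near_le (by linarith : 0 < δ) hδ₁
  refine ⟨C * 32 * 9, by positivity, fun y r hy hra hra' => ?_⟩
  obtain ⟨hy0, hy2, hya, hya', hv0, hv1, hyv, ha2⟩ := primeCantor_mul_bounds hy
  set a : ℕ := digit y with ha
  have ha0 : (0 : ℝ) < a := by positivity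
  have hr0 : 0 < r := by
    by_contra! h
    nlinarith [sq_nonneg (a : ℝ)]
  have hl := log_nat_pos ha2
  classical
  set F : Finset ℕ := {b ∈ Finset.range (2 * a + 1) | b ∈ nearDigits y r ∧ b.Prime} with hF
  have hFmem : ∀ b ∈ F, b ∈ nearDigits y r ∧ b.Prime := fun b hb => (Finset.mem_filter.1 hb).2
  have hcard := hCF a (32 * r * (a : ℝ) ^ 2) F ha2 hra' fun b hb => by
    obtain ⟨h1, h2, -⟩ := nearDigits_bounds hy hra hra' (hFmem b hb).1
    exact ⟨(hFmem b hb).2, h1, by omega⟩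
  refine (primeMass_le_of_subset δ (F := F) (fun b hb => (hFmem b hb).2) fun b hb hp => ?_).trans
    (ENNReal.ofReal_le_ofReal ?_)
  · rw [hF, Finset.mem_filter, Finset.mem_range]
    have := (nearDigits_bounds hy hra hra' hb).2.1
    exact ⟨by omega, hb, hp⟩
  have hterm : ∀ b ∈ F, (b : ℝ) ^ (-(2 * δ)) ≤ 9 * (a : ℝ) ^ (-(2 * δ)) := fun b hb => by
    have h3 := (nearDigits_bounds hy hra hra' (hFmem b hb).1).2.2
    have h3' : (a : ℝ) / 3 ≤ b := by
      rw [div_le_iff₀ (by norm_num)]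
      exact_mod_cast (by omega : a ≤ b * 3)
    calc (b : ℝ) ^ (-(2 * δ)) ≤ ((a : ℝ) / 3) ^ (-(2 * δ)) :=
          Real.rpow_le_rpow_of_nonpos (by positivity) h3' (by linarith)
      _ = (3 : ℝ) ^ (2 * δ) * (a : ℝ) ^ (-(2 * δ)) := by
          rw [Real.div_rpow ha0.le (by norm_num), Real.rpow_neg (by norm_num : (0 : ℝ) ≤ 3)]
          field_simp
      _ ≤ 9 * (a : ℝ) ^ (-(2 * δ)) := by
          gcongr
          calc (3 : ℝ) ^ (2 * δ) ≤ 3 ^ (2 : ℝ) :=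
                Real.rpow_le_rpow_of_exponent_le (by norm_num) (by linarith)
            _ = 9 := by norm_num
  have hpow : (a : ℝ) ^ (1 - δ) * (32 * r * (a : ℝ) ^ 2) ^ δ * (a : ℝ) ^ (-(2 * δ)) ≤
      32 * ((a * r) ^ δ * (a : ℝ) ^ (1 - 2 * δ)) := by
    have e1 : (32 * r * (a : ℝ) ^ 2) ^ δ = 32 ^ δ * ((a * r) ^ δ * (a : ℝ) ^ δ) := by
      rw [← Real.mul_rpow (by positivity) (by positivity),
        ← Real.mul_rpow (by positivity) (by positivity)]
      congr 1
      ring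
    have e2 : (a : ℝ) ^ (1 - δ) * (a : ℝ) ^ δ * (a : ℝ) ^ (-(2 * δ)) = (a : ℝ) ^ (1 - 2 * δ) := by
      rw [← Real.rpow_add ha0, ← Real.rpow_add ha0]
      congr 1
      ring
    have h32 : (32 : ℝ) ^ δ ≤ 32 := by
      calc (32 : ℝ) ^ δ ≤ 32 ^ (1 : ℝ) :=
            Real.rpow_le_rpow_of_exponent_le (by norm_num) hδ₁.le
        _ = 32 := Real.rpow_one _
    calc _ = 32 ^ δ * ((a * r) ^ δ *
          ((a : ℝ) ^ (1 - δ) * (a : ℝ) ^ δ * (a : ℝ) ^ (-(2 * δ)))) := by rw [e1]; ring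
      _ ≤ _ := by
          rw [e2]
          gcongr
  calc ∑ b ∈ F, (b : ℝ) ^ (-(2 * δ)) ≤ F.card • (9 * (a : ℝ) ^ (-(2 * δ))) :=
        Finset.sum_le_card_nsmul _ _ _ hterm
    _ = F.card * (9 * (a : ℝ) ^ (-(2 * δ))) := nsmul_eq_mul _ _
    _ ≤ C * ((a : ℝ) ^ (1 - δ) * (32 * r * (a : ℝ) ^ 2) ^ δ) / Real.log a *
          (9 * (a : ℝ) ^ (-(2 * δ))) := by gcongr
    _ = C * 9 / Real.log a *
          ((a : ℝ) ^ (1 - δ) * (32 * r * (a : ℝ) ^ 2) ^ δ * (a : ℝ) ^ (-(2 * δ))) := by ring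
    _ ≤ C * 9 / Real.log a * (32 * ((a * r) ^ δ * (a : ℝ) ^ (1 - 2 * δ))) := by gcongr
    _ = _ := by rw [primeTail]; ring

end

/-! ### The convergent case -/

lemma closedBall_inter_subset {x r : ℝ} {n : ℕ} (hx : x ∈ primeCantor)
    (hr : r < rho (digits n x) / 32) :
    closedBall x r ∩ primeCantor ⊆ wordMap (digits n x) ''
      firstDigitIn (nearDigits (shift^[n] x) (4 * r / rho (digits n x))) := by
  rintro z ⟨hz, hzΛ⟩
  have hω := digits_primeWord hx n
  have hρ := rho_pos hω.posWord
  have hy := shift_iterate_mem hx n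
  have hzx : |z - x| ≤ r := by simpa [Real.dist_eq] using hz
  have hxim : x ∈ wordMap (digits n x) '' primeCantor := ⟨_, hy, wordMap_digits n x⟩
  have hzim : z ∈ wordMap (digits n x) '' primeCantor := by
    by_contra h
    have := cylinder_separation primeWord_nil hω hxim hzΛ h
    rw [List.nil_append] at this
    simp only [wordMap] at this
    rw [abs_sub_comm] at this
    linarith
  obtain ⟨w, hw, rfl⟩ := hzim
  refine ⟨w, ⟨hw, w, hw, rfl, ?_⟩, rfl⟩
  have hyI := primeCantor_subset hy
  have hwI := primeCantor_subset hw
  have h := le_dist_wordMap hω.posWord hwI.1.le (hwI.2.trans (by norm_num)) hyI.1.le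
    (hyI.2.trans (by norm_num))
  rw [wordMap_digits] at h
  rw [le_div_iff₀ hρ]
  linarith

lemma one_le_of_rho_succ_le {x r : ℝ} {n : ℕ} (hx : x ∈ primeCantor)
    (hr : rho (digits (n + 1) x) / 32 ≤ r) :
    1 ≤ 32 * (4 * r / rho (digits n x)) * (digit (shift^[n] x) : ℝ) ^ 2 := by
  have hω := digits_primeWord hx n
  have hρ := rho_pos hω.posWord
  have hp := (digit_prime_and_shift_mem (shift_iterate_mem hx n)).1
  have ha : (0 : ℝ) < digit (shift^[n] x) := by exact_mod_cast hp.pos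
  rw [digits_succ'] at hr
  have h := le_rho_append hω.posWord (primeWord_singleton hp).posWord
  rw [rho_singleton, ← div_eq_mul_inv, div_div, div_le_iff₀ (by positivity)] at h
  have h' : rho (digits n x ++ [digit (shift^[n] x)]) * ((digit (shift^[n] x) : ℝ) ^ 2 * 4) ≤
      32 * r * ((digit (shift^[n] x) : ℝ) ^ 2 * 4) := by
    gcongr
    linarith
  rw [mul_div_assoc', div_mul_eq_mul_div, le_div_iff₀ hρ]
  linarith

lemma exists_rho_digits_scale {x r : ℝ} {n₀ : ℕ} (hx : x ∈ primeCantor) (hr0 : 0 < r)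
    (hr : r < rho (digits n₀ x) / 32) :
    ∃ n, n₀ ≤ n ∧ rho (digits (n + 1) x) / 32 ≤ r ∧ r < rho (digits n x) / 32 := by
  classical
  have hex : ∃ k, rho (digits (n₀ + k + 1) x) / 32 ≤ r := by
    obtain ⟨k, hk⟩ := exists_pow_lt_of_lt_one hr0 (by norm_num : (1 / 4 : ℝ) < 1)
    refine ⟨k, ?_⟩
    have h1 := rho_le_pow (digits_primeWord hx (n₀ + k + 1))
    rw [digits_length] at h1
    have h2 : (1 / 4 : ℝ) ^ (n₀ + k + 1) ≤ (1 / 4) ^ k :=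
      pow_le_pow_of_le_one (by norm_num) (by norm_num) (by omega)
    have h3 := rho_pos (digits_primeWord hx (n₀ + k + 1)).posWord
    linarith
  refine ⟨n₀ + Nat.find hex, by omega, Nat.find_spec hex, ?_⟩
  rcases h : Nat.find hex with _ | k
  · simpa using hr
  · have := Nat.find_min hex (m := k) (by omega)
    rw [not_le] at this
    exact this

section

variable {δ : ℝ} (hδ : 1 / 2 < δ) (hδ₁ : δ < 1)
include hδ hδ₁

lemma IsQuasiConformal.exists_measure_closedBall_le {ψ : ℝ → ℝ} {D : ℝ} (hD : 0 < D)
    (hpos : ∀ r, 0 < r → 0 < ψ r) (hψ : MonotoneOn ψ (Ioi 0))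
    (hD60 : ∀ r, 0 < r → ψ (60 * r) ≤ D * ψ r)
    (hanti : AntitoneOn (fun r : ℝ => r ^ (-δ) * ψ r) (Ioi 0)) :
    ∃ C : ℝ, 0 < C ∧ ∀ (ν : Measure ℝ) (_ : IsQuasiConformal δ ν) (β : ℝ) (_ : 0 < β)
      (x : ℝ) (_ : x ∈ primeCantor) (n₀ : ℕ)
      (_ : ∀ n, n₀ ≤ n → digit (shift^[n] x) ∉ heavyDigits ψ δ β (rho (digits n x)))
      (r : ℝ) (_ : 0 < r) (_ : r < rho (digits n₀ x) / 32),
      ν (closedBall x r) ≤ ENNReal.ofReal (C * β * ψ r) * ν univ := by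
  obtain ⟨C₁, hC₁, h₁⟩ := exists_primeMass_nearDigits_le_tail hδ
  obtain ⟨C₂, hC₂, h₂⟩ := exists_primeMass_nearDigits_le_mul hδ hδ₁
  refine ⟨(C₁ + C₂) * D, by positivity, fun ν hν β hβ x hx n₀ hn₀ r hr0 hr => ?_⟩
  obtain ⟨n, hn, hrn, hrn'⟩ := exists_rho_digits_scale hx hr0 hr
  have hω := digits_primeWord hx n
  have hρ := rho_pos hω.posWord
  have hy := shift_iterate_mem hx n
  have hlight := hn₀ n hn
  have hsq := one_le_of_rho_succ_le hx hrn
  have hsub := closedBall_inter_subset hx hrn'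
  have hψ0 : ∀ s, 0 < s → s ≤ 60 * r → ψ s ≤ D * ψ r := fun s hs hs' =>
    (hψ hs (show 0 < 60 * r by positivity) hs').trans (hD60 r hr0)
  have ha2 := (digit_prime_and_shift_mem hy).1.two_le
  set ρ := rho (digits n x)
  set y := shift^[n] x
  set r' := 4 * r / ρ with hr'
  have hr'ρ : ρ * r' = 4 * r := by rw [hr']; field_simp
  have hr'0 : 0 < r' := by positivity
  have hr'8 : r' < 1 / 8 := by
    rw [hr', div_lt_iff₀ hρ]
    linarith
  have hlt : ∀ N : ℕ, 2 ≤ N → N ≤ digit y → ρ ^ δ * primeTail δ N ≤ β * ψ (ρ / N) :=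
    fun N hN hNa => by
      by_contra! h
      exact hlight ⟨N, hN, hNa, h.le⟩
  have hmass : ∃ M : ℝ, primeMass δ (nearDigits y r') ≤ ENNReal.ofReal M ∧
      ρ ^ δ * M ≤ (C₁ + C₂) * D * β * ψ r := by
    have hψr : 0 < ψ r := hpos r hr0
    rcases le_total 1 (4 * r' * digit y) with hc | hc
    · obtain ⟨N, hN2, hNa, hN15, hN⟩ := h₁ y r' hy hr'8 hc
      refine ⟨_, hN, ?_⟩
      have hN0 : (0 : ℝ) < N := by positivity
      have h3 : ψ (ρ / N) ≤ D * ψ r := by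
        refine hψ0 _ (by positivity) ?_
        rw [div_le_iff₀ hN0]
        nlinarith
      calc ρ ^ δ * (C₁ * primeTail δ N) = C₁ * (ρ ^ δ * primeTail δ N) := by ring
        _ ≤ C₁ * (β * ψ (ρ / N)) := 
            mul_le_mul_of_nonneg_left (hlt N hN2 hNa) hC₁.le
        _ ≤ C₁ * (β * (D * ψ r)) := by gcongr
        _ ≤ (C₁ + C₂) * (β * (D * ψ r)) := by gcongr; linarith
        _ = _ := by ring
    · refine ⟨_, h₂ y r' hy hc hsq, ?_⟩
      have ha0 : (0 : ℝ) < digit y := by positivity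
      have h3 : (digit y * r') ^ δ * ψ (ρ / digit y) ≤ D * ψ r := by
        refine le_trans ?_ (hψ0 (ρ * r') (by positivity) (by linarith))
        have h4 := hanti (show 0 < ρ * r' by positivity) (show 0 < ρ / digit y by positivity) (by
          rw [div_eq_mul_inv]
          gcongr
          rw [← one_div, le_div_iff₀ ha0]
          nlinarith)
        calc (digit y * r') ^ δ * ψ (ρ / digit y)
            = (ρ * r') ^ δ * ((ρ / digit y) ^ (-δ) * ψ (ρ / digit y)) := by
              rw [← mul_assoc, Real.rpow_neg (by positivity), ← Real.inv_rpow (by positivity),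
                ← Real.mul_rpow (by positivity) (by positivity)]
              congr 2
              field_simp
          _ ≤ (ρ * r') ^ δ * ((ρ * r') ^ (-δ) * ψ (ρ * r')) := by gcongr
          _ = ψ (ρ * r') := by
              rw [← mul_assoc, ← Real.rpow_add (by positivity), add_neg_cancel, Real.rpow_zero,
                one_mul]
      calc ρ ^ δ * (C₂ * ((digit y * r') ^ δ * primeTail δ (digit y)))
          = C₂ * ((digit y * r') ^ δ * (ρ ^ δ * primeTail δ (digit y))) := by ring
        _ ≤ C₂ * ((digit y * r') ^ δ * (β * ψ (ρ / digit y))) := by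
            refine mul_le_mul_of_nonneg_left ?_ hC₂.le
            exact mul_le_mul_of_nonneg_left (hlt _ ha2 le_rfl) (by positivity)
        _ = C₂ * (β * ((digit y * r') ^ δ * ψ (ρ / digit y))) := by ring
        _ ≤ C₂ * (β * (D * ψ r)) := by gcongr
        _ ≤ (C₁ + C₂) * (β * (D * ψ r)) := by gcongr; linarith
        _ = _ := by ring
  obtain ⟨M, hM, hM'⟩ := hmass
  calc ν (closedBall x r) ≤ ν (closedBall x r ∩ primeCantor ∪ primeCantorᶜ) :=
        measure_mono fun z hz => (em (z ∈ primeCantor)).imp (fun h => ⟨hz, h⟩) id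
    _ ≤ ν (wordMap (digits n x) '' firstDigitIn (nearDigits y r')) + ν primeCantorᶜ :=
        (measure_union_le _ _).trans (by gcongr)
    _ ≤ ENNReal.ofReal (ρ ^ δ) * (primeMass δ (nearDigits y r') * ν univ) := by
        rw [hν.compl_null, add_zero]
        exact hν.image_firstDigitIn_le hω _
    _ ≤ ENNReal.ofReal (ρ ^ δ) * (ENNReal.ofReal M * ν univ) := by gcongr
    _ = ENNReal.ofReal (ρ ^ δ * M) * ν univ := by
        rw [← mul_assoc, ENNReal.ofReal_mul (by positivity)]
    _ ≤ _ := by gcongr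

end

lemma image_gaussMap_subset_primeCantor {a : ℕ} (ha : a.Prime) {A : Set ℝ} (hA : A ⊆ primeCantor) :
    gaussMap a '' A ⊆ primeCantor := by
  rw [image_gaussMap_eq ha hA]
  exact inter_subset_right

lemma hausdorffPsi_primeCantor_eq_zero_of_convergent {ψ : ℝ → ℝ} {δ D : ℝ} (hδ : 1 / 2 < δ)
    (hδ₁ : δ < 1) (hψ₀ : Tendsto ψ (𝓝[>] 0) (𝓝 0)) (hD : 0 < D) (hpos : ∀ r, 0 < r → 0 < ψ r)
    (hψ : MonotoneOn ψ (Ioi 0)) (hD60 : ∀ r, 0 < r → ψ (60 * r) ≤ D * ψ r)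
    (hanti : AntitoneOn (fun r : ℝ => r ^ (-δ) * ψ r) (Ioi 0))
    (hν : IsQuasiConformal δ ((hausdorffPsi ψ).restrict primeCantor))
    (hsum : ∀ β : ℝ, 0 < β → ∑' n : ℕ, primeMass δ (heavyDigits ψ δ β ((1 / 4) ^ n)) ≠ ⊤) :
    hausdorffPsi ψ primeCantor = 0 := by
  obtain ⟨C, hC, hball⟩ := IsQuasiConformal.exists_measure_closedBall_le hδ hδ₁ hD hpos hψ hD60 hanti
  set ν := (hausdorffPsi ψ).restrict primeCantor with hνdef
  have : IsFiniteMeasure ν := ⟨hν.finite.lt_top⟩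
  set m : ℝ := (ν univ).toReal with hm
  have hm0 : 0 ≤ m := ENNReal.toReal_nonneg
  set β : ℝ := 1 / (2 * C * (m + 1)) with hβ
  have hβ0 : 0 < β := by positivity
  have hκ : C * β * m ≤ 1 / 2 := by
    rw [hβ, mul_one_div, div_mul_eq_mul_div, div_le_div_iff₀ (by positivity) (by norm_num)]
    nlinarith
  set J : List ℕ → Set ℕ := fun ω => heavyDigits ψ δ β (rho ω) with hJ
  have hfin : ∑' n, ν (nextDigitIn n J) ≠ ⊤ := by
    refine ne_top_of_le_ne_top ?_ (ENNReal.tsum_le_tsum fun n =>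
      hν.nextDigitIn_le (s := primeMass δ (heavyDigits ψ δ β ((1 / 4) ^ n))) ?_)
    · rw [ENNReal.tsum_mul_left, ENNReal.tsum_mul_right]
      exact ENNReal.mul_ne_top (by norm_num)
        (ENNReal.mul_ne_top (hsum β hβ0) (measure_ne_top _ _))
    · rintro ω hω rfl
      exact measure_mono (heavyDigits_mono hβ0.le hanti (rho_pos hω.posWord) (rho_le_pow hω))
  have hBC := measure_setOfPred_frequently_eq_zero hfin
  set G : ℕ → Set ℝ := fun k => {x ∈ primeCantor | ∀ r, 0 < r → r < 1 / ((k : ℝ) + 1) →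
    ν (closedBall x r) ≤ ENNReal.ofReal (1 / 2 * ψ r)} with hG
  have hGν : ∀ k, ν (G k) = hausdorffPsi ψ (G k) := fun k => by
    rw [hνdef, Measure.restrict_apply' measurableSet_primeCantor,
      inter_eq_self_of_subset_left fun x hx => hx.1]
  have hG0 : ∀ k, ν (G k) = 0 := fun k => by
    have h1 := measure_le_hausdorffPsi hψ₀ (ν := ν) (G := G k) (κ := 1 / 2)
      (ε := 1 / ((k : ℝ) + 1)) (by norm_num) (by positivity) fun x hx => hx.2
    rw [← hGν] at h1
    by_contra h0
    have h2 : ENNReal.ofReal (1 / 2) * ν (G k) < 1 * ν (G k) := by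
      rw [ENNReal.mul_lt_mul_iff_left h0 (measure_ne_top _ _)]
      exact ENNReal.ofReal_lt_one.2 (by norm_num)
    rw [one_mul] at h2
    exact absurd h1 (not_le.2 h2)
  have hcover : primeCantor ⊆ {x | ∃ᶠ n in atTop, x ∈ nextDigitIn n J} ∪ ⋃ k, G k := by
    intro x hx
    by_cases hfr : ∃ᶠ n in atTop, x ∈ nextDigitIn n J
    · exact Or.inl hfr
    refine Or.inr (mem_iUnion.2 ?_)
    obtain ⟨n₀, hn₀⟩ := eventually_atTop.1 (not_frequently.1 hfr)
    have hr0 : 0 < rho (digits n₀ x) / 32 :=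
      div_pos (rho_pos (digits_primeWord hx n₀).posWord) (by norm_num)
    obtain ⟨k, hk⟩ := exists_nat_one_div_lt hr0
    refine ⟨k, hx, fun r hr hrk => ?_⟩
    refine (hball ν hν β hβ0 x hx n₀ (fun n hn h => hn₀ n hn ⟨hx, h⟩) r hr (hrk.trans hk)).trans ?_
    rw [← ENNReal.ofReal_toReal (measure_ne_top ν univ), ← hm,
      ← ENNReal.ofReal_mul (by have := hpos r hr; positivity)]
    refine ENNReal.ofReal_le_ofReal ?_
    calc C * β * ψ r * m = C * β * m * ψ r := by ring
      _ ≤ 1 / 2 * ψ r := mul_le_mul_of_nonneg_right hκ (hpos r hr).le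
  have h0 : ν primeCantor = 0 :=
    measure_mono_null hcover (measure_union_null hBC (measure_iUnion_null hG0))
  rwa [hνdef, Measure.restrict_apply_self] at h0

/-! ### The zero-infinity law -/

lemma IsDoubling.exists_mul_le {ψ : ℝ → ℝ} (hψ : IsDoubling ψ) (hpos : ∀ r, 0 < r → 0 < ψ r)
    {K : ℝ} (hK : 1 ≤ K) : ∃ C : ℝ, 0 < C ∧ ∀ r, 0 < r → ψ (K * r) ≤ C * ψ r := by
  obtain ⟨C, hC, h⟩ := hψ K hK
  refine ⟨C, by linarith, fun r hr => ?_⟩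
  have e : K * r / r = K := by field_simp
  have := (h (K * r) r (by positivity) hr (by rw [e]; exact (inv_le_one_of_one_le₀ hK).trans hK)
    e.le).2
  rwa [div_le_iff₀ (hpos r hr)] at this

lemma exists_Ici_subset_heavyDigits {ψ : ℝ → ℝ} {δ α : ℝ} (hδ₁ : δ < 1) (hα : 0 ≤ α)
    (hmono : MonotoneOn (fun r : ℝ => r ^ (-δ) * ψ r) (Ioi 0)) :
    ∃ N : ℕ, 2 ≤ N ∧ ∀ r : ℝ, 0 < r → r ≤ 1 → Ici N ⊆ heavyDigits ψ δ α r := by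
  have hlog : Tendsto (fun N : ℕ => Real.log N / (N : ℝ) ^ (1 - δ)) atTop (𝓝 0) :=
    ((isLittleO_log_rpow_atTop (by linarith : 0 < 1 - δ)).tendsto_div_nhds_zero).comp
      tendsto_natCast_atTop_atTop
  have hlog' := hlog.const_mul (α * ψ 1)
  rw [mul_zero] at hlog'
  obtain ⟨N, hN, hN2⟩ := ((hlog'.eventually (gt_mem_nhds one_pos)).and
    (eventually_ge_atTop 2)).exists
  refine ⟨N, hN2, fun r hr hr1 a ha => ⟨N, hN2, ha, ?_⟩⟩
  have hN0 : (0 : ℝ) < N := by positivity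
  have hN1 : (1 : ℝ) ≤ N := by exact_mod_cast (by omega : 1 ≤ N)
  have hl := log_nat_pos hN2
  rw [mul_div_assoc', div_lt_one (by positivity)] at hN
  have h1 := hmono (show 0 < r / N by positivity) (show (0 : ℝ) < 1 by norm_num)
    ((div_le_one hN0).2 (hr1.trans hN1))
  simp only [Real.one_rpow, one_mul] at h1
  have h2 : ψ (r / N) ≤ (r / N) ^ δ * ψ 1 := by
    rw [Real.rpow_neg (by positivity), inv_mul_le_iff₀ (by positivity)] at h1
    exact h1
  calc α * ψ (r / N) ≤ α * ((r / N) ^ δ * ψ 1) := by gcongr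
    _ = r ^ δ * ((α * ψ 1 * Real.log N) * (N : ℝ) ^ (-δ) / Real.log N) := by
        rw [Real.div_rpow hr.le hN0.le, Real.rpow_neg hN0.le]
        field_simp
    _ ≤ r ^ δ * ((N : ℝ) ^ (1 - δ) * (N : ℝ) ^ (-δ) / Real.log N) := by gcongr
    _ = r ^ δ * primeTail δ N := by
        rw [primeTail, ← Real.rpow_add hN0]
        ring_nf

lemma hausdorffPsi_eq_zero_or_top_of_antitone {ψ : ℝ → ℝ} {δ : ℝ} (hδ : 1 / 2 < δ) (hδ₁ : δ < 1)
    (hp : pressure primes δ = 0) (hdim : IsDimFun ψ) (hdbl : IsDoubling ψ)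
    (hanti : AntitoneOn (fun r : ℝ => r ^ (-δ) * ψ r) (Ioi 0)) :
    hausdorffPsi ψ primeCantor = 0 ∨ hausdorffPsi ψ primeCantor = ⊤ := by
  obtain ⟨-, hψ, hpos, hψ₀⟩ := hdim
  by_contra! h
  obtain ⟨h0, htop⟩ := h
  obtain ⟨C, hC, hC10⟩ := hdbl.exists_mul_le hpos (by norm_num : (1 : ℝ) ≤ 10)
  obtain ⟨D, hD, hD60⟩ := hdbl.exists_mul_le hpos (by norm_num : (1 : ℝ) ≤ 60)
  have := isFiniteMeasure_restrict.2 htop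
  have hnull : (hausdorffPsi ψ).restrict primeCantor primeCantorᶜ = 0 :=
    (Measure.restrict_apply' measurableSet_primeCantor).trans (by simp)
  have ht := transfer_le (δ := δ) hnull fun a ha A hA hAm => by
    rw [Measure.restrict_restrict_of_subset hA,
      Measure.restrict_eq_self _ (image_gaussMap_subset_primeCantor ha hA)]
    exact lintegral_le_image_of_antitone (by linarith) hψ hanti ha hA hAm
  have hν := isQuasiConformal_of_transfer_eq (by linarith) hδ₁.le hnull
    (transfer_eq hnull hδ hp (Or.inl ht))
  obtain ⟨α, hα, hJ⟩ := exists_measure_lt_top_of_divergent hδ hC hC10 hν h0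
  have hα' := hJ (heavyDigits ψ δ α) (fun r r' hr hrr' => heavyDigits_mono hα.le hanti hr hrr')
    fun r _ _ => Subset.rfl
  exact h0 (hausdorffPsi_primeCantor_eq_zero_of_convergent hδ hδ₁ hψ₀ hD hpos hψ hD60 hanti hν
    fun β hβ => tsum_primeMass_heavyDigits_ne_top hδ hδ₁ hpos hα hβ hα')

lemma hausdorffPsi_eq_zero_or_top_of_monotone {ψ : ℝ → ℝ} {δ : ℝ} (hδ : 1 / 2 < δ) (hδ₁ : δ < 1)
    (hp : pressure primes δ = 0) (hdim : IsDimFun ψ) (hdbl : IsDoubling ψ)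
    (hmono : MonotoneOn (fun r : ℝ => r ^ (-δ) * ψ r) (Ioi 0)) :
    hausdorffPsi ψ primeCantor = 0 ∨ hausdorffPsi ψ primeCantor = ⊤ := by
  obtain ⟨-, hψ, hpos, -⟩ := hdim
  by_contra! h
  obtain ⟨h0, htop⟩ := h
  obtain ⟨C, hC, hC10⟩ := hdbl.exists_mul_le hpos (by norm_num : (1 : ℝ) ≤ 10)
  have := isFiniteMeasure_restrict.2 htop
  have hnull : (hausdorffPsi ψ).restrict primeCantor primeCantorᶜ = 0 :=
    (Measure.restrict_apply' measurableSet_primeCantor).trans (by simp)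
  have ht := le_transfer (δ := δ) hnull fun a ha A hA hAm => by
    rw [Measure.restrict_restrict_of_subset hA,
      Measure.restrict_eq_self _ (image_gaussMap_subset_primeCantor ha hA)]
    exact image_le_lintegral_of_monotone (by linarith) hψ hmono ha hA hAm
  have hν := isQuasiConformal_of_transfer_eq (by linarith) hδ₁.le hnull
    (transfer_eq hnull hδ hp (Or.inr ht))
  obtain ⟨α, hα, hJ⟩ := exists_measure_lt_top_of_divergent hδ hC hC10 hν h0
  obtain ⟨N, hN, hheavy⟩ := exists_Ici_subset_heavyDigits hδ₁ hα.le hmono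
  refine hJ (fun _ => Ici N) (fun _ _ _ _ => Subset.rfl) hheavy (ENNReal.tsum_const_eq_top_of_ne_zero ?_)
  obtain ⟨c, hc, hcN⟩ := exists_le_primeMass hδ
  have h2 : 0 < ENNReal.ofReal (c * primeTail δ N) :=
    ENNReal.ofReal_pos.2 (mul_pos hc (primeTail_pos δ hN))
  exact (h2.trans_le (hcN N hN)).ne'

/-- Corollary. For any doubling dimension function `ψ` such that
`Ψ(r) = r^{-δ} ψ(r)` is monotonic, `H^ψ(Λ_P) ∈ {0, ∞}`. -/
theorem stmt1 (δ : ℝ) (hδ₁ : 1 / 2 < δ) (hδ₂ : δ < 1) (hpress : pressure primes δ = 0)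
    (ψ : ℝ → ℝ) (hdim : IsDimFun ψ) (hdbl : IsDoubling ψ)
    (hmono : MonotoneOn (fun r : ℝ => r ^ (-δ) * ψ r) (Ioi 0) ∨
      AntitoneOn (fun r : ℝ => r ^ (-δ) * ψ r) (Ioi 0)) :
    hausdorffPsi ψ (limitSet primes) = 0 ∨ hausdorffPsi ψ (limitSet primes) = ⊤ := by
  rcases hmono with h | h
  · exact hausdorffPsi_eq_zero_or_top_of_monotone hδ₁ hδ₂ hpress hdim hdbl h
  · exact hausdorffPsi_eq_zero_or_top_of_antitone hδ₁ hδ₂ hpress hdim hdbl h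
end
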